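/- Let f:U→ℝ^n be of the Monge form on an open set U⊂ℝ^d with n=d+m, θ∈ℝ^n, and suppose f is nondegenerate at x_0∈U. Then there exist a small open ball V centred at x_0 and constants C_0, K_0>0 such that for every ball B⊂V there exists t_0=t_0(B,n,f) such that for every t≥t_0 and every ε∈(0,1) with ε > K_0 e^{−ηt}, where η=η(n,d), one has L_d(Δ_θ(t,ε,B,ρ)) ≥ (1/2)·L_d(B), where ρ = (C_0/(ε^m e^{(d+1)t}))^{1/d}. -/

import Mathlib

open MeasureTheory Filter Set
open scoped ENNReal NNReal

noncomputable section

/-- The set `S_n^θ(ψ)` of `(ψ,θ)`-approximable points of `ℝ^n` (sup norm on `Fin n → ℝ`):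
points `x` with `‖x - (p+θ)/q‖ ≤ ψ q / q` for infinitely many `(p,q) ∈ ℤ^n × ℕ`. -/
def SApprox (n : ℕ) (θ : Fin n → ℝ) (ψ : ℝ → ℝ) : Set (Fin n → ℝ) :=
  {x | {pq : (Fin n → ℤ) × ℕ | 0 < pq.2 ∧
    ‖(fun i => x i - ((pq.1 i : ℝ) + θ i) / (pq.2 : ℝ) : Fin n → ℝ)‖ ≤
      ψ (pq.2 : ℝ) / (pq.2 : ℝ)}.Infinite}

/-- Iterated partial derivatives along a list of coordinate directions. -/
def listPDeriv {d n : ℕ} : List (Fin d) → ((Fin d → ℝ) → (Fin n → ℝ)) → ((Fin d → ℝ) → (Fin n → ℝ))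
  | [], f => f
  | i :: is, f => fun x => fderiv ℝ (listPDeriv is f) x (Pi.single i 1)

/-- `f` is `l`-nondegenerate at `x`: `f` is `C^l` near `x` and the partial derivatives of `f`
at `x` of orders `1,…,l` span `ℝ^n`. -/
def IsLNondegenerateAt {d n : ℕ} (l : ℕ) (f : (Fin d → ℝ) → (Fin n → ℝ)) (x : Fin d → ℝ) : Prop :=
  (∃ V ∈ nhds x, ContDiffOn ℝ l f V) ∧
  Submodule.span ℝ {v : Fin n → ℝ | ∃ β : List (Fin d),
    1 ≤ β.length ∧ β.length ≤ l ∧ v = listPDeriv β f x} = ⊤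

def IsNondegenerateAt {d n : ℕ} (f : (Fin d → ℝ) → (Fin n → ℝ)) (x : Fin d → ℝ) : Prop :=
  ∃ l : ℕ, IsLNondegenerateAt l f x

/-- `f` is nondegenerate in `U`: nondegenerate at almost every point of `U`. -/
def IsNondegenerateIn {d n : ℕ} (f : (Fin d → ℝ) → (Fin n → ℝ)) (U : Set (Fin d → ℝ)) : Prop :=
  ∀ᵐ x ∂(volume : Measure (Fin d → ℝ)), x ∈ U → IsNondegenerateAt f x

/-- `f` is nonsingular on `U`: its Jacobian has rank `d` at every point of `U`. -/
def IsNonsingularOn {d n : ℕ} (f : (Fin d → ℝ) → (Fin n → ℝ)) (U : Set (Fin d → ℝ)) : Prop :=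
  ∀ x ∈ U, LinearMap.rank (fderiv ℝ f x).toLinearMap = (d : Cardinal)

/-- `η(n,d)`. -/
def etaND (n d : ℕ) : ℝ := if 1 < d then 1 / ((n : ℝ) - 1) else 3 / (2 * (n : ℝ) - 1)

/-- The set counted by `N*_θ(Δ;ε,t)`. -/
def NstarSet {d n : ℕ} (f : (Fin d → ℝ) → Fin n → ℝ) (θ : Fin n → ℝ)
    (Δ : Set (Fin d → ℝ)) (ε t : ℝ) : Set ((Fin n → ℤ) × ℤ) :=
  {pq | Real.exp (t - 1) ≤ (pq.2 : ℝ) ∧ (pq.2 : ℝ) ≤ Real.exp t ∧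
    sInf ((fun x => ‖(fun i => f x i - ((pq.1 i : ℝ) + θ i) / (pq.2 : ℝ) : Fin n → ℝ)‖) '' Δ)
      ≤ ε / Real.exp t}

/-- `N*_θ(Δ;ε,t)`. -/
def Nstar {d n : ℕ} (f : (Fin d → ℝ) → Fin n → ℝ) (θ : Fin n → ℝ)
    (Δ : Set (Fin d → ℝ)) (ε t : ℝ) : ℕ := (NstarSet f θ Δ ε t).ncard

/-- The set counted by `N_θ(Δ;ε,t)` (with `1 ≤ q ≤ e^t`). -/
def NfullSet {d n : ℕ} (f : (Fin d → ℝ) → Fin n → ℝ) (θ : Fin n → ℝ)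
    (Δ : Set (Fin d → ℝ)) (ε t : ℝ) : Set ((Fin n → ℤ) × ℤ) :=
  {pq | 1 ≤ pq.2 ∧ (pq.2 : ℝ) ≤ Real.exp t ∧
    sInf ((fun x => ‖(fun i => f x i - ((pq.1 i : ℝ) + θ i) / (pq.2 : ℝ) : Fin n → ℝ)‖) '' Δ)
      ≤ ε / Real.exp t}

/-- `N_θ(Δ;ε,t)`. -/
def Nfull {d n : ℕ} (f : (Fin d → ℝ) → Fin n → ℝ) (θ : Fin n → ℝ)
    (Δ : Set (Fin d → ℝ)) (ε t : ℝ) : ℕ := (NfullSet f θ Δ ε t).ncard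

/-- Sup norm of the gradient of a scalar function on `ℝ^d`. -/
def gradSupNorm {d : ℕ} (g : (Fin d → ℝ) → ℝ) (x : Fin d → ℝ) : ℝ :=
  ‖(fun j : Fin d => fderiv ℝ g x (Pi.single j 1) : Fin d → ℝ)‖

/-- The set `𝔖_f(δ,K,T)`. -/
def SfrakSet {d n : ℕ} (U : Set (Fin d → ℝ)) (f : (Fin d → ℝ) → Fin n → ℝ)
    (δ K : ℝ) (T : Fin n → ℝ) : Set (Fin d → ℝ) :=
  {x | x ∈ U ∧ ∃ a₀ : ℤ, ∃ a : Fin n → ℤ, a ≠ 0 ∧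
    |(a₀ : ℝ) + ∑ i, f x i * (a i : ℝ)| < δ ∧
    gradSupNorm (fun y => ∑ i, f y i * (a i : ℝ)) x < K ∧
    ∀ i, |(a i : ℝ)| < T i}

/-- First-order partial derivative `∂_i f_j` (0-based indices as naturals; junk value 0
out of range). -/
def pd1 {d m : ℕ} (f : (Fin d → ℝ) → Fin m → ℝ) (i j : ℕ) (x : Fin d → ℝ) : ℝ :=
  if h : i < d ∧ j < m then
    fderiv ℝ (fun y => f y ⟨j, h.2⟩) x (Pi.single (⟨i, h.1⟩ : Fin d) 1)
  else 0

/-- Second-order partial derivative `∂_{i'} ∂_i f_j`. -/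
def pd2 {d m : ℕ} (f : (Fin d → ℝ) → Fin m → ℝ) (i i' j : ℕ) (x : Fin d → ℝ) : ℝ :=
  if h : i' < d then fderiv ℝ (fun y => pd1 f i j y) x (Pi.single (⟨i', h⟩ : Fin d) 1) else 0

/-- The Monge map `x ↦ (x, f(x)) : ℝ^d → ℝ^{d+m}`. -/
def fullMap (d m : ℕ) (f : (Fin d → ℝ) → Fin m → ℝ) : (Fin d → ℝ) → Fin (d + m) → ℝ :=
  fun x i => if h : (i : ℕ) < d then x ⟨(i : ℕ), h⟩
    else f x ⟨(i : ℕ) - d, by have := i.isLt; omega⟩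

/-- The `i`-th Minkowski successive minimum (w.r.t. the closed unit Euclidean ball) of the
lattice `g ℤ^k`. -/
def succMin {k : ℕ} (i : ℕ) (g : Matrix (Fin k) (Fin k) ℝ) : ℝ :=
  sInf {r : ℝ | 0 ≤ r ∧ i ≤ Module.finrank ℝ
    (Submodule.span ℝ {w : Fin k → ℝ | (∃ v : Fin k → ℤ, v ≠ 0 ∧
      w = g.mulVec (fun j => (v j : ℝ))) ∧ Real.sqrt (∑ j, w j ^ 2) ≤ r})}

/-- The unipotent matrix `u₁(x) ∈ SL_{n+1}(ℝ)`, `n = d+m`. -/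
def u1Mat {d m : ℕ} (f : (Fin d → ℝ) → Fin m → ℝ) (x : Fin d → ℝ) :
    Matrix (Fin (d + m + 1)) (Fin (d + m + 1)) ℝ := fun r c =>
  if (r : ℕ) = (c : ℕ) then 1
  else if (r : ℕ) < m ∧ m ≤ (c : ℕ) ∧ (c : ℕ) < d + m then
    - pd1 f (d + m - 1 - (c : ℕ)) (m - 1 - (r : ℕ)) x
  else if (r : ℕ) < m ∧ (c : ℕ) = d + m then
    (if h : m - 1 - (r : ℕ) < m then f x ⟨m - 1 - (r : ℕ), h⟩ else 0)
      - ∑ i : Fin d, x i * pd1 f (i : ℕ) (m - 1 - (r : ℕ)) x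
  else if m ≤ (r : ℕ) ∧ (r : ℕ) < d + m ∧ (c : ℕ) = d + m then
    (if h : d + m - 1 - (r : ℕ) < d then x ⟨d + m - 1 - (r : ℕ), h⟩ else 0)
  else 0

/-- The inverse `a_{ε,t,v}⁻¹` of the diagonal matrix `a_{ε,t,v}`. -/
def aInvMat (d m : ℕ) (ε t v : ℝ) : Matrix (Fin (d + m + 1)) (Fin (d + m + 1)) ℝ :=
  Matrix.diagonal (fun i => v * (if (i : ℕ) < m then ε⁻¹
    else if (i : ℕ) < d + m then (ε ^ m * Real.exp t) ^ ((1 : ℝ) / d)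
    else (v ^ (d + m + 1) * Real.exp t)⁻¹))

/-- The set `𝔊(v,t,ε)`. -/
def Gfrak {d m : ℕ} (U : Set (Fin d → ℝ)) (f : (Fin d → ℝ) → Fin m → ℝ)
    (v t ε : ℝ) : Set (Fin d → ℝ) :=
  {x | x ∈ U ∧ v ≤ succMin 1 (aInvMat d m ε t v * u1Mat f x)}

/-- The set `𝒩_θ(t,ε,B)`. -/
def NCal {d m : ℕ} (f : (Fin d → ℝ) → Fin m → ℝ) (θ : Fin (d + m) → ℝ)
    (t : ℕ) (ε : ℝ) (B : Set (Fin d → ℝ)) : Set (ℕ × (Fin d → ℤ) × (Fin m → ℤ)) :=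
  {q | 0 < q.1 ∧
    (fun i => ((q.2.1 i : ℝ) + θ (Fin.castAdd m i)) / (q.1 : ℝ)) ∈ B ∧
    Real.exp ((t : ℝ) - 1) ≤ (q.1 : ℝ) ∧ (q.1 : ℝ) ≤ Real.exp t ∧
    ‖(fun j => (q.1 : ℝ) * f (fun i => ((q.2.1 i : ℝ) + θ (Fin.castAdd m i)) / (q.1 : ℝ)) j
        - θ (Fin.natAdd d j) - (q.2.2 j : ℝ) : Fin m → ℝ)‖ ≤ ε}

/-- The set `Δ_θ(t,ε,B,ρ)`. -/
def DeltaCal {d m : ℕ} (f : (Fin d → ℝ) → Fin m → ℝ) (θ : Fin (d + m) → ℝ)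
    (t : ℕ) (ε : ℝ) (B : Set (Fin d → ℝ)) (ρ : ℝ) : Set (Fin d → ℝ) :=
  ⋃ q ∈ NCal f θ t ε B,
    Metric.ball (fun i => ((q.2.1 i : ℝ) + θ (Fin.castAdd m i)) / (q.1 : ℝ)) ρ

/-- `φ = (ε^n e^t)^{1/(n+1)}`, `n = d+m`. -/
def phiC (d m : ℕ) (ε t : ℝ) : ℝ := (ε ^ (d + m) * Real.exp t) ^ ((1 : ℝ) / (d + m + 1))

/-- `h = dt/(2(n+1))`. -/
def hC (d m : ℕ) (t : ℝ) : ℝ := (d : ℝ) * t / (2 * ((d : ℝ) + m + 1))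

def gMat (d m : ℕ) (ε t : ℝ) : Matrix (Fin (d + m + 1)) (Fin (d + m + 1)) ℝ :=
  Matrix.diagonal (fun i => phiC d m ε t *
    (if (i : ℕ) < d + m then ε⁻¹ else Real.exp (-t)))

def bMat (d m : ℕ) (t : ℝ) : Matrix (Fin (d + m + 1)) (Fin (d + m + 1)) ℝ :=
  Matrix.diagonal (fun i => if (i : ℕ) < m then Real.exp (hC d m t)
    else if (i : ℕ) < d + m then Real.exp (-(((m : ℝ) + 1) * t) / (2 * ((d : ℝ) + m + 1)))
    else Real.exp (hC d m t))

def dMat (d m : ℕ) (ε : ℝ) : Matrix (Fin (d + m + 1)) (Fin (d + m + 1)) ℝ :=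
  Matrix.diagonal (fun i => if (i : ℕ) < m then 1
    else if (i : ℕ) < d + m then Real.sqrt ε else 1)

/-- The raw nongeneric set `𝔐₀(ε,t)`. -/
def M0frak {d m : ℕ} (U : Set (Fin d → ℝ)) (f : (Fin d → ℝ) → Fin m → ℝ)
    (ε t : ℝ) : Set (Fin d → ℝ) :=
  {x | x ∈ U ∧ phiC d m ε t * Real.exp (hC d m t) <
    succMin (d + m + 1) (dMat d m ε * bMat d m t * gMat d m ε t * u1Mat f x)}

/-- The nongeneric (special) set `𝔐(ε,t)`. -/
def Mfrak {d m : ℕ} (U : Set (Fin d → ℝ)) (f : (Fin d → ℝ) → Fin m → ℝ)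
    (ε t : ℝ) : Set (Fin d → ℝ) :=
  (⋃ x ∈ M0frak U f ε t, Metric.ball x (Real.sqrt ε * Real.exp (-t / 2))) ∩ U

/-- The inhomogeneous Diophantine exponent `λ_n^θ(x)` of `(x,x²,…,x^n)`, as a value
in `[0,∞]`. -/
def lambdaN (n : ℕ) (θ : Fin n → ℝ) (x : ℝ) : ℝ≥0∞ :=
  sSup {lam : ℝ≥0∞ | ∃ τ : ℝ, lam = ENNReal.ofReal τ ∧
    (fun i : Fin n => x ^ ((i : ℕ) + 1)) ∈ SApprox n θ (fun q => q ^ (-τ))}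

end


section NN
local notation "Vc" n:max => Fin n → ℝ
local notation "ic" => (Int.cast : ℤ → ℝ)
local notation "Bl" => Metric.ball
local notation "eR" => ENNReal.ofReal

namespace DSM

section KM
variable {d : ℕ} {S : Type*}

def KMBad [DecidableEq S] (comp : S → S → Prop) (ψ : S → (Vc d) → ℝ) (c : ℝ) (F : Finset S)
    (y : Vc d) (r : ℝ) : Set (Vc d) :=
  {x | x ∈ Bl y r ∧ ¬ ∃ F' : Finset S, F ⊆ F' ∧
    (∀ s ∈ F', ∀ s' ∈ F', s ≠ s' → comp s s') ∧
    (∀ s ∈ F', s ∉ F → c ≤ ψ s x ∧ ψ s x ≤ 1 / c) ∧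
    ∀ s, (∀ s' ∈ F', comp s s') → 1 ≤ ψ s x}

noncomputable def KMA (d : ℕ) : ℕ → ℝ≥0∞
  | 0 => 0
  | k + 1 => (1 + KMA d k) * 18 ^ d

lemma KMA_ne_top (d k : ℕ) : KMA d k ≠ ⊤ := by
  induction k with
  | zero => simp [KMA]
  | succ k ih =>
    simp only [KMA]
    exact ENNReal.mul_ne_top (ENNReal.add_ne_top.2 ⟨ENNReal.one_ne_top, ih⟩) (by simp)

lemma vol_ball_scale (x y : Vc d) (k : ℕ) (r : ℝ) (hr : 0 < r) (hk : 0 < k) :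
    volume (Bl x ((k : ℝ) * r)) = (k : ℝ≥0∞) ^ d * volume (Bl y r) := by
  rw [Real.volume_pi_ball _ (by positivity), Real.volume_pi_ball _ hr]
  simp only [Fintype.card_fin]
  rw [show (2 * ((k : ℝ) * r)) ^ d = (k : ℝ) ^ d * (2 * r) ^ d by rw [← mul_pow]; ring,
    ENNReal.ofReal_mul (by positivity), ENNReal.ofReal_pow (by positivity), ENNReal.ofReal_natCast]

theorem KM_induction [DecidableEq S] [Nonempty S] (comp : S → S → Prop) (hirr : ∀ s, ¬ comp s s)
    (hsymm : ∀ s s', comp s s' → comp s' s)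
    (ψ : S → (Vc d) → ℝ) (x0 : Vc d) (R : ℝ)
    (hcont : ∀ s, ContinuousOn (ψ s) (Bl x0 R)) (N : ℕ)
    (hN : ∀ F : Finset S, (∀ s ∈ F, ∀ s' ∈ F, s ≠ s' → comp s s') → F.card ≤ N)
    (c : ℝ) (hc : 0 < c) (τ : ℝ≥0∞) (hτ : τ * 6 ^ d < 1)
    (hgood : ∀ s y r M, 0 < r → dist y x0 + r < R → 0 < M → (∃ x ∈ Bl y r, M ≤ ψ s x) →
      volume {x | x ∈ Bl y r ∧ ψ s x < c * M} ≤ τ * volume (Bl y r))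
    (k : ℕ) : ∀ (F : Finset S), (∀ s ∈ F, ∀ s' ∈ F, s ≠ s' → comp s s') → N ≤ F.card + k →
      ∀ y r, 0 < r → dist y x0 + 20 ^ k * r < R →
      (∀ s, (∀ s' ∈ F, comp s s') → ∃ x ∈ Bl y r, 1 ≤ ψ s x) →
      volume (KMBad comp ψ c F y r) ≤ KMA d k * τ * volume (Bl y r) := by
  have hins : ∀ (F : Finset S), (∀ s ∈ F, ∀ s' ∈ F, s ≠ s' → comp s s') → ∀ s,
      (∀ s' ∈ F, comp s s') → s ∉ F ∧ ∀ a ∈ insert s F, ∀ b ∈ insert s F, a ≠ b → comp a b := by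
    intro F hF s hs
    refine ⟨fun h => hirr s (hs s h), ?_⟩
    intro a ha b hb hab
    rw [Finset.mem_insert] at ha hb
    rcases ha with rfl | ha <;> rcases hb with rfl | hb
    · exact absurd rfl hab
    · exact hs b hb
    · exact hsymm _ _ (hs a ha)
    · exact hF a ha b hb hab
  induction k with
  | zero =>
    intro F hF hNF y r hr hR hsup
    have : KMBad comp ψ c F y r = ∅ := by
      ext x
      simp only [KMBad, mem_ofPred_eq, mem_empty_iff_false, iff_false, not_and, not_not]
      intro hx
      refine ⟨F, subset_rfl, hF, fun s h1 h2 => absurd h1 h2, ?_⟩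
      intro s hs
      obtain ⟨h1, h2⟩ := hins F hF s hs
      have := hN _ h2
      rw [Finset.card_insert_of_notMem h1] at this
      omega
    rw [this]; simp
  | succ k ih =>
    intro F hF hNF y r hr hR hsup
    have h20 : (1:ℝ) ≤ 20 ^ k := one_le_pow₀ (by norm_num)
    have hR' : dist y x0 + 20 * (20 ^ k * r) < R := by rw [pow_succ] at hR; linarith
    have hrr : r ≤ 20 ^ k * r := by nlinarith
    set Bd := KMBad comp ψ c F y r with hBd
    have hch : ∀ x, ∃ ρ : ℝ, ∃ s : S, x ∈ Bd → 0 < ρ ∧ ρ ≤ 2 * r ∧ (∀ s' ∈ F, comp s s') ∧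
        (∀ x' ∈ Bl x ρ, ψ s x' < 1) ∧
        (∀ s, (∀ s' ∈ F, comp s s') → ∃ x' ∈ Bl x (2 * ρ), 1 ≤ ψ s x') := by
      intro x
      by_cases hx : x ∈ Bd
      swap
      · exact ⟨0, Classical.arbitrary S, fun h => absurd h hx⟩
      set P : Set ℝ := {ρ | 0 < ρ ∧ ∃ s : S, (∀ s' ∈ F, comp s s') ∧ ∀ x' ∈ Bl x ρ, ψ s x' < 1} with hP
      have hxy : dist x y < r := hx.1
      have hPb : ∀ ρ ∈ P, ρ ≤ 2 * r := by
        rintro ρ ⟨h0, s, hs, h⟩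
        by_contra hlt
        push Not at hlt
        obtain ⟨x', hx', h1⟩ := hsup s hs
        rw [Metric.mem_ball] at hx'
        have : x' ∈ Bl x ρ := by
          rw [Metric.mem_ball]
          have := dist_triangle_right x' x y
          linarith
        exact absurd (h x' this) (not_lt.2 h1)
      have hPn : P.Nonempty := by
        have hx2 := hx.2
        have : ∃ s : S, (∀ s' ∈ F, comp s s') ∧ ψ s x < 1 := by
          by_contra hno
          push Not at hno
          exact hx2 ⟨F, subset_rfl, hF, fun s h1 h2 => absurd h1 h2, hno⟩
        obtain ⟨s, hs, h1⟩ := this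
        have hxb : x ∈ Bl x0 R := by
          rw [Metric.mem_ball]
          have := dist_triangle x y x0
          nlinarith
        have hca : ContinuousAt (ψ s) x := (hcont s).continuousAt (Metric.isOpen_ball.mem_nhds hxb)
        have := hca.eventually (Iio_mem_nhds h1)
        obtain ⟨ρ, h0, hρ⟩ := Metric.eventually_nhds_iff_ball.1 this
        exact ⟨ρ, h0, s, hs, fun x' hx' => hρ x' hx'⟩
      have hbdd : BddAbove P := ⟨2 * r, hPb⟩
      have hpos : 0 < sSup P := by
        obtain ⟨ρ, hρ⟩ := hPn
        exact lt_of_lt_of_le hρ.1 (le_csSup hbdd hρ)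
      obtain ⟨ρ, hρP, hρ⟩ := exists_lt_of_lt_csSup hPn (show sSup P / 2 < sSup P by linarith)
      obtain ⟨s, hs, h1⟩ := hρP.2
      refine ⟨ρ, s, fun _ => ⟨hρP.1, hPb _ hρP, hs, h1, ?_⟩⟩
      intro s' hs'
      by_contra hno
      push Not at hno
      have : 2 * ρ ∈ P := ⟨by linarith [hρP.1], s', hs', hno⟩
      have := le_csSup hbdd this
      linarith
    choose ρ s hρs using hch
    obtain ⟨u, hut, hdisj, hcov⟩ := Vitali.exists_disjoint_subfamily_covering_enlargement_closedBall
      Bd (fun x => x) ρ (2 * r) (fun a ha => (hρs a ha).2.1) 5 (by norm_num)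
    have hucount : u.Countable := by
      refine Set.PairwiseDisjoint.countable_of_nonempty_interior hdisj ?_
      intro x hx
      refine ⟨x, ?_⟩
      have := Metric.ball_subset_interior_closedBall (x := x) (ε := ρ x)
      exact this (Metric.mem_ball_self (hρs x (hut hx)).1)
    have hcov2 : Bd ⊆ ⋃ x ∈ u, Bd ∩ Bl x (6 * ρ x) := by
      intro x hx
      obtain ⟨b, hb, hsub⟩ := hcov x hx
      rw [mem_iUnion₂]
      refine ⟨b, hb, hx, ?_⟩
      have h1 : x ∈ Metric.closedBall b (5 * ρ b) :=
        hsub (Metric.mem_closedBall_self (hρs x hx).1.le)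
      rw [Metric.mem_closedBall] at h1
      rw [Metric.mem_ball]
      linarith [(hρs b (hut hb)).1]
    have hloc : ∀ x ∈ u, volume (Bd ∩ Bl x (6 * ρ x)) ≤
        (1 + KMA d k) * τ * (6 ^ d * volume (Metric.closedBall x (ρ x))) := by
      intro x hxu
      obtain ⟨h0, h2r, hsF, hlt, hge⟩ := hρs x (hut hxu)
      have hxy : dist x y < r := (hut hxu).1
      have hdx : dist x x0 ≤ dist y x0 + r := by
        have := dist_triangle x y x0
        linarith
      have hscale : volume (Bl x (6 * ρ x)) = 6 ^ d * volume (Bl x (ρ x)) := by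
        simpa using vol_ball_scale x x 6 (ρ x) h0 (by norm_num)
      have hRx : dist x x0 + 20 ^ k * (6 * ρ x) < R := by nlinarith
      have hRx' : dist x x0 + 6 * ρ x < R := by nlinarith
      have hupper : ∀ x' ∈ Bl x (6 * ρ x), ψ (s x) x' ≤ 1 / c := by
        intro x' hx'
        by_contra hgt
        push Not at hgt
        have hg := hgood (s x) x (6 * ρ x) (1 / c) (by linarith) hRx' (by positivity) ⟨x', hx', hgt.le⟩
        rw [mul_one_div_cancel hc.ne'] at hg
        have hsub : Bl x (ρ x) ⊆ {x' | x' ∈ Bl x (6 * ρ x) ∧ ψ (s x) x' < 1} := by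
          intro z hz
          exact ⟨Metric.ball_subset_ball (by linarith) hz, hlt z hz⟩
        have h1 := (measure_mono hsub).trans hg
        rw [hscale, ← mul_assoc] at h1
        have hpos : 0 < volume (Bl x (ρ x)) := Metric.measure_ball_pos _ _ h0
        have hfin : volume (Bl x (ρ x)) ≠ ⊤ := measure_ball_lt_top.ne
        have h2 : τ * 6 ^ d * volume (Bl x (ρ x)) < 1 * volume (Bl x (ρ x)) := by
          exact (ENNReal.mul_lt_mul_iff_left hpos.ne' hfin).2 hτ
        rw [one_mul] at h2
        exact absurd h1 (not_le.2 h2)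
      have hA := hgood (s x) x (6 * ρ x) 1 (by linarith) hRx' one_pos (by
        obtain ⟨x', hx', h1⟩ := hge (s x) hsF
        exact ⟨x', Metric.ball_subset_ball (by linarith) hx', h1⟩)
      obtain ⟨hnot, hins'⟩ := hins F hF (s x) hsF
      have hB := ih (insert (s x) F) hins' (by rw [Finset.card_insert_of_notMem hnot]; omega)
        x (6 * ρ x) (by linarith) hRx (by
          intro s' hs'
          obtain ⟨x', hx', h1⟩ := hge s' (fun s'' h => hs' s'' (Finset.mem_insert_of_mem h))
          exact ⟨x', Metric.ball_subset_ball (by linarith) hx', h1⟩)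
      have hsub : Bd ∩ Bl x (6 * ρ x) ⊆
          {x' | x' ∈ Bl x (6 * ρ x) ∧ ψ (s x) x' < c * 1} ∪
          KMBad comp ψ c (insert (s x) F) x (6 * ρ x) := by
        rintro x' ⟨hx'B, hx'b⟩
        by_cases h1 : ψ (s x) x' < c * 1
        · exact Or.inl ⟨hx'b, h1⟩
        · right
          refine ⟨hx'b, ?_⟩
          rintro ⟨F', hFF, hch', hcc, h1'⟩
          apply hx'B.2
          refine ⟨F', fun z hz => hFF (Finset.mem_insert_of_mem hz), hch', ?_, h1'⟩
          intro s' hs' hs'F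
          by_cases hss : s' = s x
          · subst hss
            exact ⟨by linarith, hupper _ hx'b⟩
          · exact hcc s' hs' (by simp [hss, hs'F])
      calc volume (Bd ∩ Bl x (6 * ρ x)) ≤ _ := measure_mono hsub
        _ ≤ _ := measure_union_le _ _
        _ ≤ τ * volume (Bl x (6 * ρ x)) + KMA d k * τ * volume (Bl x (6 * ρ x)) :=
          add_le_add hA hB
        _ = (1 + KMA d k) * τ * volume (Bl x (6 * ρ x)) := by ring
        _ = (1 + KMA d k) * τ * (6 ^ d * volume (Bl x (ρ x))) := by rw [hscale]
        _ ≤ _ := by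
          gcongr
          exact Metric.ball_subset_closedBall
    have hsum : ∑' x : u, volume (Metric.closedBall (x : Vc d) (ρ x)) ≤
        3 ^ d * volume (Bl y r) := by
      rw [← measure_biUnion hucount hdisj (fun x _ => Metric.isClosed_closedBall.measurableSet)]
      have h3 : volume (Bl y (3 * r)) = 3 ^ d * volume (Bl y r) := by
        simpa using vol_ball_scale y y 3 r hr (by norm_num)
      rw [← h3]
      apply measure_mono
      intro z hz
      rw [mem_iUnion₂] at hz
      obtain ⟨x, hx, hz⟩ := hz
      rw [Metric.mem_closedBall] at hz
      rw [Metric.mem_ball]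
      have h1 : dist x y < r := (hut hx).1
      have := dist_triangle z x y
      linarith [(hρs x (hut hx)).2.1]
    calc volume Bd ≤ volume (⋃ x ∈ u, Bd ∩ Bl x (6 * ρ x)) := measure_mono hcov2
      _ ≤ ∑' x : u, volume (Bd ∩ Bl (x : Vc d) (6 * ρ x)) :=
        measure_biUnion_le _ hucount _
      _ ≤ ∑' x : u, (1 + KMA d k) * τ * (6 ^ d * volume (Metric.closedBall (x : Vc d) (ρ x))) :=
        ENNReal.tsum_le_tsum fun x => hloc x x.2
      _ = (1 + KMA d k) * τ * (6 ^ d * ∑' x : u, volume (Metric.closedBall (x : Vc d) (ρ x))) := by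
        rw [ENNReal.tsum_mul_left, ENNReal.tsum_mul_left]
      _ ≤ (1 + KMA d k) * τ * (6 ^ d * (3 ^ d * volume (Bl y r))) := by gcongr
      _ = KMA d (k + 1) * τ * volume (Bl y r) := by
        simp only [KMA]
        rw [show (18 : ℝ≥0∞) ^ d = 6 ^ d * 3 ^ d by rw [← mul_pow]; norm_num]
        ring

end KM

section Transference
open scoped RealInnerProductSpace

def IsDual {V : Type} [NormedAddCommGroup V] [InnerProductSpace ℝ V] (Λ : AddSubgroup V) (w : V) : Prop :=
  ∀ v ∈ Λ, ∃ k : ℤ, ⟪w, v⟫ = (k : ℝ)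

theorem cover_aux (N : ℕ) : ∀ (V : Type) [NormedAddCommGroup V] [InnerProductSpace ℝ V]
    [FiniteDimensional ℝ V], Module.finrank ℝ V = N → ∀ (Λ : AddSubgroup V) (σ : ℝ), 0 < σ →
    (∀ w, w ≠ 0 → IsDual Λ w → σ ≤ ‖w‖) → Submodule.span ℝ {w | IsDual Λ w} = ⊤ →
    ∀ y, ∃ v ∈ Λ, ‖v - y‖ ≤ (2 ^ N - 1) / σ := by
  induction N with
  | zero =>
    intro V _ _ _ hV Λ σ hσ _ _ y
    have : Subsingleton V := Module.finrank_zero_iff.1 hV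
    refine ⟨0, Λ.zero_mem, ?_⟩
    rw [Subsingleton.elim (0 - y) 0]; simp
  | succ N ih =>
    intro V _ _ _ hV Λ σ hσ hmin hspan y
    have hne : ∃ w0 : V, w0 ≠ 0 ∧ IsDual Λ w0 := by
      by_contra hno
      push Not at hno
      have : {w | IsDual Λ w} ⊆ ({0} : Set V) := by
        intro w hw
        by_contra h
        exact hno w h hw
      have h2 := Submodule.span_mono (R := ℝ) this
      rw [hspan, Submodule.span_zero_singleton] at h2
      have h3 : (⊤ : Submodule ℝ V) = ⊥ := le_bot_iff.1 h2
      have h4 : Module.finrank ℝ (⊤ : Submodule ℝ V) = 0 := by rw [h3]; simp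
      rw [finrank_top] at h4
      omega
    obtain ⟨w0, hw0, hw0d⟩ := hne
    have hclosed : IsClosed {w : V | IsDual Λ w} := by
      have : {w : V | IsDual Λ w} = ⋂ v ∈ Λ, (fun w : V => ⟪w, v⟫) ⁻¹' (range ((↑) : ℤ → ℝ)) := by
        ext w
        simp only [IsDual, mem_iInter, mem_preimage, mem_range, mem_ofPred_eq]
        constructor
        · intro h v hv
          obtain ⟨k, hk⟩ := h v hv
          exact ⟨k, hk.symm⟩
        · intro h v hv
          obtain ⟨k, hk⟩ := h v hv
          exact ⟨k, hk.symm⟩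
      rw [this]
      refine isClosed_biInter fun v _ => ?_
      exact IsClosed.preimage (by fun_prop) Int.isClosedEmbedding_coe_real.isClosed_range
    have hcomp : IsCompact ({w : V | IsDual Λ w} ∩ {w | σ ≤ ‖w‖} ∩ Metric.closedBall 0 ‖w0‖) := by
      refine (isCompact_closedBall _ _).inter_left (hclosed.inter ?_)
      exact isClosed_le continuous_const continuous_norm
    obtain ⟨w, ⟨⟨hwd, hwσ⟩, hwb⟩, hwmin⟩ := hcomp.exists_isMinOn
      ⟨w0, ⟨hw0d, hmin w0 hw0 hw0d⟩, by simp⟩ continuous_norm.continuousOn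
    simp only [mem_ofPred_eq] at hwd hwσ
    have hwpos : 0 < ‖w‖ := lt_of_lt_of_le hσ hwσ
    have hwne : w ≠ 0 := norm_pos_iff.1 hwpos
    have hshort : ∀ u, u ≠ 0 → IsDual Λ u → ‖w‖ ≤ ‖u‖ := by
      intro u hu hud
      by_cases hb : ‖u‖ ≤ ‖w0‖
      · exact hwmin ⟨⟨hud, hmin u hu hud⟩, by simpa using hb⟩
      · have : ‖w‖ ≤ ‖w0‖ := by simpa using hwb
        linarith
    have hv1 : ∃ v1 ∈ Λ, ⟪w, v1⟫ = (1 : ℝ) := by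
      let G : AddSubgroup ℤ :=
        { carrier := {k | ∃ v ∈ Λ, ⟪w, v⟫ = (k : ℝ)}
          zero_mem' := ⟨0, Λ.zero_mem, by simp⟩
          add_mem' := by
            rintro a b ⟨v, hv, h⟩ ⟨v', hv', h'⟩
            exact ⟨v + v', Λ.add_mem hv hv', by rw [inner_add_right, h, h']; push_cast; ring⟩
          neg_mem' := by
            rintro a ⟨v, hv, h⟩
            exact ⟨-v, Λ.neg_mem hv, by rw [inner_neg_right, h]; push_cast; ring⟩ }
      obtain ⟨g, hg⟩ := Int.subgroup_cyclic G
      have hdvd : ∀ v ∈ Λ, ∃ k : ℤ, ⟪w, v⟫ = (g : ℝ) * k := by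
        intro v hv
        obtain ⟨k, hk⟩ := hwd v hv
        have : k ∈ G := ⟨v, hv, hk⟩
        rw [hg, AddSubgroup.mem_closure_singleton] at this
        obtain ⟨j, hj⟩ := this
        refine ⟨j, ?_⟩
        rw [hk, ← hj]; simp; ring
      have hgG : g ∈ G := by rw [hg]; exact AddSubgroup.mem_closure_singleton_self g
      have hscale : ∀ s : ℝ, 0 < s → (∀ v ∈ Λ, ∃ k : ℤ, s * ⟪w, v⟫ = k) → 1 ≤ s := by
        intro s hs h
        have := hshort (s • w) (smul_ne_zero hs.ne' hwne) (fun v hv => by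
          obtain ⟨k, hk⟩ := h v hv
          exact ⟨k, by rw [real_inner_smul_left, hk]⟩)
        rw [norm_smul, Real.norm_of_nonneg hs.le] at this
        by_contra hlt
        push Not at hlt
        nlinarith
      have hg0 : g ≠ 0 := by
        intro h0
        have := hscale (1/2) (by norm_num) (fun v hv => by
          obtain ⟨k, hk⟩ := hdvd v hv
          exact ⟨0, by rw [hk, h0]; simp⟩)
        norm_num at this
      have hgabs : |(g : ℝ)| ≤ 1 := by
        have hp : 0 < |(g : ℝ)| := abs_pos.2 (by exact_mod_cast hg0)
        have := hscale (1 / |(g : ℝ)|) (by positivity) (fun v hv => by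
          obtain ⟨k, hk⟩ := hdvd v hv
          rcases abs_cases (g : ℝ) with ⟨h, _⟩ | ⟨h, _⟩
          · refine ⟨k, ?_⟩
            rw [hk, h]; rw [h] at hp; field_simp
          · refine ⟨-k, ?_⟩
            rw [hk, h]; rw [h] at hp
            have : (g : ℝ) ≠ 0 := by exact_mod_cast hg0
            push_cast; field_simp)
        rw [le_div_iff₀ hp] at this
        linarith
      have hg1 : g = 1 ∨ g = -1 := by
        have h1 : |g| ≤ 1 := by exact_mod_cast hgabs
        rw [abs_le] at h1
        omega
      have h1G : (1 : ℤ) ∈ G := by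
        rcases hg1 with h | h
        · rw [← h]; exact hgG
        · have := G.neg_mem hgG
          rw [h] at this; simpa using this
      obtain ⟨v, hv, h⟩ := h1G
      exact ⟨v, hv, by simpa using h⟩
    obtain ⟨v1, hv1, hwv1⟩ := hv1
    let W : Submodule ℝ V := (Submodule.span ℝ {w})ᗮ
    have hWmem : ∀ x : V, x ∈ W ↔ ⟪w, x⟫ = (0 : ℝ) := fun x => Submodule.mem_orthogonal_singleton_iff_inner_right
    have hWrank : Module.finrank ℝ W = N := by
      have : Fact (Module.finrank ℝ V = N + 1) := ⟨hV⟩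
      exact Submodule.finrank_orthogonal_span_singleton hwne
    let Λ' : AddSubgroup W := Λ.comap W.subtype.toAddMonoidHom
    have hext : ∀ u' : W, IsDual Λ' u' → ∃ c : ℝ, IsDual Λ ((u' : V) + c • w) := by
      intro u' hu'
      refine ⟨-⟪(u' : V), v1⟫, ?_⟩
      intro v hv
      obtain ⟨k, hk⟩ := hwd v hv
      have hmem : v - k • v1 ∈ W := by
        rw [hWmem, inner_sub_right, hk, ← Int.cast_smul_eq_zsmul ℝ, real_inner_smul_right, hwv1]; ring
      have hmem' : v - k • v1 ∈ Λ := Λ.sub_mem hv (Λ.zsmul_mem hv1 k)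
      obtain ⟨j, hj⟩ := hu' ⟨v - k • v1, hmem⟩ hmem'
      refine ⟨j, ?_⟩
      rw [← hj, Submodule.coe_inner]
      simp only [inner_add_left, inner_sub_right, real_inner_smul_left, hk]
      rw [← Int.cast_smul_eq_zsmul ℝ, real_inner_smul_right]
      ring
    have hw2 : ⟪w, w⟫ = ‖w‖ ^ 2 := real_inner_self_eq_norm_sq w
    have hmin' : ∀ u' : W, u' ≠ 0 → IsDual Λ' u' → ‖w‖ / 2 ≤ ‖u'‖ := by
      intro u' hu' hd
      obtain ⟨c, hc⟩ := hext u' hd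
      let c' : ℝ := c - round c
      have hd2 : IsDual Λ ((u' : V) + c' • w) := by
        intro v hv
        obtain ⟨k, hk⟩ := hc v hv
        obtain ⟨k', hk'⟩ := hwd v hv
        refine ⟨k - round c * k', ?_⟩
        simp only [inner_add_left, real_inner_smul_left, hk'] at hk ⊢
        push_cast
        simp only [c']
        linarith
      have hort : ⟪(u' : V), w⟫ = (0 : ℝ) := by
        rw [real_inner_comm]; exact (hWmem _).1 u'.2
      have hsq : ‖(u' : V) + c' • w‖ ^ 2 = ‖u'‖ ^ 2 + c' ^ 2 * ‖w‖ ^ 2 := by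
        rw [norm_add_sq_real, real_inner_smul_right, hort, norm_smul, Real.norm_eq_abs, mul_pow, sq_abs]
        simp
      have hne2 : (u' : V) + c' • w ≠ 0 := by
        intro h0
        rw [h0] at hsq
        have h1 : 0 < ‖u'‖ := norm_pos_iff.2 hu'
        rw [norm_zero] at hsq
        nlinarith [mul_nonneg (sq_nonneg c') (sq_nonneg ‖w‖), pow_pos h1 2]
      have h1 := hshort _ hne2 hd2
      have hc' : |c'| ≤ 1 / 2 := abs_sub_round c
      have hc2 : c' ^ 2 ≤ 1 / 4 := by
        rw [← sq_abs]; nlinarith [abs_nonneg c']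
      have h2 : ‖w‖ ^ 2 ≤ ‖(u' : V) + c' • w‖ ^ 2 := by gcongr
      rw [hsq] at h2
      have h3 : (‖w‖ / 2) ^ 2 ≤ ‖u'‖ ^ 2 := by nlinarith [sq_nonneg ‖w‖]
      exact (sq_le_sq₀ (by positivity) (by positivity)).1 h3
    have hspan' : Submodule.span ℝ {u' : W | IsDual Λ' u'} = ⊤ := by
      have hproj : ∀ u : V, IsDual Λ u → IsDual Λ' (W.orthogonalProjectionOnto u) := by
        intro u hu v hv
        obtain ⟨k, hk⟩ := hu (v : V) hv
        refine ⟨k, ?_⟩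
        rw [← hk]
        exact Submodule.inner_orthogonalProjectionOnto_eq_of_mem_right v u
      rw [eq_top_iff]
      rintro x -
      have hx : (x : V) ∈ Submodule.span ℝ {w | IsDual Λ w} := by rw [hspan]; trivial
      have h2 := Submodule.mem_map_of_mem (f := (W.orthogonalProjectionOnto : V →L[ℝ] W).toLinearMap) hx
      rw [Submodule.map_span] at h2
      have h3 : (W.orthogonalProjectionOnto : V →L[ℝ] W).toLinearMap (x : V) = x := by
        simp
      rw [h3] at h2
      refine Submodule.span_mono ?_ h2
      rintro _ ⟨u, hu, rfl⟩
      exact hproj u hu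
    set k : ℤ := round ⟪w, y⟫ with hk
    set y1 : V := y - k • v1 with hy1
    set s : ℝ := ⟪w, y1⟫ with hs
    have hs1 : |s| ≤ 1 / 2 := by
      have : s = ⟪w, y⟫ - (round ⟪w, y⟫ : ℤ) := by
        rw [hs, hy1, inner_sub_right, ← Int.cast_smul_eq_zsmul ℝ, real_inner_smul_right, hwv1]
        simp [hk]
      rw [this]; exact abs_sub_round _
    have hy'mem : y1 - (s / ‖w‖ ^ 2) • w ∈ W := by
      rw [hWmem, inner_sub_right, real_inner_smul_right, hw2]
      field_simp
      simp [hs]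
    obtain ⟨v', hv', hv'y⟩ := ih W hWrank Λ' (‖w‖ / 2) (by positivity) hmin' hspan' ⟨_, hy'mem⟩
    refine ⟨(v' : V) + k • v1, Λ.add_mem hv' (Λ.zsmul_mem hv1 k), ?_⟩
    have heq : (v' : V) + k • v1 - y = ((v' : V) - (y1 - (s / ‖w‖ ^ 2) • w)) - (s / ‖w‖ ^ 2) • w := by
      rw [hy1]; abel
    have hn1 : ‖(v' : V) - (y1 - (s / ‖w‖ ^ 2) • w)‖ ≤ (2 ^ N - 1) / (‖w‖ / 2) := by
      simpa using hv'y
    have hn2 : ‖(s / ‖w‖ ^ 2) • w‖ ≤ (1 / 2) / ‖w‖ := by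
      rw [norm_smul, Real.norm_eq_abs, abs_div, abs_of_pos (by positivity : 0 < ‖w‖ ^ 2)]
      rw [show |s| / ‖w‖ ^ 2 * ‖w‖ = |s| / ‖w‖ by field_simp]
      gcongr
    calc ‖(v' : V) + k • v1 - y‖ ≤ (2 ^ N - 1) / (‖w‖ / 2) + (1 / 2) / ‖w‖ := by
          rw [heq]; exact (norm_sub_le _ _).trans (add_le_add hn1 hn2)
      _ = (2 ^ (N + 1) - 3 / 2) / ‖w‖ := by field_simp; ring
      _ ≤ (2 ^ (N + 1) - 1) / ‖w‖ := by gcongr; linarith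
      _ ≤ (2 ^ (N + 1) - 1) / σ := by
        have : (1 : ℝ) ≤ 2 ^ (N + 1) := one_le_pow₀ (by norm_num)
        apply div_le_div_of_nonneg_left (by linarith) hσ hwσ

theorem transference {ι : Type} [Fintype ι] [DecidableEq ι] (M : Matrix ι ι ℝ)
    (hinj : ∀ b, M.mulVec b = 0 → b = 0)
    (hM : ∀ a : ι → ℤ, a ≠ 0 → ∃ i, 1 ≤ |M.mulVec (fun j => (a j : ℝ)) i|) (y : ι → ℝ) :
    ∃ (z : ι → ℤ) (u : ι → ℝ), Matrix.vecMul u M = (fun j => (z j : ℝ)) ∧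
      ∀ i, |u i - y i| ≤ 2 ^ (Fintype.card ι) := by
  have hdet : IsUnit M.det := by
    rw [isUnit_iff_ne_zero]
    intro h0
    obtain ⟨v, hv, h⟩ := Matrix.exists_mulVec_eq_zero_iff.2 h0
    exact hv (hinj v h)
  let E := EuclideanSpace ℝ ι
  have hin : ∀ a b : E, ⟪a, b⟫ = ∑ i, a i * b i := by
    intro a b
    rw [PiLp.inner_apply]
    simp [mul_comm]
  let Λ : AddSubgroup E :=
    { carrier := {u | ∃ z : ι → ℤ, Matrix.vecMul u.ofLp M = (fun j => (z j : ℝ))}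
      zero_mem' := ⟨0, by ext; simp⟩
      add_mem' := by
        rintro a b ⟨z, hz⟩ ⟨z', hz'⟩
        refine ⟨z + z', ?_⟩
        rw [WithLp.ofLp_add, Matrix.add_vecMul, hz, hz']
        ext; simp
      neg_mem' := by
        rintro a ⟨z, hz⟩
        refine ⟨-z, ?_⟩
        rw [WithLp.ofLp_neg, Matrix.neg_vecMul, hz]
        ext; simp }
  have hpair : ∀ (b : ι → ℝ) (u : E), ⟪(WithLp.toLp 2 (M.mulVec b) : E), u⟫ =
      ∑ j, Matrix.vecMul u.ofLp M j * b j := by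
    intro b u
    rw [hin]
    have := Matrix.dotProduct_mulVec u.ofLp M b
    simp only [dotProduct] at this
    rw [← this]
    exact Finset.sum_congr rfl fun i _ => mul_comm _ _
  have hdual1 : ∀ a : ι → ℤ, IsDual Λ (WithLp.toLp 2 (M.mulVec (fun j => (a j : ℝ)))) := by
    rintro a u ⟨z, hz⟩
    refine ⟨∑ j, z j * a j, ?_⟩
    rw [hpair, hz]; push_cast; rfl
  have hdual2 : ∀ w : E, IsDual Λ w → ∃ a : ι → ℤ, w = WithLp.toLp 2 (M.mulVec (fun j => (a j : ℝ))) := by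
    intro w hw
    have hb : w = WithLp.toLp 2 (M.mulVec (M⁻¹.mulVec w.ofLp)) := by
      rw [Matrix.mulVec_mulVec, Matrix.mul_nonsing_inv _ hdet, Matrix.one_mulVec]
    have hint : ∀ i, ∃ k : ℤ, M⁻¹.mulVec w.ofLp i = k := by
      intro i
      have hmem : (WithLp.toLp 2 (Matrix.vecMul (Pi.single i 1) M⁻¹) : E) ∈ Λ := by
        refine ⟨Pi.single i 1, ?_⟩
        rw [Matrix.vecMul_vecMul, Matrix.nonsing_inv_mul _ hdet, Matrix.vecMul_one]
        ext j
        by_cases h : j = i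
        · subst h; simp
        · simp [h]
      obtain ⟨k, hk⟩ := hw _ hmem
      refine ⟨k, ?_⟩
      rw [← hk]
      conv_rhs => rw [hb]
      rw [hpair]
      simp only
      rw [Matrix.vecMul_vecMul, Matrix.nonsing_inv_mul _ hdet, Matrix.vecMul_one]
      simp [Pi.single_apply]
    choose a ha using hint
    refine ⟨a, ?_⟩
    rw [hb]; congr 2; ext i; exact ha i
  have hmin : ∀ w, w ≠ 0 → IsDual Λ w → (1:ℝ) ≤ ‖w‖ := by
    intro w hw hwd
    obtain ⟨a, rfl⟩ := hdual2 w hwd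
    have ha : a ≠ 0 := by
      rintro rfl
      apply hw
      simp only [Pi.zero_apply, Int.cast_zero]
      rw [show (fun _ : ι => (0:ℝ)) = 0 from rfl, Matrix.mulVec_zero]; rfl
    obtain ⟨i, hi⟩ := hM a ha
    refine hi.trans ?_
    have := PiLp.norm_apply_le (WithLp.toLp 2 (M.mulVec (fun j => (a j : ℝ))) : E) i
    simpa using this
  have hspan : Submodule.span ℝ {w : E | IsDual Λ w} = ⊤ := by
    rw [eq_top_iff]
    rintro x -
    have hx : x = ∑ j, (M⁻¹.mulVec x.ofLp j) • (WithLp.toLp 2 (M.mulVec (fun k => (((Pi.single j 1 : ι → ℤ) k : ℤ) : ℝ))) : E) := by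
      have h1 : x = WithLp.toLp 2 (M.mulVec (M⁻¹.mulVec x.ofLp)) := by
        rw [Matrix.mulVec_mulVec, Matrix.mul_nonsing_inv _ hdet, Matrix.one_mulVec]
      set b := M⁻¹.mulVec x.ofLp
      rw [h1]
      ext i
      rw [PiLp.ext_iff.1 rfl i]
      simp only [WithLp.ofLp_sum, WithLp.ofLp_smul, Finset.sum_apply, Pi.smul_apply, smul_eq_mul, Matrix.mulVec,
        dotProduct]
      refine Finset.sum_congr rfl fun j _ => ?_
      rw [Finset.sum_eq_single j]
      · simp; ring
      · intro k _ hk; simp [hk]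
      · simp
    rw [hx]
    exact Submodule.sum_mem _ fun j _ => Submodule.smul_mem _ _ (Submodule.subset_span (hdual1 _))
  obtain ⟨u, ⟨z, hz⟩, hu⟩ := cover_aux _ E rfl Λ 1 one_pos hmin hspan (WithLp.toLp 2 y)
  refine ⟨z, u.ofLp, hz, fun i => ?_⟩
  have h1 := PiLp.norm_apply_le (u - WithLp.toLp 2 y) i
  have h2 : Module.finrank ℝ E = Fintype.card ι := by simp [E]
  rw [h2] at hu
  rw [Real.norm_eq_abs] at h1
  have h3 : |u.ofLp i - y i| ≤ ‖u - WithLp.toLp 2 y‖ := h1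
  linarith

end Transference

section Alg
variable {k N : ℕ}

noncomputable def pdet (R : Fin k → Vc N) (B : Matrix (Fin k) (Fin N) ℝ) : ℝ :=
  (Matrix.of R * B.transpose).det

lemma pdet_update_eq (R : Fin k → Vc N) (B : Matrix (Fin k) (Fin N) ℝ) (i0 : Fin k)
    (a : Vc N) : pdet (Function.update R i0 a) B =
      ((Matrix.of R * B.transpose).updateRow i0 (B.mulVec a)).det := by
  unfold pdet
  congr 1
  ext i j
  by_cases h : i = i0
  · subst h
    simp [Matrix.mul_apply, Matrix.mulVec, dotProduct, mul_comm]
  · simp [Matrix.mul_apply, h]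

lemma pdet_linear (R : Fin k → Vc N) (B : Matrix (Fin k) (Fin N) ℝ) (i0 : Fin k) :
    ∃ p : Vc N, ∀ a, pdet (Function.update R i0 a) B = p ⬝ᵥ a := by
  let L : (Vc N) →ₗ[ℝ] ℝ := (LinearMap.proj i0) ∘ₗ
    (Matrix.cramer (Matrix.of R * B.transpose).transpose) ∘ₗ B.mulVecLin
  refine ⟨fun l => L (Pi.single l 1), fun a => ?_⟩
  rw [pdet_update_eq, ← Matrix.cramer_transpose_apply]
  have := LinearMap.pi_apply_eq_sum_univ L a
  have h2 : L a = (Matrix.cramer (Matrix.of R * B.transpose).transpose) (B.mulVec a) i0 := rfl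
  rw [← h2, this]
  simp only [dotProduct, smul_eq_mul]
  refine Finset.sum_congr rfl fun l _ => ?_
  rw [mul_comm]
  congr 2
  ext j; simp [Pi.single_apply, eq_comm]

lemma pdet_decomp (R : Fin k → Vc N) (B : Matrix (Fin k) (Fin N) ℝ) (i0 j0 : Fin k)
    (hij : i0 ≠ j0) : ∃ p q : Vc N, ∀ a b,
      pdet (Function.update (Function.update R i0 a) j0 b) B
        = (p ⬝ᵥ a) * (q ⬝ᵥ b) - (q ⬝ᵥ a) * (p ⬝ᵥ b) := by
  by_cases hz : ∀ a b, pdet (Function.update (Function.update R i0 a) j0 b) B = 0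
  · exact ⟨0, 0, fun a b => by rw [hz]; simp⟩
  push Not at hz
  obtain ⟨u, w, huw⟩ := hz
  set M0 := Matrix.of (Function.update (Function.update R i0 u) j0 w) * B.transpose with hM0
  have hdet : IsUnit M0.det := isUnit_iff_ne_zero.2 huw
  have hinv : M0 * M0⁻¹ = 1 := Matrix.mul_nonsing_inv _ hdet
  set P := B.transpose * M0⁻¹ with hP
  have hrow : ∀ t s, (Function.update (Function.update R i0 u) j0 w t) ⬝ᵥ (fun l => P l s) = (1 : Matrix (Fin k) (Fin k) ℝ) t s := by
    intro t s
    rw [← hinv, hM0, Matrix.mul_assoc, ← hP]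
    rw [Matrix.mul_apply]; rfl
  have hu : ∀ s, u ⬝ᵥ (fun l => P l s) = (1 : Matrix (Fin k) (Fin k) ℝ) i0 s := by
    intro s
    have := hrow i0 s
    rwa [Function.update_of_ne hij, Function.update_self] at this
  have hw : ∀ s, w ⬝ᵥ (fun l => P l s) = (1 : Matrix (Fin k) (Fin k) ℝ) j0 s := by
    intro s
    have := hrow j0 s
    rwa [Function.update_self] at this
  refine ⟨fun l => M0.det * P l i0, fun l => P l j0, fun a b => ?_⟩
  let Um : Matrix (Fin k) (Fin 2) ℝ := fun t e => if e = 0 then (if t = i0 then 1 else 0) else (if t = j0 then 1 else 0)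
  let Vr : Matrix (Fin 2) (Fin N) ℝ := ![a - u, b - w]
  have hdec : Matrix.of (Function.update (Function.update R i0 a) j0 b) * B.transpose
      = M0 + Um * (Vr * B.transpose) := by
    rw [hM0, ← Matrix.mul_assoc, ← Matrix.add_mul]
    congr 1
    ext t l
    rw [Matrix.add_apply, Matrix.mul_apply, Fin.sum_univ_two,
      show Vr 0 l = a l - u l from rfl, show Vr 1 l = b l - w l from rfl,
      show Um t 0 = if t = i0 then 1 else 0 from rfl, show Um t 1 = if t = j0 then 1 else 0 from rfl]
    simp only [Matrix.of_apply]
    by_cases h1 : t = j0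
    · subst h1; simp [hij.symm]
    · by_cases h2 : t = i0
      · subst h2; simp [hij]
      · simp [h1, h2]
  unfold pdet
  rw [hdec, Matrix.det_add_mul _ _ hdet, Matrix.mul_assoc Vr, ← hP]
  have hent : ∀ e e', ((1 : Matrix (Fin 2) (Fin 2) ℝ) + Vr * P * Um) e e' =
      (1 : Matrix (Fin 2) (Fin 2) ℝ) e e' + (Vr e) ⬝ᵥ (fun l => P l (if e' = 0 then i0 else j0)) := by
    intro e e'
    rw [Matrix.add_apply, Matrix.mul_apply]
    congr 1
    rw [Finset.sum_eq_single (if e' = 0 then i0 else j0)]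
    · by_cases h : e' = 0 <;> simp [Um, h, Matrix.mul_apply, dotProduct]
    · intro t _ ht
      by_cases h : e' = 0 <;> simp_all [Um]
    · simp
  rw [Matrix.det_fin_two, hent, hent, hent, hent,
    show (if (0 : Fin 2) = 0 then i0 else j0) = i0 from if_pos rfl,
    show (if (1 : Fin 2) = 0 then i0 else j0) = j0 from if_neg (by decide),
    show Vr 0 = a - u from rfl, show Vr 1 = b - w from rfl,
    sub_dotProduct, sub_dotProduct, sub_dotProduct, sub_dotProduct, hu, hu, hw, hw]
  simp only [Matrix.one_apply_eq, Matrix.one_apply_ne hij, Matrix.one_apply_ne hij.symm,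
    Matrix.one_apply_ne (show (0 : Fin 2) ≠ 1 by decide), Matrix.one_apply_ne (show (1 : Fin 2) ≠ 0 by decide)]
  have hc : ∀ (s : Fin k) (a : Vc N), (fun l => P l s) ⬝ᵥ a = a ⬝ᵥ (fun l => P l s) :=
    fun s a => dotProduct_comm _ _
  have hc2 : ∀ (a : Vc N), (fun l => M0.det * P l i0) ⬝ᵥ a = M0.det * (a ⬝ᵥ (fun l => P l i0)) := by
    intro a
    rw [dotProduct_comm]
    simp only [dotProduct, Finset.mul_sum]
    exact Finset.sum_congr rfl fun l _ => by ring
  rw [hc, hc, hc2, hc2]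
  ring

lemma pdet_row_eq (R : Fin k → Vc N) (B : Matrix (Fin k) (Fin N) ℝ) (i j : Fin k) (hij : i ≠ j)
    (h : R i = R j) : pdet R B = 0 := by
  unfold pdet
  refine Matrix.det_zero_of_row_eq hij ?_
  ext t
  simp [Matrix.mul_apply, h]

lemma pdet_smul (s : Vc k) (R : Fin k → Vc N) (B : Matrix (Fin k) (Fin N) ℝ) :
    pdet (fun t => s t • R t) B = (∏ t, s t) * pdet R B := by
  unfold pdet
  rw [← Matrix.det_mul_column]
  congr 1
  ext i j
  simp [Matrix.mul_apply, Finset.mul_sum, mul_assoc]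

lemma exists_minor (B : Matrix (Fin k) (Fin N) ℝ) (hB : LinearIndependent ℝ B.row) :
    ∃ J : Fin k → Fin N, Function.Injective J ∧
      pdet (fun t => (Pi.single (J t) 1 : Vc N)) B ≠ 0 := by
  have hrank : Module.finrank ℝ (Submodule.span ℝ (Set.range B.col)) = k := by
    rw [← Matrix.rank_eq_finrank_span_cols, LinearIndependent.rank_matrix hB]; simp
  have key := Submodule.exists_fun_fin_finrank_span_eq ℝ (Set.range B.col)
  rw [hrank] at key
  obtain ⟨g, hg1, hg2, hg3⟩ := key
  choose J hJ using hg1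
  have hg : LinearIndependent ℝ (fun t => B.col (J t)) := by
    have : (fun t => B.col (J t)) = g := funext hJ
    rw [this]; exact hg3
  have hne : pdet (fun t => (Pi.single (J t) 1 : Vc N)) B ≠ 0 := by
    unfold pdet
    have heq : (Matrix.of (fun t => (Pi.single (J t) 1 : Vc N)) * B.transpose) =
        Matrix.of (fun t => B.col (J t)) := by
      ext i j
      simp [Matrix.mul_apply, Pi.single_apply, Matrix.col]
    rw [heq]
    have := (Matrix.linearIndependent_rows_iff_isUnit (A := Matrix.of (fun t => B.col (J t)))).1 hg
    exact ((Matrix.isUnit_iff_isUnit_det _).1 this).ne_zero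
  refine ⟨J, ?_, hne⟩
  intro i j hij
  by_contra h
  exact hne (pdet_row_eq _ _ i j h (by simp [hij]))

lemma pdet_change (A : Matrix (Fin k) (Fin k) ℝ) (R : Fin k → Vc N) (B : Matrix (Fin k) (Fin N) ℝ) :
    pdet R (A * B) = pdet R B * A.det := by
  unfold pdet
  rw [Matrix.transpose_mul, ← Matrix.mul_assoc, Matrix.det_mul, Matrix.det_transpose]

lemma gram_pos (B : Matrix (Fin k) (Fin N) ℝ) (hB : LinearIndependent ℝ B.row) :
    0 < (B * B.transpose).det := by
  have := Matrix.PosDef.mul_conjTranspose_self B (Matrix.vecMul_injective_iff.2 hB)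
  simpa using this.det_pos

lemma pdet_cons (R : Fin (k + 1) → Vc N) (v : Vc N) (B : Matrix (Fin k) (Fin N) ℝ)
    (ν : ℝ) (hν : ∀ i, |R i ⬝ᵥ v| ≤ ν) :
    |pdet R (Matrix.of (Fin.cons v B : Fin (k + 1) → Vc N))| ≤
      ∑ i : Fin (k + 1), ν * |pdet (fun t => R (i.succAbove t)) B| := by
  unfold pdet
  rw [Matrix.det_succ_column_zero]
  refine (Finset.abs_sum_le_sum_abs _ _).trans (Finset.sum_le_sum fun i _ => ?_)
  rw [abs_mul, abs_mul, abs_pow, abs_neg, abs_one, one_pow, one_mul]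
  have h1 : (Matrix.of R * (Matrix.of (Fin.cons v B : Fin (k + 1) → Vc N)).transpose) i 0 = R i ⬝ᵥ v := by
    simp [Matrix.mul_apply, dotProduct]
    rfl
  have h2 : (Matrix.of R * (Matrix.of (Fin.cons v B : Fin (k + 1) → Vc N)).transpose).submatrix i.succAbove Fin.succ =
      Matrix.of (fun t => R (i.succAbove t)) * B.transpose := by
    ext a b
    simp [Matrix.mul_apply]
    rfl
  rw [h1, h2]
  gcongr
  exact hν i

lemma abs_pdet_int (b : Matrix (Fin k) (Fin N) ℤ) (J : Fin k → Fin N)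
    (h : pdet (fun t => (Pi.single (J t) 1 : Vc N)) (b.map ic) ≠ 0) :
    1 ≤ |pdet (fun t => (Pi.single (J t) 1 : Vc N)) (b.map ic)| := by
  have : pdet (fun t => (Pi.single (J t) 1 : Vc N)) (b.map ic) =
      (((Matrix.of fun i j => b j (J i)).det : ℤ) : ℝ) := by
    unfold pdet
    rw [Int.cast_det]
    congr 1
    ext i j
    simp [Matrix.mul_apply, Pi.single_apply]
  rw [this] at h ⊢
  have h0 : (Matrix.of fun i j => b j (J i)).det ≠ 0 := by
    intro h0; exact h (by rw [h0]; simp)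
  exact_mod_cast Int.one_le_abs h0

end Alg

def GoodOn {d : ℕ} (x0 : Vc d) (R c : ℝ) (τ : ℝ≥0∞) (φ : (Vc d) → ℝ) : Prop :=
  ∀ y r M, 0 < r → dist y x0 + r < R → 0 < M → (∃ x ∈ Bl y r, M ≤ φ x) →
      volume {x | x ∈ Bl y r ∧ φ x < c * M} ≤ τ * volume (Bl y r)

section Good
variable {d : ℕ} {x0 : Vc d} {R c : ℝ} {τ : ℝ≥0∞}

lemma goodOn_const (a : ℝ) (hc : c ≤ 1) : GoodOn x0 R c τ (fun _ => a) := by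
  intro y r M hr hR hM hx
  obtain ⟨x, _, hx⟩ := hx
  have : {x | x ∈ Bl y r ∧ a < c * M} = ∅ := by
    ext z
    simp only [mem_ofPred_eq, mem_empty_iff_false, iff_false, not_and, not_lt]
    intro _
    nlinarith
  rw [this]; simp

lemma goodOn_sum {ι : Type*} [Fintype ι] (φ : ι → (Vc d) → ℝ)
    (hnn : ∀ i x, 0 ≤ φ i x) (h : ∀ i, GoodOn x0 R c τ (φ i)) (K : ℝ) (hK : (Fintype.card ι : ℝ) ≤ K)
    (hK0 : 0 < K) (hc : 0 < c) :
    GoodOn x0 R (c / K) τ (fun x => ∑ i, φ i x) := by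
  intro y r M hr hR hM hx
  obtain ⟨x, hxb, hx⟩ := hx
  have : ∃ i, M / K ≤ φ i x := by
    by_contra hno
    push Not at hno
    have h1 : ∑ i, φ i x ≤ Fintype.card ι * (M / K) := by
      have := Finset.sum_le_card_nsmul Finset.univ (fun i => φ i x) (M / K) (fun i _ => (hno i).le)
      simpa using this
    have h3 : (Fintype.card ι : ℝ) * (M / K) ≤ M := by
      rw [mul_div_assoc', div_le_iff₀ hK0]; nlinarith
    rcases isEmpty_or_nonempty ι with he | hne
    · simp at hx; linarith
    · have h4 : ∑ i, φ i x < ∑ i : ι, M / K :=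
        Finset.sum_lt_sum_of_nonempty Finset.univ_nonempty (fun i _ => hno i)
      simp at h4
      linarith
  obtain ⟨i, hi⟩ := this
  refine (measure_mono ?_).trans (h i y r (M / K) hr hR (by positivity) ⟨x, hxb, hi⟩)
  rintro z ⟨h1, h2⟩
  refine ⟨h1, ?_⟩
  have h5 : φ i z ≤ ∑ i, φ i z := Finset.single_le_sum (fun j _ => hnn j z) (Finset.mem_univ i)
  calc φ i z ≤ _ := h5
    _ < c / K * M := h2
    _ = c * (M / K) := by ring

end Good

abbrev Row (n : ℕ) := Option (Option (Fin n))

noncomputable def rowv {n : ℕ} (α β γ : ℝ) (Fx Dx : Vc (n + 1)) : Row n → Vc (n + 1)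
  | none => α • Fx
  | some none => β • Dx
  | some (some j) => γ • Pi.single j.succ 1

noncomputable def psi {d n k : ℕ} (rw : Fin d → Row n → Vc (n + 1))
    (B : Matrix (Fin k) (Fin (n + 1)) ℝ) : ℝ :=
  ∑ i, ∑ τ : Fin k → Row n, |pdet (fun t => rw i (τ t)) B|

def Wd {d N : ℕ} (F : (Vc d) → Vc N) (D : Fin d → (Vc d) → Vc N)
    (p q : Vc N) (i : Fin d) (x : Vc d) : ℝ :=
  (p ⬝ᵥ F x) * (q ⬝ᵥ D i x) - (q ⬝ᵥ F x) * (p ⬝ᵥ D i x)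

section Terms
variable {d n k : ℕ}

lemma FG_form (α β γ : ℝ) (B : Matrix (Fin k) (Fin (n + 1)) ℝ) (σ : Fin k → Row n)
    (hinj : Function.Injective σ) (i0 j0 : Fin k) (hi : σ i0 = none) (hj : σ j0 = some none) :
    ∃ p q : Vc (n + 1),
      (∀ Fx Dx, pdet (fun t => rowv α β γ Fx Dx (σ t)) B
        = (p ⬝ᵥ Fx) * (q ⬝ᵥ Dx) - (q ⬝ᵥ Fx) * (p ⬝ᵥ Dx)) ∧
      ∀ a b, p a * q b - q a * p b = α * β * pdet (Function.update (Function.update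
        (fun t => rowv α β γ 0 0 (σ t)) i0 (Pi.single a 1)) j0 (Pi.single b 1)) B := by
  have hij : i0 ≠ j0 := by
    rintro rfl
    rw [hi] at hj; exact absurd hj (by simp)
  obtain ⟨p, q, hpq⟩ := pdet_decomp (fun t => rowv α β γ 0 0 (σ t)) B i0 j0 hij
  refine ⟨(α * β) • p, q, ?_, ?_⟩
  · intro Fx Dx
    have : (fun t => rowv α β γ Fx Dx (σ t)) =
        Function.update (Function.update (fun t => rowv α β γ 0 0 (σ t)) i0 (α • Fx)) j0 (β • Dx) := by
      ext1 t
      by_cases h1 : t = j0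
      · subst h1; simp [hj, rowv]
      · by_cases h2 : t = i0
        · subst h2; simp [hi, rowv, h1]
        · rw [Function.update_of_ne h1, Function.update_of_ne h2]
          rcases hσ : σ t with _ | _ | j
          · exact absurd (hinj (hσ.trans hi.symm)) h2
          · exact absurd (hinj (hσ.trans hj.symm)) h1
          · simp [rowv]
    rw [this, hpq]
    simp only [dotProduct_smul, smul_dotProduct, smul_eq_mul]
    ring
  · intro a b
    rw [hpq]
    simp
    ring

lemma rowv_single_update (α β γ : ℝ) (B : Matrix (Fin k) (Fin (n + 1)) ℝ) (σ : Fin k → Row n)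
    (hinj : Function.Injective σ) (i0 : Fin k) :
    (σ i0 = none → (∀ t, σ t ≠ some none) → ∃ p : Vc (n + 1),
      ∀ Fx Dx, pdet (fun t => rowv α β γ Fx Dx (σ t)) B = p ⬝ᵥ Fx) ∧
    (σ i0 = some none → (∀ t, σ t ≠ none) → ∃ p : Vc (n + 1),
      ∀ Fx Dx, pdet (fun t => rowv α β γ Fx Dx (σ t)) B = p ⬝ᵥ Dx) := by
  obtain ⟨p, hp⟩ := pdet_linear (fun t => rowv α β γ 0 0 (σ t)) B i0
  constructor
  · intro hi hno
    refine ⟨α • p, fun Fx Dx => ?_⟩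
    have : (fun t => rowv α β γ Fx Dx (σ t)) =
        Function.update (fun t => rowv α β γ 0 0 (σ t)) i0 (α • Fx) := by
      ext1 t
      by_cases h2 : t = i0
      · subst h2; simp [hi, rowv]
      · rw [Function.update_of_ne h2]
        rcases hσ : σ t with _ | _ | j
        · exact absurd (hinj (hσ.trans hi.symm)) h2
        · exact absurd hσ (hno t)
        · simp [rowv]
    rw [this, hp]; simp
  · intro hi hno
    refine ⟨β • p, fun Fx Dx => ?_⟩
    have : (fun t => rowv α β γ Fx Dx (σ t)) =
        Function.update (fun t => rowv α β γ 0 0 (σ t)) i0 (β • Dx) := by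
      ext1 t
      by_cases h2 : t = i0
      · subst h2; simp [hi, rowv]
      · rw [Function.update_of_ne h2]
        rcases hσ : σ t with _ | _ | j
        · exact absurd hσ (hno t)
        · exact absurd (hinj (hσ.trans hi.symm)) h2
        · simp [rowv]
    rw [this, hp]; simp

variable {x0 : Vc d} {R c : ℝ} {τ : ℝ≥0∞}

lemma good_term (F : (Vc d) → Vc (n + 1)) (D : Fin d → (Vc d) → Vc (n + 1))
    (hF0 : ∀ x, F x 0 = 1) (hD0 : ∀ i x, D i x 0 = 0) (hc1 : c ≤ 1)
    (hG1 : ∀ p, GoodOn x0 R c τ (fun x => |p ⬝ᵥ F x|))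
    (hG2 : ∀ p q, GoodOn x0 R c τ (fun x => ∑ i, |Wd F D p q i x|))
    (α β γ : ℝ) (B : Matrix (Fin k) (Fin (n + 1)) ℝ) (σ : Fin k → Row n) :
    GoodOn x0 R c τ (fun x => ∑ i, |pdet (fun t => rowv α β γ (F x) (D i x) (σ t)) B|) := by
  by_cases hinj : Function.Injective σ
  swap
  · simp only [Function.Injective, not_forall] at hinj
    obtain ⟨i, j, h1, h2⟩ := hinj
    have : ∀ x, ∑ i, |pdet (fun t => rowv α β γ (F x) (D i x) (σ t)) B| = 0 := by
      intro x
      refine Finset.sum_eq_zero fun l _ => ?_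
      rw [pdet_row_eq _ _ i j h2 (by simp [h1])]; simp
    simp only [this]
    exact goodOn_const 0 hc1
  by_cases hF : ∃ i0, σ i0 = none
  · obtain ⟨i0, hi0⟩ := hF
    by_cases hG : ∃ j0, σ j0 = some none
    · obtain ⟨j0, hj0⟩ := hG
      obtain ⟨p, q, h1, _⟩ := FG_form α β γ B σ hinj i0 j0 hi0 hj0
      simp only [h1]
      exact hG2 p q
    · push Not at hG
      obtain ⟨p, hp⟩ := (rowv_single_update α β γ B σ hinj i0).1 hi0 hG
      simp only [hp]
      have := hG1 ((d : ℝ) • p)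
      convert this using 2 with x
      simp [abs_mul]
  · push Not at hF
    by_cases hG : ∃ j0, σ j0 = some none
    · obtain ⟨j0, hj0⟩ := hG
      obtain ⟨p, hp⟩ := (rowv_single_update α β γ B σ hinj j0).2 hj0 hF
      simp only [hp]
      have := hG2 (Pi.single 0 1) p
      convert this using 2 with x
      refine Finset.sum_congr rfl fun i _ => ?_
      simp [Wd, hF0, hD0]
    · push Not at hG
      have : ∀ x i, (fun t => rowv α β γ (F x) (D i x) (σ t)) = (fun t => rowv α β γ 0 0 (σ t)) := by
        intro x i
        ext1 t
        rcases hσ : σ t with _ | _ | j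
        · exact absurd hσ (hF t)
        · exact absurd hσ (hG t)
        · simp [rowv]
      simp only [this]
      exact goodOn_const _ hc1

lemma good_psi (F : (Vc d) → Vc (n + 1)) (D : Fin d → (Vc d) → Vc (n + 1))
    (hF0 : ∀ x, F x 0 = 1) (hD0 : ∀ i x, D i x 0 = 0) (hc : 0 < c) (hc1 : c ≤ 1)
    (hG1 : ∀ p, GoodOn x0 R c τ (fun x => |p ⬝ᵥ F x|))
    (hG2 : ∀ p q, GoodOn x0 R c τ (fun x => ∑ i, |Wd F D p q i x|))
    (α β γ : ℝ) (hk : k ≤ n + 1) (B : Matrix (Fin k) (Fin (n + 1)) ℝ) :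
    GoodOn x0 R (c / (n + 2) ^ (n + 1)) τ
      (fun x => psi (fun i => rowv α β γ (F x) (D i x)) B) := by
  have h := goodOn_sum (x0 := x0) (R := R) (c := c) (τ := τ)
    (fun (σ : Fin k → Row n) x => ∑ i, |pdet (fun t => rowv α β γ (F x) (D i x) (σ t)) B|)
    (fun σ x => Finset.sum_nonneg fun i _ => abs_nonneg _)
    (fun σ => good_term F D hF0 hD0 hc1 hG1 hG2 α β γ B σ) ((n + 2 : ℝ) ^ (n + 1)) (by
      simp only [Fintype.card_fun, Fintype.card_fin, Fintype.card_option]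
      push_cast
      rw [show (n : ℝ) + 1 + 1 = n + 2 by ring]
      exact pow_le_pow_right₀ (by have : (0:ℝ) ≤ n := Nat.cast_nonneg n; linarith) hk) (by positivity) hc
  convert h using 2 with x
  unfold psi
  exact Finset.sum_comm

lemma psi_term_le (rw : Fin d → Row n → Vc (n + 1)) (B : Matrix (Fin k) (Fin (n + 1)) ℝ)
    (σ : Fin k → Row n) : ∑ i, |pdet (fun t => rw i (σ t)) B| ≤ psi rw B := by
  unfold psi
  refine Finset.sum_le_sum fun i _ => ?_
  exact Finset.single_le_sum (f := fun σ : Fin k → Row n => |pdet (fun t => rw i (σ t)) B|)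
    (fun _ _ => abs_nonneg _) (Finset.mem_univ σ)

lemma psi_cons (rw : Fin d → Row n → Vc (n + 1)) (B : Matrix (Fin k) (Fin (n + 1)) ℝ)
    (hk : k + 1 ≤ n + 1) (v : Vc (n + 1)) (ν : ℝ) (hν0 : 0 ≤ ν) (hν : ∀ i ρ, |rw i ρ ⬝ᵥ v| ≤ ν) :
    psi rw (Matrix.of (Fin.cons v B : Fin (k + 1) → Vc (n + 1))) ≤
      (n + 2) ^ (n + 1) * ((n + 1) * ν * psi rw B) := by
  unfold psi
  rw [Finset.mul_sum, Finset.mul_sum]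
  refine Finset.sum_le_sum fun i _ => ?_
  set Y := ∑ τ : Fin k → Row n, |pdet (fun t => rw i (τ t)) B| with hY
  have hY0 : 0 ≤ Y := Finset.sum_nonneg fun _ _ => abs_nonneg _
  have h1 : ∀ σ : Fin (k + 1) → Row n, |pdet (fun t => rw i (σ t))
      (Matrix.of (Fin.cons v B : Fin (k + 1) → Vc (n + 1)))| ≤ (n + 1) * ν * Y := by
    intro σ
    refine (pdet_cons (fun t => rw i (σ t)) v B ν (fun j => hν i (σ j))).trans ?_
    have h2 : ∀ j ∈ (Finset.univ : Finset (Fin (k + 1))),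
        ν * |pdet (fun t => rw i (σ (j.succAbove t))) B| ≤ ν * Y := by
      intro j _
      gcongr
      exact Finset.single_le_sum (f := fun σ : Fin k → Row n => |pdet (fun t => rw i (σ t)) B|)
        (fun _ _ => abs_nonneg _) (Finset.mem_univ (fun t => σ (j.succAbove t)))
    refine (Finset.sum_le_card_nsmul _ _ _ h2).trans ?_
    simp only [Finset.card_univ, Fintype.card_fin, nsmul_eq_mul]
    have : ((k + 1 : ℕ) : ℝ) ≤ n + 1 := by exact_mod_cast hk
    nlinarith [mul_nonneg hν0 hY0]
  refine (Finset.sum_le_card_nsmul _ _ _ (fun σ _ => h1 σ)).trans ?_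
  simp only [Finset.card_univ, Fintype.card_fun, Fintype.card_fin, Fintype.card_option, nsmul_eq_mul]
  have : (((n + 1 + 1) ^ (k + 1) : ℕ) : ℝ) ≤ (n + 2) ^ (n + 1) := by
    push_cast
    rw [show (n : ℝ) + 1 + 1 = n + 2 by ring]
    exact pow_le_pow_right₀ (by have : (0:ℝ) ≤ n := Nat.cast_nonneg n; linarith) hk
  have h3 : 0 ≤ (n + 1) * ν * Y := by positivity
  nlinarith

lemma psi_continuousOn (F : (Vc d) → Vc (n + 1)) (D : Fin d → (Vc d) → Vc (n + 1))
    (X : Set (Vc d)) (hF : ContinuousOn F X) (hD : ∀ i, ContinuousOn (D i) X)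
    (α β γ : ℝ) (B : Matrix (Fin k) (Fin (n + 1)) ℝ) :
    ContinuousOn (fun x => psi (fun i => rowv α β γ (F x) (D i x)) B) X := by
  unfold psi
  refine continuousOn_finsetSum _ fun i _ => continuousOn_finsetSum _ fun σ _ => ?_
  refine ContinuousOn.abs ?_
  unfold pdet
  have h : ∀ ρ : Row n, ContinuousOn (fun x => rowv α β γ (F x) (D i x) ρ) X := by
    rintro (_ | _ | j)
    · exact hF.const_smul α
    · exact (hD i).const_smul β
    · exact continuousOn_const
  have hrow : ContinuousOn (fun x => (Matrix.of (fun t => rowv α β γ (F x) (D i x) (σ t)) :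
      Matrix (Fin k) (Fin (n + 1)) ℝ)) X :=
    continuousOn_pi.2 fun t => h (σ t)
  have : Continuous (fun A : Matrix (Fin k) (Fin (n + 1)) ℝ => (A * B.transpose).det) := by
    fun_prop
  exact this.comp_continuousOn hrow

end Terms
section Rep
variable {n : ℕ}

def RepOf {k : ℕ} (b : Matrix (Fin k) (Fin (n + 1)) ℤ) (W : Submodule ℝ (Vc (n + 1))) : Prop :=
  LinearIndependent ℝ (b.map ic).row ∧
    Submodule.span ℝ (Set.range (b.map ic).row) = W

lemma RepOf.finrank {k : ℕ} {b : Matrix (Fin k) (Fin (n + 1)) ℤ} {W : Submodule ℝ (Vc (n + 1))}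
    (h : RepOf b W) : Module.finrank ℝ W = k := by
  have := finrank_span_eq_card h.1
  rw [h.2] at this
  simpa using this

lemma RepOf.le {k : ℕ} {b : Matrix (Fin k) (Fin (n + 1)) ℤ} {W : Submodule ℝ (Vc (n + 1))}
    (h : RepOf b W) : k ≤ n + 1 := by
  have := Submodule.finrank_le W
  rw [h.finrank] at this
  simpa using this

lemma psi_le_of_gram {k d : ℕ} {b b' : Matrix (Fin k) (Fin (n + 1)) ℤ} {W : Submodule ℝ (Vc (n + 1))}
    (h : RepOf b W) (h' : RepOf b' W)
    (hg : (b.map ic * (b.map ic).transpose).det ≤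
      (b'.map ic * (b'.map ic).transpose).det)
    (rw : Fin d → Row n → Vc (n + 1)) :
    psi rw (b.map ic) ≤ psi rw (b'.map ic) := by
  set B := b.map ic with hB
  set B' := b'.map ic with hB'
  have hA : ∃ A : Matrix (Fin k) (Fin k) ℝ, B' = A * B := by
    have : ∀ i, ∃ c : Vc k, ∑ j, c j • B.row j = B'.row i := by
      intro i
      have hm : B'.row i ∈ Submodule.span ℝ (Set.range B.row) := by
        rw [h.2, ← h'.2]; exact Submodule.subset_span ⟨i, rfl⟩
      exact (Submodule.mem_span_range_iff_exists_fun ℝ).1 hm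
    choose c hc using this
    refine ⟨Matrix.of c, ?_⟩
    ext i j
    have := congrFun (hc i) j
    simp only [Finset.sum_apply, Pi.smul_apply, smul_eq_mul, Matrix.row] at this
    rw [Matrix.mul_apply]
    exact this.symm
  obtain ⟨A, hA⟩ := hA
  have hpos := gram_pos B h.1
  have hdet : (B' * B'.transpose).det = A.det ^ 2 * (B * B.transpose).det := by
    rw [hA, Matrix.transpose_mul, Matrix.mul_assoc, ← Matrix.mul_assoc B, Matrix.det_mul, Matrix.det_mul,
      Matrix.det_transpose]
    ring
  rw [hdet] at hg
  have h1 : 1 ≤ A.det ^ 2 := by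
    by_contra hlt
    push Not at hlt
    nlinarith
  have h2 : 1 ≤ |A.det| := by
    rw [← sq_abs] at h1
    nlinarith [abs_nonneg A.det]
  rw [hA]
  unfold psi
  refine Finset.sum_le_sum fun i _ => Finset.sum_le_sum fun σ _ => ?_
  rw [pdet_change, abs_mul]
  nlinarith [abs_nonneg (pdet (fun t => rw i (σ t)) B)]

lemma exists_rep {W : Submodule ℝ (Vc (n + 1))}
    (hW : ∃ (k : ℕ) (b : Matrix (Fin k) (Fin (n + 1)) ℤ), RepOf b W) :
    ∃ (k : ℕ) (b : Matrix (Fin k) (Fin (n + 1)) ℤ), RepOf b W ∧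
      ∀ (k' : ℕ) (b' : Matrix (Fin k') (Fin (n + 1)) ℤ), RepOf b' W →
        ∀ (d : ℕ) (rw : Fin d → Row n → Vc (n + 1)),
        psi rw (b.map ic) ≤ psi rw (b'.map ic) := by
  classical
  obtain ⟨k, b, hb⟩ := hW
  have hgi : ∀ b : Matrix (Fin k) (Fin (n + 1)) ℤ, RepOf b W →
      (b.map ic * (b.map ic).transpose).det =
      (((b * b.transpose).det.natAbs : ℕ) : ℝ) := by
    intro b hb
    have hpos := gram_pos _ hb.1
    have h1 : (b.map ic * (b.map ic).transpose).det =
        (((b * b.transpose).det : ℤ) : ℝ) := by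
      rw [Int.cast_det]
      congr 1
      ext i j
      simp [Matrix.mul_apply]
    rw [h1] at hpos ⊢
    have h2 : 0 < (b * b.transpose).det := by exact_mod_cast hpos
    have h3 : (((b * b.transpose).det.natAbs : ℕ) : ℤ) = (b * b.transpose).det := by
      rw [Int.natCast_natAbs, abs_of_pos h2]
    rw [← h3]; simp
  have hex : ∃ N, ∃ b : Matrix (Fin k) (Fin (n + 1)) ℤ, RepOf b W ∧ (b * b.transpose).det.natAbs = N :=
    ⟨_, b, hb, rfl⟩
  obtain ⟨b0, hb0, hN⟩ := Nat.find_spec hex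
  refine ⟨k, b0, hb0, ?_⟩
  intro k' b' hb' d rw
  have hk : k' = k := by rw [← hb'.finrank, hb.finrank]
  subst hk
  apply psi_le_of_gram hb0 hb'
  rw [hgi b0 hb0, hgi b' hb', hN]
  exact_mod_cast Nat.find_min' hex ⟨b', hb', rfl⟩

lemma RepOf.cons {k : ℕ} {b : Matrix (Fin k) (Fin (n + 1)) ℤ} {W : Submodule ℝ (Vc (n + 1))}
    (h : RepOf b W) (v : Fin (n + 1) → ℤ) (hv : (fun j => (v j : ℝ)) ∉ W) :
    (Matrix.of (Fin.cons v b : Fin (k + 1) → Fin (n + 1) → ℤ)).map ic =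
      Matrix.of (Fin.cons (fun j => (v j : ℝ)) (b.map ic) : Fin (k + 1) → Vc (n + 1)) ∧
    RepOf (Matrix.of (Fin.cons v b : Fin (k + 1) → Fin (n + 1) → ℤ))
      (W ⊔ Submodule.span ℝ {fun j => (v j : ℝ)}) := by
  have h1 : (Matrix.of (Fin.cons v b : Fin (k + 1) → Fin (n + 1) → ℤ)).map ic =
      Matrix.of (Fin.cons (fun j => (v j : ℝ)) (b.map ic) : Fin (k + 1) → Vc (n + 1)) := by
    ext i j
    refine Fin.cases ?_ (fun i => ?_) i <;> simp [Matrix.map_apply] <;> rfl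
  refine ⟨h1, ?_, ?_⟩
  · rw [h1]
    have := (linearIndependent_finCons (K := ℝ) (x := fun j => (v j : ℝ)) (v := (b.map ic).row)).2
      ⟨h.1, by rw [h.2]; exact hv⟩
    exact this
  · rw [h1]
    have : Set.range (Matrix.of (Fin.cons (fun j => (v j : ℝ)) (b.map ic) : Fin (k + 1) → Vc (n + 1))).row
      = insert (fun j => (v j : ℝ)) (Set.range (b.map ic).row) := by
      exact Fin.range_cons _ _
    rw [this, Submodule.span_insert, h.2, sup_comm]

lemma repOf_bot : RepOf (Matrix.of (fun (i : Fin 0) (_ : Fin (n + 1)) => (0 : ℤ))) ⊥ := by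
  constructor
  · exact linearIndependent_empty_type
  · simp

lemma psi_zero {d : ℕ} (rw : Fin d → Row n → Vc (n + 1)) (B : Matrix (Fin 0) (Fin (n + 1)) ℝ) :
    psi rw B = d := by
  simp [psi, pdet]

end Rep
section Sup
variable {d n : ℕ}

lemma sup_one (b : Matrix (Fin 1) (Fin (n + 1)) ℤ) {W : Submodule ℝ (Vc (n + 1))} (hb : RepOf b W)
    (F : (Vc d) → Vc (n + 1)) (D : Fin d → (Vc d) → Vc (n + 1)) (i0 : Fin d)
    (Y : Set (Vc d)) (cB : ℝ) (hcB : 0 < cB)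
    (h3 : ∀ p : Vc (n + 1), ∃ x ∈ Y, cB * ‖p‖ ≤ |p ⬝ᵥ F x|)
    (α β γ : ℝ) (hα : 0 < α) (hα1 : 1 ≤ α * cB) :
    ∃ x ∈ Y, 1 ≤ psi (fun i => rowv α β γ (F x) (D i x)) (b.map ic) := by
  set p : Vc (n + 1) := fun j => (b 0 j : ℝ) with hp
  have hp1 : 1 ≤ ‖p‖ := by
    have hne : (b.map ic).row 0 ≠ 0 := hb.1.ne_zero 0
    obtain ⟨j, hj⟩ := Function.ne_iff.1 hne
    have hj' : b 0 j ≠ 0 := by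
      intro h0; apply hj; simp [Matrix.row, h0]
    refine le_trans ?_ (norm_le_pi_norm p j)
    rw [Real.norm_eq_abs]
    have := Int.one_le_abs hj'
    simp only [hp]
    exact_mod_cast this
  obtain ⟨x, hx, hxp⟩ := h3 p
  refine ⟨x, hx, ?_⟩
  have h1 := psi_term_le (fun i => rowv α β γ (F x) (D i x)) (b.map ic) (fun _ => none)
  have h2 : ∀ i, |pdet (fun _ : Fin 1 => rowv α β γ (F x) (D i x) none) (b.map ic)| =
      α * |p ⬝ᵥ F x| := by
    intro i
    have : pdet (fun _ : Fin 1 => rowv α β γ (F x) (D i x) none) (b.map ic) =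
        α * (p ⬝ᵥ F x) := by
      simp [pdet, rowv, Matrix.mul_apply, dotProduct, Finset.mul_sum, hp]
      refine Finset.sum_congr rfl fun j _ => by ring
    rw [this, abs_mul, abs_of_pos hα]
  refine le_trans ?_ h1
  refine le_trans ?_ (Finset.single_le_sum (fun i _ => abs_nonneg _) (Finset.mem_univ i0))
  rw [h2]
  calc 1 ≤ α * cB := hα1
    _ ≤ α * (cB * ‖p‖) := by nlinarith [mul_pos hα hcB]
    _ ≤ _ := by gcongr

lemma sup_mid {k : ℕ} (hk : 2 ≤ k) (b : Matrix (Fin k) (Fin (n + 1)) ℤ)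
    {W : Submodule ℝ (Vc (n + 1))} (hb : RepOf b W)
    (F : (Vc d) → Vc (n + 1)) (D : Fin d → (Vc d) → Vc (n + 1))
    (Y : Set (Vc d)) (cB : ℝ) (hcB : 0 < cB)
    (h3 : ∀ (p q : Vc (n + 1)) a b, ∃ x ∈ Y, cB * |p a * q b - q a * p b| ≤ ∑ i, |Wd F D p q i x|)
    (α β γ : ℝ) (hα : 0 < α) (hβ : 0 < β) (hγ : 0 < γ) (h1 : 1 ≤ α * β * γ ^ (k - 2) * cB) :
    ∃ x ∈ Y, 1 ≤ psi (fun i => rowv α β γ (F x) (D i x)) (b.map ic) := by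
  classical
  obtain ⟨J, hJ, hne⟩ := exists_minor _ hb.1
  have hmin := abs_pdet_int b J hne
  obtain ⟨i0, hi0⟩ : ∃ i0 : Fin k, ∀ t, t ≠ i0 → J t ≠ 0 := by
    by_cases h : ∃ t, J t = 0
    · obtain ⟨t, ht⟩ := h
      exact ⟨t, fun s hs h0 => hs (hJ (h0.trans ht.symm))⟩
    · push Not at h
      exact ⟨⟨0, by omega⟩, fun t _ => h t⟩
  have : Nontrivial (Fin k) := Fin.nontrivial_iff_two_le.2 hk
  obtain ⟨j0, hj0⟩ := exists_ne i0
  set σ : Fin k → Row n := fun t => if t = i0 then none else if t = j0 then some none else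
    if h : J t = 0 then none else some (some ((J t).pred h)) with hσ
  have hσi : σ i0 = none := by simp [hσ]
  have hσj : σ j0 = some none := by simp [hσ, hj0]
  have hσt : ∀ t, t ≠ i0 → t ≠ j0 → ∃ j : Fin n, σ t = some (some j) ∧ j.succ = J t := by
    intro t h1 h2
    have h3 := hi0 t h1
    exact ⟨(J t).pred h3, by simp [hσ, h1, h2, h3], by simp⟩
  have hinj : Function.Injective σ := by
    intro s t hst
    by_cases hs1 : s = i0
    · by_cases ht1 : t = i0
      · rw [hs1, ht1]
      · by_cases ht2 : t = j0
        · subst hs1 ht2; rw [hσi, hσj] at hst; simp at hst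
        · obtain ⟨j, hj, _⟩ := hσt t ht1 ht2
          subst hs1; rw [hσi, hj] at hst; simp at hst
    · by_cases hs2 : s = j0
      · by_cases ht1 : t = i0
        · subst hs2 ht1; rw [hσi, hσj] at hst; simp at hst
        · by_cases ht2 : t = j0
          · rw [hs2, ht2]
          · obtain ⟨j, hj, _⟩ := hσt t ht1 ht2
            subst hs2; rw [hσj, hj] at hst; simp at hst
      · obtain ⟨j, hj, hj'⟩ := hσt s hs1 hs2
        by_cases ht1 : t = i0
        · subst ht1; rw [hσi, hj] at hst; simp at hst
        · by_cases ht2 : t = j0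
          · subst ht2; rw [hσj, hj] at hst; simp at hst
          · obtain ⟨j2, hj2, hj2'⟩ := hσt t ht1 ht2
            rw [hj, hj2] at hst
            simp at hst
            apply hJ
            rw [← hj', ← hj2', hst]
  obtain ⟨p, q, hpq, hpq2⟩ := FG_form α β γ (b.map ic) σ hinj i0 j0 hσi hσj
  obtain ⟨x, hx, hxw⟩ := h3 p q (J i0) (J j0)
  refine ⟨x, hx, ?_⟩
  refine le_trans ?_ (psi_term_le (fun i => rowv α β γ (F x) (D i x)) (b.map ic) σ)
  have he : ∑ i, |Wd F D p q i x| = ∑ i, |pdet (fun t => rowv α β γ (F x) (D i x) (σ t)) (b.map ic)| := by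
    refine Finset.sum_congr rfl fun i _ => ?_
    rw [hpq]; rfl
  rw [← he]
  refine le_trans ?_ hxw
  rw [hpq2]
  set s : Vc k := fun t => if t = i0 ∨ t = j0 then 1 else γ with hs
  have hupd : Function.update (Function.update (fun t => rowv α β γ 0 0 (σ t)) i0 (Pi.single (J i0) 1)) j0
      (Pi.single (J j0) 1) = fun t => s t • (Pi.single (J t) 1 : Vc (n + 1)) := by
    ext1 t
    by_cases ht2 : t = j0
    · subst ht2; simp [hs]
    · by_cases ht1 : t = i0
      · subst ht1; simp [hs, ht2]
      · rw [Function.update_of_ne ht2, Function.update_of_ne ht1]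
        obtain ⟨j, hj, hj'⟩ := hσt t ht1 ht2
        simp [hj, rowv, hs, ht1, ht2, hj']
  rw [hupd, pdet_smul]
  have hprod : ∏ t, s t = γ ^ (k - 2) := by
    rw [hs, Finset.prod_ite]
    simp only [Finset.prod_const_one, one_mul, Finset.prod_const]
    congr 1
    rw [← Finset.compl_filter, Finset.card_compl]
    have : (Finset.univ.filter fun t => t = i0 ∨ t = j0) = {i0, j0} := by
      ext t; simp
    rw [this, Finset.card_pair hj0.symm]; simp
  rw [hprod, abs_mul (α * β), abs_mul (γ ^ (k - 2)), abs_of_pos (mul_pos hα hβ), abs_of_pos (pow_pos hγ _)]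
  have h0 : 0 < α * β * γ ^ (k - 2) * cB := by positivity
  nlinarith

lemma sup_top (hn : 1 ≤ n) (b : Matrix (Fin (n + 1)) (Fin (n + 1)) ℤ)
    {W : Submodule ℝ (Vc (n + 1))} (hb : RepOf b W)
    (F : (Vc d) → Vc (n + 1)) (D : Fin d → (Vc d) → Vc (n + 1)) (i0 : Fin d)
    (hF0 : ∀ x, F x 0 = 1) (hD0 : ∀ i x, D i x 0 = 0) (x : Vc d)
    (hD1 : D i0 x 1 = 1)
    (α β γ : ℝ) (hα : 0 < α) (hβ : 0 < β) (hγ : 0 < γ) (h1 : 1 ≤ α * β * γ ^ (n - 1)) :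
    1 ≤ psi (fun i => rowv α β γ (F x) (D i x)) (b.map ic) := by
  classical
  obtain ⟨n, rfl⟩ : ∃ n', n = n' + 1 := ⟨n - 1, by omega⟩
  set σ : Fin (n + 1 + 1) → Row (n + 1) := Fin.cons none (Fin.cons (some none)
    (fun t : Fin n => some (some t.succ))) with hσ
  refine le_trans ?_ (psi_term_le (fun i => rowv α β γ (F x) (D i x)) (b.map ic) σ)
  refine le_trans ?_ (Finset.single_le_sum (fun i _ => abs_nonneg _) (Finset.mem_univ i0))
  unfold pdet
  rw [Matrix.det_mul, Matrix.det_transpose, abs_mul]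
  have hdet : (Matrix.of fun t => rowv α β γ (F x) (D i0 x) (σ t)).det = α * β * γ ^ n := by
    rw [Matrix.det_of_isUpperTriangular]
    · rw [Fin.prod_univ_succ, Fin.prod_univ_succ]
      have e0 : (Matrix.of fun t => rowv α β γ (F x) (D i0 x) (σ t)) 0 0 = α := by
        simp [hσ, rowv, hF0]
      have e1 : (Matrix.of fun t => rowv α β γ (F x) (D i0 x) (σ t)) (Fin.succ 0) (Fin.succ 0) = β := by
        simp [hσ, rowv]
        rw [hD1, mul_one]
      have e2 : ∀ t : Fin n, (Matrix.of fun t => rowv α β γ (F x) (D i0 x) (σ t)) t.succ.succ t.succ.succ = γ := by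
        intro t
        simp [hσ, rowv]
      simp only [e0, e1, e2]
      simp
      ring
    · intro i j hij
      simp only [id] at hij
      rw [Matrix.of_apply]
      revert hij
      refine Fin.cases ?_ (fun i => ?_) i
      · intro h; exact absurd h (by simp)
      · refine Fin.cases ?_ (fun i => ?_) i
        · intro h
          have : j = 0 := by
            ext; have := Fin.lt_def.1 h; simp at this; simp [this]
          subst this
          simp [hσ, rowv, hD0]
        · intro h
          simp [hσ, rowv, h.ne]
  have hB : 1 ≤ |(b.map ic).det| := by
    have h0 : (b.map ic).det ≠ 0 := by
      have := (Matrix.linearIndependent_rows_iff_isUnit).1 hb.1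
      exact ((Matrix.isUnit_iff_isUnit_det _).1 this).ne_zero
    have h2 : (b.map ic).det = ((b.det : ℤ) : ℝ) := by
      rw [Int.cast_det]
    rw [h2] at h0 ⊢
    have h3 : b.det ≠ 0 := by intro h; exact h0 (by rw [h]; simp)
    exact_mod_cast Int.one_le_abs h3
  rw [hdet, abs_of_pos (by positivity)]
  simp at h1
  nlinarith
end Sup
section BKM
variable {d n : ℕ}

abbrev RS (n : ℕ) := {W : Submodule ℝ (Vc (n + 1)) //
  W ≠ ⊥ ∧ ∃ (k : ℕ) (b : Matrix (Fin k) (Fin (n + 1)) ℤ), RepOf b W}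

noncomputable def kk (s : RS n) : ℕ := (exists_rep s.2.2).choose
noncomputable def bb (s : RS n) : Matrix (Fin (kk s)) (Fin (n + 1)) ℤ :=
  (exists_rep s.2.2).choose_spec.choose

lemma bb_rep (s : RS n) : RepOf (bb s) s.1 := (exists_rep s.2.2).choose_spec.choose_spec.1
lemma bb_min (s : RS n) {k' : ℕ} {b' : Matrix (Fin k') (Fin (n + 1)) ℤ} (h : RepOf b' s.1)
    (rw : Fin d → Row n → Vc (n + 1)) :
    psi rw ((bb s).map ic) ≤ psi rw (b'.map ic) :=
  (exists_rep s.2.2).choose_spec.choose_spec.2 _ _ h _ _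

lemma kk_pos (s : RS n) : 1 ≤ kk s := by
  have h := (bb_rep s).finrank
  have h2 : Module.finrank ℝ s.1 ≠ 0 := by
    intro h0
    exact s.2.1 (Submodule.finrank_eq_zero.1 h0)
  omega

lemma marked_good (rw : Fin d → Row n → Vc (n + 1)) (c ν : ℝ) (hc : 0 < c) (hc1 : c ≤ 1) (hν : 0 < ν)
    (hcν : (n + 2) ^ (n + 1) * ((n + 1) * ν * (d + 1 / c)) < c)
    (F' : Finset (RS n)) (hch : ∀ s ∈ F', ∀ s' ∈ F', s ≠ s' → (s < s' ∨ s' < s))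
    (hF' : ∀ s ∈ F', c ≤ psi rw ((bb s).map ic) ∧ psi rw ((bb s).map ic) ≤ 1 / c)
    (hco : ∀ s, (∀ s' ∈ F', (s < s' ∨ s' < s)) → 1 ≤ psi rw ((bb s).map ic))
    (v : Fin (n + 1) → ℤ) (hv : v ≠ 0) (hvν : ∀ i ρ, |rw i ρ ⬝ᵥ (fun j => (v j : ℝ))| ≤ ν) : False := by
  classical
  set vr : Vc (n + 1) := fun j => (v j : ℝ) with hvr
  have hvr0 : vr ≠ 0 := by
    intro h
    apply hv
    ext j
    have := congrFun h j
    simp only [hvr, Pi.zero_apply] at this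
    exact_mod_cast this
  obtain ⟨W', k', b', hb', hvW, hpsi, hsub, hsup⟩ : ∃ (W' : Submodule ℝ (Vc (n + 1))) (k' : ℕ)
      (b' : Matrix (Fin k') (Fin (n + 1)) ℤ), RepOf b' W' ∧ vr ∉ W' ∧
      psi rw (b'.map ic) ≤ d + 1 / c ∧ (∀ s ∈ F', vr ∉ s.1 → s.1 ≤ W') ∧
      (∀ s ∈ F', vr ∈ s.1 → W' ≤ s.1) := by
    by_cases hG : (F'.filter (fun s => vr ∉ s.1)).Nonempty
    · obtain ⟨w, hw, hmax⟩ := Finset.exists_max_image _ (fun s : RS n => Module.finrank ℝ s.1) hG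
      rw [Finset.mem_filter] at hw
      refine ⟨w.1, kk w, bb w, bb_rep w, hw.2, ?_, ?_, ?_⟩
      · have := (hF' w hw.1).2
        have : (0:ℝ) ≤ d := Nat.cast_nonneg d
        linarith
      · intro s hs hvs
        by_cases hsw : s = w
        · rw [hsw]
        rcases hch s hs w hw.1 hsw with h | h
        · exact h.le
        · exfalso
          have h1 := Submodule.finrank_lt_finrank_of_lt (show w.1 < s.1 from h)
          have h2 := hmax s (Finset.mem_filter.2 ⟨hs, hvs⟩)
          omega
      · intro s hs hvs
        by_cases hsw : s = w
        · rw [hsw]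
        rcases hch s hs w hw.1 hsw with h | h
        · exact absurd ((show s.1 ≤ w.1 from h.le) hvs) hw.2
        · exact h.le
    · rw [Finset.not_nonempty_iff_eq_empty, Finset.filter_eq_empty_iff] at hG
      refine ⟨⊥, 0, _, repOf_bot, by simpa using hvr0, ?_, ?_, ?_⟩
      · rw [psi_zero]
        have : 0 < 1 / c := by positivity
        linarith
      · intro s hs hvs
        exact absurd hvs (hG hs)
      · intro s _ _; exact bot_le
  obtain ⟨hmap, hrep⟩ := hb'.cons v hvW
  set X := W' ⊔ Submodule.span ℝ {vr} with hX
  have hvX : vr ∈ X := by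
    exact (le_sup_right : _ ≤ X) (Submodule.mem_span_singleton_self vr)
  have hX0 : X ≠ ⊥ := by
    intro h
    rw [h] at hvX
    exact hvr0 (by simpa using hvX)
  let sX : RS n := ⟨X, hX0, _, _, hrep⟩
  have hcX : c ≤ psi rw ((bb sX).map ic) := by
    by_cases hXF : sX ∈ F'
    · exact (hF' sX hXF).1
    · refine hc1.trans (hco sX ?_)
      intro s hs
      have hne : s ≠ sX := fun h => hXF (h ▸ hs)
      by_cases hvs : vr ∈ s.1
      · left
        refine lt_of_le_of_ne ?_ hne.symm
        change X ≤ s.1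
        refine sup_le (hsup s hs hvs) ?_
        rw [Submodule.span_singleton_le_iff_mem]; exact hvs
      · right
        refine lt_of_le_of_ne ?_ hne
        change s.1 ≤ X
        exact (hsub s hs hvs).trans le_sup_left
  have h1 := bb_min sX hrep rw
  rw [hmap] at h1
  have h2 := psi_cons rw (b'.map ic) hrep.le vr ν hν.le hvν
  have h3 : ((n:ℝ) + 2) ^ (n + 1) * ((n + 1) * ν * psi rw (b'.map ic)) ≤
      (n + 2) ^ (n + 1) * ((n + 1) * ν * (d + 1 / c)) := by gcongr
  linarith

theorem BKM (hn : 2 ≤ n) (i0 : Fin d) {x0 : Vc d} {R c : ℝ} {τ : ℝ≥0∞} (hτ : τ * 6 ^ d < 1)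
    (F : (Vc d) → Vc (n + 1)) (D : Fin d → (Vc d) → Vc (n + 1))
    (hF0 : ∀ x, F x 0 = 1) (hD0 : ∀ i x, D i x 0 = 0)
    (hD1 : ∀ x ∈ Bl x0 R, D i0 x 1 = 1) (hc : 0 < c) (hc1 : c ≤ 1)
    (hFc : ContinuousOn F (Bl x0 R)) (hDc : ∀ i, ContinuousOn (D i) (Bl x0 R))
    (hG1 : ∀ p, GoodOn x0 R c τ (fun x => |p ⬝ᵥ F x|))
    (hG2 : ∀ p q, GoodOn x0 R c τ (fun x => ∑ i, |Wd F D p q i x|))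
    (h3 : ∀ y r, 0 < r → dist y x0 + r < R → ∃ cB : ℝ, 0 < cB ∧
      (∀ p : Vc (n + 1), ∃ x ∈ Bl y r, cB * ‖p‖ ≤ |p ⬝ᵥ F x|) ∧
      (∀ (p q : Vc (n + 1)) a b, ∃ x ∈ Bl y r,
        cB * |p a * q b - q a * p b| ≤ ∑ i, |Wd F D p q i x|)) :
    ∃ κ : ℝ, 0 < κ ∧ ∀ y r, 0 < r → dist y x0 + 20 ^ (n + 1) * r < R → ∃ cB : ℝ, 0 < cB ∧
      ∀ δ K T : ℝ, 0 < δ → δ ≤ cB → 0 < K → 1 ≤ T → δ * K * T ^ (n - 2) ≤ cB →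
        δ * K * T ^ (n - 1) ≤ κ →
        volume {x | x ∈ Bl y r ∧ ∃ a : Fin (n + 1) → ℤ, a ≠ 0 ∧
          |(fun j => (a j : ℝ)) ⬝ᵥ F x| < δ ∧ (∀ i, |(fun j => (a j : ℝ)) ⬝ᵥ D i x| < K) ∧
          ∀ j : Fin n, |(a j.succ : ℝ)| < T} ≤ KMA d (n + 1) * τ * volume (Bl y r) := by
  classical
  set c' : ℝ := c / (n + 2) ^ (n + 1) with hc'
  have hc'0 : 0 < c' := by positivity
  have hc'1 : c' ≤ 1 := by
    rw [hc', div_le_one (by positivity)]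
    refine hc1.trans (one_le_pow₀ ?_)
    have : (0:ℝ) ≤ n := Nat.cast_nonneg n
    linarith
  set lam : ℝ := min 1 (c' / (2 * ((n + 2) ^ (n + 1) * ((n + 1) * (d + 1 / c'))))) with hlam
  have hlam0 : 0 < lam := by
    rw [hlam]; positivity
  have hlam1 : lam ≤ 1 := min_le_left _ _
  have hlamc : (n + 2) ^ (n + 1) * ((n + 1) * lam * (d + 1 / c')) < c' := by
    have h1 : lam ≤ c' / (2 * ((n + 2) ^ (n + 1) * ((n + 1) * (d + 1 / c')))) := min_le_right _ _
    rw [le_div_iff₀ (by positivity)] at h1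
    nlinarith
  refine ⟨lam ^ (n + 1), by positivity, ?_⟩
  intro y r hr hyR
  have h20 : (1:ℝ) ≤ 20 ^ (n + 1) := one_le_pow₀ (by norm_num)
  have hyR' : dist y x0 + r < R := by nlinarith
  obtain ⟨cB, hcB, hB1, hB2⟩ := h3 y r hr hyR'
  refine ⟨lam ^ (n + 1) * cB, by positivity, ?_⟩
  intro δ K T hδ hδc hK hT hmid htop
  have hT0 : 0 < T := by linarith
  set α := lam / δ with hα
  set β := lam / K with hβ
  set γ := lam / T with hγ
  have hα0 : 0 < α := by positivity
  have hβ0 : 0 < β := by positivity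
  have hγ0 : 0 < γ := by positivity
  have hlampow : ∀ k, k ≤ n + 1 → lam ^ (n + 1) ≤ lam ^ k := fun k hk =>
    pow_le_pow_of_le_one hlam0.le hlam1 hk
  have : Nonempty (RS n) := by
    let e : Fin (n + 1) → ℤ := Pi.single 0 1
    have he : (fun j => (e j : ℝ)) ∉ (⊥ : Submodule ℝ (Vc (n + 1))) := by
      intro h
      have := congrFun ((Submodule.mem_bot ℝ).1 h) 0
      simp [e] at this
    have h := (repOf_bot (n := n)).cons e he
    refine ⟨⟨_, ?_, _, _, h.2⟩⟩
    intro h0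
    apply he
    rw [← h0]
    exact Submodule.mem_sup_right (Submodule.mem_span_singleton_self _)
  set ψ : RS n → (Vc d) → ℝ := fun s x =>
    psi (fun i => rowv α β γ (F x) (D i x)) ((bb s).map ic) with hψ
  have hKM := KM_induction (S := RS n) (fun s s' => s < s' ∨ s' < s) (fun s h => by simp at h)
    (fun s s' h => h.symm) ψ x0 R
    (fun s => psi_continuousOn F D _ hFc hDc α β γ _) (n + 1)
    (by
      intro F hF
      have h1 : Set.InjOn (fun s : RS n => kk s) F := by
        intro s hs s' hs' h
        by_contra hne
        have e1 := (bb_rep s).finrank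
        have e2 := (bb_rep s').finrank
        simp only at h
        rcases hF s hs s' hs' hne with h' | h'
        · have := Submodule.finrank_lt_finrank_of_lt (show s.1 < s'.1 from h'); omega
        · have := Submodule.finrank_lt_finrank_of_lt (show s'.1 < s.1 from h'); omega
      have h2 : F.card ≤ (Finset.Icc 1 (n + 1)).card :=
        Finset.card_le_card_of_injOn (fun s => kk s) (fun s _ => by
          simp only [Finset.coe_Icc, Set.mem_Icc]
          exact ⟨kk_pos s, (bb_rep s).le⟩) h1
      simpa using h2)
    c' hc'0 τ hτ
    (fun s => good_psi F D hF0 hD0 hc hc1 hG1 hG2 α β γ (bb_rep s).le _)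
    (n + 1) ∅ (by simp) (by simp) y r hr hyR
    (by
      intro s _
      have hk1 := kk_pos s
      have hk2 := (bb_rep s).le
      by_cases hk : kk s = 1
      · have key : ∀ k (b : Matrix (Fin k) (Fin (n + 1)) ℤ), k = 1 → RepOf b s.1 → ∃ x ∈ Bl y r,
            1 ≤ psi (fun i => rowv α β γ (F x) (D i x)) (b.map ic) := by
          rintro k b rfl hb
          refine sup_one b hb F D i0 _ cB hcB hB1 α β γ hα0 ?_
          rw [hα, div_mul_eq_mul_div, le_div_iff₀ hδ, one_mul]
          refine hδc.trans ?_
          have := hlampow 1 (by omega)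
          rw [pow_one] at this
          gcongr
        exact key _ _ hk (bb_rep s)
      by_cases hk' : kk s = n + 1
      · have key : ∀ k (b : Matrix (Fin k) (Fin (n + 1)) ℤ), k = n + 1 → RepOf b s.1 → ∃ x ∈ Bl y r,
            1 ≤ psi (fun i => rowv α β γ (F x) (D i x)) (b.map ic) := by
          rintro k b rfl hb
          refine ⟨y, Metric.mem_ball_self hr, ?_⟩
          refine sup_top (by omega) b hb F D i0 hF0 hD0 y (hD1 y ?_) α β γ hα0 hβ0 hγ0 ?_
          · rw [Metric.mem_ball]; linarith
          · have e : α * β * γ ^ (n - 1) = lam ^ (n + 1) / (δ * K * T ^ (n - 1)) := by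
              rw [hα, hβ, hγ, div_pow]
              obtain ⟨l, rfl⟩ : ∃ l, n = l + 1 := ⟨n - 1, by omega⟩
              simp only [Nat.add_sub_cancel]
              field_simp
              ring
            rw [e, le_div_iff₀ (by positivity), one_mul]
            exact htop
        exact key _ _ hk' (bb_rep s)
      · refine sup_mid (by omega) (bb s) (bb_rep s) F D _ cB hcB hB2 α β γ hα0 hβ0 hγ0 ?_
        have e : α * β * γ ^ (kk s - 2) = lam ^ (kk s) / (δ * K * T ^ (kk s - 2)) := by
          rw [hα, hβ, hγ, div_pow]
          obtain ⟨l, hl⟩ : ∃ l, kk s = l + 2 := ⟨kk s - 2, by omega⟩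
          rw [hl]
          simp only [Nat.add_sub_cancel]
          field_simp
          ring
        rw [e, div_mul_eq_mul_div, le_div_iff₀ (by positivity), one_mul]
        calc δ * K * T ^ (kk s - 2) ≤ δ * K * T ^ (n - 2) := by
              have := pow_le_pow_right₀ hT (show kk s - 2 ≤ n - 2 by omega)
              exact mul_le_mul_of_nonneg_left this (mul_pos hδ hK).le
          _ ≤ lam ^ (n + 1) * cB := hmid
          _ ≤ _ := mul_le_mul_of_nonneg_right (hlampow _ hk2) hcB.le)
  refine le_trans (measure_mono ?_) hKM
  rintro x ⟨hxB, a, ha, ha1, ha2, ha3⟩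
  refine ⟨hxB, ?_⟩
  rintro ⟨F', _, hch, hF', hco⟩
  refine marked_good (fun i => rowv α β γ (F x) (D i x)) c' lam hc'0 hc'1 hlam0 hlamc F' hch
    (fun s hs => hF' s hs (by simp)) hco a ha ?_
  rintro i (_ | _ | j)
  · simp only [rowv, smul_dotProduct, smul_eq_mul, abs_mul, abs_of_pos hα0]
    rw [dotProduct_comm, hα, div_mul_eq_mul_div, div_le_iff₀ hδ]
    gcongr
  · simp only [rowv, smul_dotProduct, smul_eq_mul, abs_mul, abs_of_pos hβ0]
    rw [dotProduct_comm, hβ, div_mul_eq_mul_div, div_le_iff₀ hK]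
    gcongr
    exact (ha2 i).le
  · simp only [rowv, smul_dotProduct, smul_eq_mul, abs_mul, abs_of_pos hγ0, single_dotProduct, one_mul]
    rw [hγ, div_mul_eq_mul_div, div_le_iff₀ hT0]
    gcongr
    exact (ha3 j).le

end BKM
section Poly

lemma mvpoly_null : ∀ (d : ℕ) (P : MvPolynomial (Fin d) ℝ), P ≠ 0 →
    volume {z : Vc d | MvPolynomial.eval z P = 0} = 0 := by
  intro d
  induction d with
  | zero =>
    intro P hP
    have : {z : Vc 0 | MvPolynomial.eval z P = 0} = ∅ := by
      ext z
      simp only [mem_ofPred_eq, mem_empty_iff_false, iff_false]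
      intro h
      apply hP
      rw [MvPolynomial.eq_C_of_isEmpty P] at h ⊢
      rw [MvPolynomial.eval_C] at h
      rw [h]; simp
    rw [this]; simp
  | succ d ih =>
    intro P hP
    set e := MeasurableEquiv.piFinSuccAbove (fun _ : Fin (d + 1) => ℝ) 0 with he
    have hmp := volume_preserving_piFinSuccAbove (fun _ : Fin (d + 1) => ℝ) 0
    set Z := {w : ℝ × (Vc d) | MvPolynomial.eval (Fin.cons w.1 w.2 : Vc (d + 1)) P = 0} with hZ
    have hZc : IsClosed Z := by
      apply isClosed_eq _ continuous_const
      apply (MvPolynomial.continuous_eval P).comp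
      refine continuous_pi fun i => ?_
      refine Fin.cases ?_ (fun i => ?_) i
      · simpa using continuous_fst
      · show Continuous fun a : ℝ × (Vc d) => a.2 i
        fun_prop
    have hpre : {z : Vc (d + 1) | MvPolynomial.eval z P = 0} = e ⁻¹' Z := by
      ext z
      simp only [mem_ofPred_eq, mem_preimage, hZ, he]
      have : (Fin.cons (e z).1 (e z).2 : Vc (d + 1)) = z := by
        ext i
        refine Fin.cases ?_ (fun i => ?_) i
        · simp [he, MeasurableEquiv.piFinSuccAbove, Fin.insertNthEquiv]
        · simp [he, MeasurableEquiv.piFinSuccAbove, Fin.insertNthEquiv, Fin.removeNth]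
          rfl
      rw [this]
    rw [hpre, hmp.measure_preimage hZc.measurableSet.nullMeasurableSet]
    rw [Measure.volume_eq_prod, Measure.measure_prod_null hZc.measurableSet]
    have hfin : Set.Finite {y : ℝ | Polynomial.eval (MvPolynomial.C y) (MvPolynomial.finSuccEquiv ℝ d P) = 0} := by
      have hne : MvPolynomial.finSuccEquiv ℝ d P ≠ 0 := by
        simpa using hP
      have h1 := (MvPolynomial.finSuccEquiv ℝ d P).rootSet_finite (MvPolynomial (Fin d) ℝ)
      refine Set.Finite.of_finite_image (f := fun y : ℝ => (MvPolynomial.C y : MvPolynomial (Fin d) ℝ))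
        (h1.subset ?_) (fun a _ b _ h => MvPolynomial.C_injective _ _ h)
      rintro _ ⟨y, hy, rfl⟩
      rw [Polynomial.mem_rootSet]
      refine ⟨hne, ?_⟩
      simpa using hy
    have hae : ∀ᵐ y : ℝ, y ∉ {y : ℝ | Polynomial.eval (MvPolynomial.C y) (MvPolynomial.finSuccEquiv ℝ d P) = 0} :=
      measure_eq_zero_iff_ae_notMem.1 (hfin.measure_zero volume)
    filter_upwards [hae] with y hy
    have := ih _ hy
    simp only [Pi.zero_apply]
    rw [← this]
    congr 1
    ext s
    simp only [hZ, mem_preimage, mem_ofPred_eq]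
    rw [MvPolynomial.eval_polynomial_eval_finSuccEquiv]
    simp only [MvPolynomial.eval_C]
    rfl

lemma mvpoly_hasFDerivAt {d : ℕ} (P : MvPolynomial (Fin d) ℝ) (z : Vc d) :
    HasFDerivAt (fun z => MvPolynomial.eval z P)
      (∑ i, MvPolynomial.eval z (MvPolynomial.pderiv i P) •
        (ContinuousLinearMap.proj i : (Vc d) →L[ℝ] ℝ)) z := by
  induction P using MvPolynomial.induction_on with
  | C a => simpa using hasFDerivAt_const a z
  | add p q hp hq =>
    have hfun : (fun z => MvPolynomial.eval z (p + q)) = fun z => MvPolynomial.eval z p + MvPolynomial.eval z q := by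
      funext z; simp
    rw [hfun]
    refine (hp.add hq).congr_fderiv ?_
    simp [add_smul, Finset.sum_add_distrib]
  | mul_X p j hp =>
    have hX : HasFDerivAt (fun z : Vc d => z j) (ContinuousLinearMap.proj j : (Vc d) →L[ℝ] ℝ) z :=
      (ContinuousLinearMap.proj j : (Vc d) →L[ℝ] ℝ).hasFDerivAt
    have hfun : (fun z => MvPolynomial.eval z (p * MvPolynomial.X j)) = fun z => MvPolynomial.eval z p * z j := by
      funext z; simp
    rw [hfun]
    refine (hp.mul hX).congr_fderiv ?_
    rw [Finset.smul_sum]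
    have h1 : (MvPolynomial.eval z p • ContinuousLinearMap.proj j : (Vc d) →L[ℝ] ℝ) =
        ∑ i, (if i = j then MvPolynomial.eval z p else 0) • (ContinuousLinearMap.proj i : (Vc d) →L[ℝ] ℝ) := by
      simp [ite_smul]
    rw [h1, ← Finset.sum_add_distrib]
    refine Finset.sum_congr rfl fun i _ => ?_
    rw [smul_smul, ← add_smul]
    congr 1
    by_cases h : i = j
    · subst h; simp
    · simp [MvPolynomial.pderiv_X_of_ne (Ne.symm h), h]

noncomputable def MI (d l : ℕ) : Finset (Fin d →₀ ℕ) := (Finsupp.finite_of_degree_le (σ := Fin d) l).toFinset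

lemma mem_MI {d l : ℕ} {ν : Fin d →₀ ℕ} : ν ∈ MI d l ↔ ν.degree ≤ l := by simp [MI]

noncomputable def TP {d : ℕ} (l : ℕ) (c : (Fin d →₀ ℕ) → ℝ) : MvPolynomial (Fin d) ℝ :=
  ∑ ν ∈ MI d l, MvPolynomial.monomial ν (c ν / ∏ i, ((ν i).factorial : ℝ))

lemma pderiv_TP {d : ℕ} (l : ℕ) (c : (Fin d →₀ ℕ) → ℝ) (i : Fin d) :
    MvPolynomial.pderiv i (TP (l + 1) c) = TP l (fun ν => c (ν + Finsupp.single i 1)) := by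
  classical
  unfold TP
  rw [map_sum]
  simp only [MvPolynomial.pderiv_monomial]
  symm
  refine Finset.sum_bij_ne_zero (fun ν _ _ => ν + Finsupp.single i 1) ?_ ?_ ?_ ?_
  · intro ν hν _
    rw [mem_MI] at hν ⊢
    rw [map_add, Finsupp.degree_single]; omega
  · intro a _ _ b _ _ h
    exact add_right_cancel h
  · intro ν hν hne
    have hi : ν i ≠ 0 := by
      intro h0
      apply hne
      simp [h0]
    have heq : ν - Finsupp.single i 1 + Finsupp.single i 1 = ν := by
      apply tsub_add_cancel_of_le
      rw [Finsupp.single_le_iff]; omega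
    have hdeg : (ν - Finsupp.single i 1).degree + 1 = ν.degree := by
      conv_rhs => rw [← heq]
      rw [map_add, Finsupp.degree_single]
    refine ⟨ν - Finsupp.single i 1, ?_, ?_, heq⟩
    · rw [mem_MI] at hν ⊢; omega
    · rw [heq]
      intro h0
      apply hne
      rw [MvPolynomial.monomial_eq_zero] at h0 ⊢
      rw [div_eq_zero_iff] at h0
      rcases h0 with h0 | h0
      · simp [h0]
      · exfalso
        exact (Finset.prod_ne_zero_iff.2 (fun j _ => by positivity)) h0
  · intro ν hν _
    congr 1
    · simp
    · have hprod : (∏ j, (((ν + Finsupp.single i 1 : Fin d →₀ ℕ) j).factorial : ℝ)) =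
          (ν i + 1) * ∏ j, ((ν j).factorial : ℝ) := by
        rw [← Finset.mul_prod_erase _ _ (Finset.mem_univ i), ← Finset.mul_prod_erase _ (fun j => ((ν j).factorial : ℝ)) (Finset.mem_univ i)]
        have : ∀ j ∈ Finset.univ.erase i, (((ν + Finsupp.single i 1 : Fin d →₀ ℕ) j).factorial : ℝ) = ((ν j).factorial : ℝ) := by
          intro j hj
          have : i ≠ j := (Finset.ne_of_mem_erase hj).symm
          simp [Finsupp.single_apply, this]
        rw [Finset.prod_congr rfl this]
        simp [Nat.factorial_succ]
        ring
      have h1 : (∏ j, ((ν j).factorial : ℝ)) ≠ 0 := Finset.prod_ne_zero_iff.2 fun i _ => by positivity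
      rw [hprod]
      have h2 : (ν i + 1 : ℝ) ≠ 0 := by positivity
      simp
      field_simp

noncomputable def PW {d : ℕ} (P Q : MvPolynomial (Fin d) ℝ) (i : Fin d) : MvPolynomial (Fin d) ℝ :=
  P * MvPolynomial.pderiv i Q - Q * MvPolynomial.pderiv i P

lemma PW_ne_zero {d : ℕ} (P Q : MvPolynomial (Fin d) ℝ) (hP : P ≠ 0)
    (h : ∀ i, PW P Q i = 0) : ∃ a : ℝ, Q = MvPolynomial.C a * P := by
  have hz : ∃ z, MvPolynomial.eval z P ≠ 0 := by
    by_contra hno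
    push Not at hno
    exact hP (MvPolynomial.funext fun z => by rw [hno z]; simp)
  obtain ⟨z0, hz0⟩ := hz
  have hop : IsOpen {z | MvPolynomial.eval z P ≠ 0} :=
    isOpen_ne_fun (MvPolynomial.continuous_eval P) continuous_const
  obtain ⟨ε, hε, hball⟩ := Metric.isOpen_iff.1 hop z0 hz0
  set a := MvPolynomial.eval z0 Q / MvPolynomial.eval z0 P with ha
  have hconst : ∀ z ∈ Bl z0 ε, MvPolynomial.eval z Q / MvPolynomial.eval z P = a := by
    intro z hz
    have hd : ∀ z ∈ Bl z0 ε, HasFDerivAt (fun z => MvPolynomial.eval z Q / MvPolynomial.eval z P) (0 : (Vc d) →L[ℝ] ℝ) z := by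
      intro z hz
      have hPz : MvPolynomial.eval z P ≠ 0 := hball hz
      have hinv := (hasDerivAt_inv hPz).comp_hasFDerivAt z (mvpoly_hasFDerivAt P z)
      have hmul := (mvpoly_hasFDerivAt Q z).mul hinv
      have hfun : (fun z => MvPolynomial.eval z Q / MvPolynomial.eval z P) =
          (fun z => MvPolynomial.eval z Q * ((fun y => y⁻¹) ∘ fun z => MvPolynomial.eval z P) z) := by
        funext z; simp [div_eq_mul_inv]
      rw [hfun]
      refine hmul.congr_fderiv ?_
      simp only [Function.comp]
      rw [smul_smul]
      rw [Finset.smul_sum, Finset.smul_sum, ← Finset.sum_add_distrib]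
      refine Finset.sum_eq_zero fun i _ => ?_
      rw [smul_smul, smul_smul, ← add_smul]
      have h1 := congrArg (MvPolynomial.eval z) (h i)
      simp only [PW, map_sub, map_mul, map_zero] at h1
      have h2 : MvPolynomial.eval z Q * -(MvPolynomial.eval z P ^ 2)⁻¹ * MvPolynomial.eval z (MvPolynomial.pderiv i P) +
          (MvPolynomial.eval z P)⁻¹ * MvPolynomial.eval z (MvPolynomial.pderiv i Q) = 0 := by
        field_simp
        linarith
      rw [h2, zero_smul]
    have hcv : Convex ℝ (Bl z0 ε) := convex_ball _ _
    exact hcv.is_const_of_fderivWithin_eq_zero (𝕜 := ℝ) (f := fun z => MvPolynomial.eval z Q / MvPolynomial.eval z P)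
      (fun z hz => (hd z hz).differentiableAt.differentiableWithinAt)
      (fun z hz => by
        rw [fderivWithin_of_isOpen Metric.isOpen_ball hz]
        exact (hd z hz).fderiv) hz (Metric.mem_ball_self hε)
  refine ⟨a, ?_⟩
  by_contra hne
  have hn := mvpoly_null d (Q - MvPolynomial.C a * P) (sub_ne_zero.2 hne)
  have hsub : Bl z0 ε ⊆ {z | MvPolynomial.eval z (Q - MvPolynomial.C a * P) = 0} := by
    intro z hz
    have h1 := hconst z hz
    have h2 : MvPolynomial.eval z P ≠ 0 := hball hz
    rw [div_eq_iff h2] at h1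
    simp [h1]
  have := measure_mono_null hsub hn
  exact (Metric.measure_ball_pos volume z0 hε).ne' this

lemma compact_level {X : Type*} [TopologicalSpace X] {d : ℕ} (K : Set X) (hK : IsCompact K)
    (g : X → (Vc d) → ℝ) (hg : Continuous (fun p : X × (Vc d) => g p.1 p.2))
    (hg0 : ∀ u z, 0 ≤ g u z)
    (hnull : ∀ u ∈ K, volume {z | g u z = 0} = 0) (τ : ℝ≥0∞) (hτ : τ ≠ 0) :
    ∃ c : ℝ, 0 < c ∧ ∀ u ∈ K, volume {z | z ∈ Bl (0 : Vc d) 1 ∧ g u z ≤ c} ≤ τ := by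
  refine hK.induction_on (p := fun S => ∃ c : ℝ, 0 < c ∧ ∀ u ∈ S, volume {z | z ∈ Bl (0 : Vc d) 1 ∧ g u z ≤ c} ≤ τ)
    ⟨1, one_pos, by simp⟩ ?_ ?_ ?_
  · rintro s t hst ⟨c, hc, h⟩
    exact ⟨c, hc, fun u hu => h u (hst hu)⟩
  · rintro s t ⟨c, hc, h⟩ ⟨c', hc', h'⟩
    refine ⟨min c c', lt_min hc hc', ?_⟩
    rintro u (hu | hu)
    · exact (measure_mono (fun z hz => And.intro hz.1 (hz.2.trans (min_le_left _ _)))).trans (h u hu)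
    · exact (measure_mono (fun z hz => And.intro hz.1 (hz.2.trans (min_le_right _ _)))).trans (h' u hu)
  · intro u0 hu0
    have hgc : ∀ u, Continuous (g u) := fun u => hg.comp (by fun_prop : Continuous fun z => (u, z))
    have hlim : Tendsto (fun k : ℕ => volume {z | z ∈ Bl (0 : Vc d) 1 ∧ g u0 z ≤ 2 * (1 / ((k : ℝ) + 1))}) atTop
        (nhds (volume (⋂ k : ℕ, {z | z ∈ Bl (0 : Vc d) 1 ∧ g u0 z ≤ 2 * (1 / ((k : ℝ) + 1))}))) := by
      apply tendsto_measure_iInter_atTop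
      · intro k
        exact (Metric.isOpen_ball.measurableSet.inter
          (isClosed_le (hgc u0) continuous_const).measurableSet).nullMeasurableSet
      · intro k k' hkk z hz
        refine ⟨hz.1, hz.2.trans ?_⟩
        have : (k : ℝ) ≤ k' := by exact_mod_cast hkk
        gcongr
      · refine ⟨0, ((measure_mono (fun z hz => hz.1)).trans_lt (measure_ball_lt_top (x := (0 : Vc d)) (r := 1))).ne⟩
    have h0 : volume (⋂ k : ℕ, {z | z ∈ Bl (0 : Vc d) 1 ∧ g u0 z ≤ 2 * (1 / ((k : ℝ) + 1))}) = 0 := by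
      refine measure_mono_null ?_ (hnull u0 hu0)
      intro z hz
      simp only [mem_iInter, mem_ofPred_eq] at hz ⊢
      refine le_antisymm ?_ (hg0 u0 z)
      have hl : Tendsto (fun k : ℕ => 2 * (1 / ((k : ℝ) + 1))) atTop (nhds (2 * 0)) :=
        tendsto_one_div_add_atTop_nhds_zero_nat.const_mul 2
      rw [mul_zero] at hl
      exact ge_of_tendsto' hl fun k => (hz k).2
    rw [h0] at hlim
    obtain ⟨k, hk⟩ := (hlim.eventually (gt_mem_nhds (pos_iff_ne_zero.2 hτ))).exists
    set c0 : ℝ := 1 / ((k : ℝ) + 1) with hc0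
    have hc0p : 0 < c0 := by positivity
    have hev : ∀ᶠ u in nhds u0, ∀ z ∈ Metric.closedBall (0 : Vc d) 1, |g u z - g u0 z| < c0 := by
      apply (isCompact_closedBall (0 : Vc d) 1).eventually_forall_of_forall_eventually
      intro z _
      have hc : Continuous (fun p : X × (Vc d) => |g p.1 p.2 - g u0 p.2|) :=
        (hg.sub ((hgc u0).comp continuous_snd)).abs
      have := hc.tendsto (u0, z)
      simp only [sub_self, abs_zero] at this
      exact this.eventually (gt_mem_nhds hc0p)
    refine ⟨{u | ∀ z ∈ Metric.closedBall (0 : Vc d) 1, |g u z - g u0 z| < c0}, mem_nhdsWithin_of_mem_nhds hev, c0, hc0p, ?_⟩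
    intro u hu
    refine (measure_mono ?_).trans hk.le
    rintro z ⟨hz1, hz2⟩
    refine ⟨hz1, ?_⟩
    have := hu z (Metric.ball_subset_closedBall hz1)
    rw [abs_lt] at this
    linarith [this.1]

end Poly
section Fam

structure Fam {d N : ℕ} (l : ℕ) (x0 : Vc d) (R0 : ℝ)
    (G : (Fin d →₀ ℕ) → (Vc d) → Vc N) : Prop where
  hder : ∀ μ : Fin d →₀ ℕ, μ.degree < l → ∀ y ∈ Bl x0 R0, ∀ a : Fin N,
    HasFDerivAt (fun y => G μ y a) (∑ i, G (μ + Finsupp.single i 1) y a •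
      (ContinuousLinearMap.proj i : (Vc d) →L[ℝ] ℝ)) y
  hcont : ∀ μ : Fin d →₀ ℕ, μ.degree ≤ l → ContinuousOn (G μ) (Bl x0 R0)
  hnd : ∀ p : Vc N, p ≠ 0 → ∃ μ : Fin d →₀ ℕ, μ.degree ≤ l ∧ p ⬝ᵥ G μ x0 ≠ 0

lemma listPDeriv_contDiffOn {d N : ℕ} (g : (Vc d) → Vc N) (B : Set (Vc d)) (hB : IsOpen B) :
    ∀ (β : List (Fin d)) (l : ℕ), ContDiffOn ℝ ((l + β.length : ℕ)) g B → ContDiffOn ℝ l (listPDeriv β g) B := by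
  intro β
  induction β with
  | nil => intro l h; simpa [listPDeriv] using h
  | cons i is ih =>
    intro l h
    have h1 := ih (l + 1) (by
      have : l + 1 + is.length = l + (i :: is).length := by simp; omega
      rw [this]; exact h)
    have h2 : ContDiffOn ℝ l (fderiv ℝ (listPDeriv is g)) B :=
      h1.fderiv_of_isOpen hB (by norm_cast)
    exact h2.clm_apply contDiffOn_const

lemma listPDeriv_perm {d N : ℕ} (g : (Vc d) → Vc N) (B : Set (Vc d)) (hB : IsOpen B)
    (l : ℕ) (hg : ContDiffOn ℝ l g B) {β β' : List (Fin d)} (h : β.Perm β') (hl : β.length ≤ l) :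
    EqOn (listPDeriv β g) (listPDeriv β' g) B := by
  induction h with
  | nil => exact fun _ _ => rfl
  | cons i h ih =>
    intro y hy
    have h1 := ih (by simp at hl; omega)
    simp only [listPDeriv]
    rw [(h1.eventuallyEq_of_mem (hB.mem_nhds hy)).fderiv_eq]
  | swap i j is =>
    intro y hy
    simp only [listPDeriv]
    have hc : ContDiffOn ℝ (2 : ℕ) (listPDeriv is g) B := by
      apply listPDeriv_contDiffOn g B hB
      apply hg.of_le
      simp at hl
      exact_mod_cast (by omega : 2 + is.length ≤ l)
    have hca := hc.contDiffAt (hB.mem_nhds hy)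
    have hs := hca.isSymmSndFDerivAt (by simp)
    have hd : DifferentiableAt ℝ (fderiv ℝ (listPDeriv is g)) y :=
      (hca.fderiv_right (m := 1) (by norm_cast)).differentiableAt (by simp)
    have key : ∀ v w : Vc d, fderiv ℝ (fun x => fderiv ℝ (listPDeriv is g) x v) y w =
        fderiv ℝ (fderiv ℝ (listPDeriv is g)) y w v := by
      intro v w
      have := (hd.hasFDerivAt.clm_apply (hasFDerivAt_const v y)).fderiv
      rw [this]; simp
    rw [key, key]
    exact hs _ _
  | trans h1 h2 ih1 ih2 =>
    exact (ih1 hl).trans (ih2 (by rw [← h1.length_eq]; exact hl))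

noncomputable def canon {d : ℕ} (μ : Fin d →₀ ℕ) : List (Fin d) := (Finsupp.toMultiset μ).toList

lemma canon_coe {d : ℕ} (μ : Fin d →₀ ℕ) : ((canon μ : List (Fin d)) : Multiset (Fin d)) = Finsupp.toMultiset μ := by
  simp [canon]

lemma canon_length {d : ℕ} (μ : Fin d →₀ ℕ) : (canon μ).length = μ.degree := by
  have : (canon μ).length = Multiset.card (Finsupp.toMultiset μ) := by simp [canon]
  rw [this, Finsupp.card_toMultiset]
  rfl

lemma canon_add {d : ℕ} (μ : Fin d →₀ ℕ) (i : Fin d) : (i :: canon μ).Perm (canon (μ + Finsupp.single i 1)) := by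
  rw [← Multiset.coe_eq_coe, ← Multiset.cons_coe, canon_coe, canon_coe, map_add]
  rw [Finsupp.toMultiset_single, one_smul, add_comm, Multiset.singleton_add]

lemma canon_surj {d : ℕ} (β : List (Fin d)) : ∃ μ : Fin d →₀ ℕ, (canon μ).Perm β := by
  refine ⟨Multiset.toFinsupp (β : Multiset (Fin d)), ?_⟩
  rw [← Multiset.coe_eq_coe, canon_coe]; simp

def consOne {d N : ℕ} (g : (Vc d) → Vc N) (x : Vc d) : Vc (N + 1) := Fin.cons 1 (g x)

lemma consOne_contDiffOn {d N l : ℕ} {g : (Vc d) → Vc N} {B : Set (Vc d)}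
    (hg : ContDiffOn ℝ l g B) : ContDiffOn ℝ l (consOne g) B := by
  rw [contDiffOn_pi]
  intro a
  refine Fin.cases ?_ (fun j => ?_) a
  · simpa [consOne] using contDiffOn_const
  · simpa [consOne] using (contDiffOn_pi.1 hg j)

lemma listPDeriv_consOne {d N l : ℕ} {g : (Vc d) → Vc N} {B : Set (Vc d)} (hB : IsOpen B)
    (hg : ContDiffOn ℝ l g B) (β : List (Fin d)) (hβ : β.length ≤ l) :
    ∀ y ∈ B, listPDeriv β (consOne g) y = Fin.cons (if β = [] then 1 else 0) (listPDeriv β g y) := by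
  induction β with
  | nil => intro y _; simp [listPDeriv, consOne]
  | cons i is ih =>
    intro y hy
    have h1 := ih (by simp at hβ; omega)
    simp only [listPDeriv]
    have hev : listPDeriv is (consOne g) =ᶠ[nhds y] fun y => Fin.cons (if is = [] then 1 else 0) (listPDeriv is g y) :=
      eventuallyEq_of_mem (hB.mem_nhds hy) h1
    rw [hev.fderiv_eq]
    have hd : DifferentiableAt ℝ (listPDeriv is g) y := by
      have : ContDiffOn ℝ (1 : ℕ) (listPDeriv is g) B := by
        apply listPDeriv_contDiffOn g B hB
        apply hg.of_le
        simp at hβ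
        exact_mod_cast (by omega : 1 + is.length ≤ l)
      exact (this.contDiffAt (hB.mem_nhds hy)).differentiableAt (by simp)
    have hda : ∀ j, HasFDerivAt (fun y => listPDeriv is g y j) ((ContinuousLinearMap.proj j).comp (fderiv ℝ (listPDeriv is g) y)) y :=
      hasFDerivAt_pi'.1 hd.hasFDerivAt
    have hc : ∀ j : Fin (N + 1), DifferentiableAt ℝ (fun y => (Fin.cons (if is = [] then 1 else 0) (listPDeriv is g y) : Vc (N + 1)) j) y := by
      intro j
      refine Fin.cases ?_ (fun j => ?_) j
      · simp
      · simpa using (hda j).differentiableAt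
    funext j
    rw [fderiv_pi (by exact hc)]
    refine Fin.cases ?_ (fun j => ?_) j
    · simp
    · simp only [ContinuousLinearMap.coe_pi', Fin.cons_succ]
      rw [(hda j).fderiv]; simp

lemma exists_fam {d N : ℕ} (g : (Vc d) → Vc N) (x0 : Vc d)
    (hnd : IsNondegenerateAt g x0) : ∃ l : ℕ, ∃ R0 : ℝ, 0 < R0 ∧ ContDiffOn ℝ l g (Bl x0 R0) ∧
      Submodule.span ℝ {v : Vc N | ∃ β : List (Fin d),
        1 ≤ β.length ∧ β.length ≤ l ∧ v = listPDeriv β g x0} = ⊤ ∧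
      ∃ G : (Fin d →₀ ℕ) → (Vc d) → Vc (N + 1), Fam l x0 R0 G ∧
        G 0 = consOne g ∧ ∀ i, G (Finsupp.single i 1) = fun x => fderiv ℝ (consOne g) x (Pi.single i 1) := by
  obtain ⟨l, ⟨V, hV, hcd⟩, hspan⟩ := hnd
  obtain ⟨R0, hR0, hball⟩ := Metric.mem_nhds_iff.1 hV
  have hg := hcd.mono hball
  have hF := consOne_contDiffOn hg
  have hB : IsOpen (Bl x0 R0) := Metric.isOpen_ball
  refine ⟨l, R0, hR0, hg, hspan, fun μ => listPDeriv (canon μ) (consOne g), ⟨?_, ?_, ?_⟩, ?_, ?_⟩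
  · intro μ hμ y hy a
    have hd : DifferentiableAt ℝ (listPDeriv (canon μ) (consOne g)) y := by
      have : ContDiffOn ℝ (1 : ℕ) (listPDeriv (canon μ) (consOne g)) (Bl x0 R0) := by
        apply listPDeriv_contDiffOn _ _ hB
        apply hF.of_le
        rw [canon_length]
        exact_mod_cast (by omega : 1 + μ.degree ≤ l)
      exact (this.contDiffAt (hB.mem_nhds hy)).differentiableAt (by simp)
    have hda := hasFDerivAt_pi'.1 hd.hasFDerivAt a
    refine hda.congr_fderiv ?_
    ext v
    have hv : v = ∑ i, v i • (Pi.single i 1 : Vc d) := by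
      ext j; simp [Finset.sum_apply, Pi.single_apply]
    conv_lhs => rw [hv]
    rw [map_sum]
    simp only [ContinuousLinearMap.sum_apply, map_smul]
    refine Finset.sum_congr rfl fun i _ => ?_
    have hp := listPDeriv_perm (consOne g) _ hB l hF (canon_add μ i) (by simp [canon_length]; omega) hy
    rw [← hp]
    simp [listPDeriv, mul_comm]
  · intro μ hμ
    refine (listPDeriv_contDiffOn _ _ hB (canon μ) 0 ?_).continuousOn
    apply hF.of_le
    rw [canon_length]
    exact_mod_cast (by omega : 0 + μ.degree ≤ l)
  · intro p hp
    by_contra hno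
    push Not at hno
    have hx0 : x0 ∈ Bl x0 R0 := Metric.mem_ball_self hR0
    have hβ : ∀ β : List (Fin d), β.length ≤ l → p ⬝ᵥ listPDeriv β (consOne g) x0 = 0 := by
      intro β hβ
      obtain ⟨μ, hμ⟩ := canon_surj β
      have hlen : μ.degree ≤ l := by rw [← canon_length, hμ.length_eq]; exact hβ
      rw [← listPDeriv_perm (consOne g) _ hB l hF hμ (by rw [canon_length]; exact hlen) hx0]
      exact hno μ hlen
    have htail : Fin.tail p = 0 := by
      have hle : (⊤ : Submodule ℝ (Vc N)) ≤ LinearMap.ker (dotProductBilin ℝ ℝ (Fin.tail p)) := by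
        rw [← hspan, Submodule.span_le]
        rintro v ⟨β, h1, h2, rfl⟩
        have h3 := hβ β h2
        rw [listPDeriv_consOne hB hg β h2 x0 hx0] at h3
        have : β ≠ [] := by rintro rfl; simp at h1
        rw [if_neg this, dotProduct, Fin.sum_univ_succ] at h3
        simp only [Fin.cons_zero, mul_zero, zero_add, Fin.cons_succ] at h3
        exact h3
      have hm : Fin.tail p ∈ LinearMap.ker (dotProductBilin ℝ ℝ (Fin.tail p)) := hle trivial
      exact dotProduct_self_eq_zero.1 hm
    have h0 := hβ [] (by simp)
    apply hp
    have hs : ∀ j : Fin N, p j.succ = 0 := fun j => congrFun htail j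
    simp only [listPDeriv, consOne, dotProduct, Fin.sum_univ_succ, Fin.cons_zero, Fin.cons_succ, hs] at h0
    ext j
    refine Fin.cases ?_ (fun j => hs j) j
    simpa using h0
  · simp [canon, listPDeriv]
  · intro i
    simp [canon, listPDeriv, Finsupp.toMultiset_single]
end Fam
section Taylor

lemma eval_TP {d : ℕ} (l : ℕ) (c : (Fin d →₀ ℕ) → ℝ) (z : Vc d) :
    MvPolynomial.eval z (TP l c) = ∑ ν ∈ MI d l, (c ν / ∏ i, ((ν i).factorial : ℝ)) * ∏ i, z i ^ ν i := by
  unfold TP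
  rw [map_sum]
  refine Finset.sum_congr rfl fun ν _ => ?_
  rw [MvPolynomial.eval_monomial, Finsupp.prod_fintype]
  simp

lemma eval_TP_zero {d : ℕ} (l : ℕ) (c : (Fin d →₀ ℕ) → ℝ) : MvPolynomial.eval 0 (TP l c) = c 0 := by
  rw [eval_TP, Finset.sum_eq_single 0]
  · simp
  · intro ν _ hν
    obtain ⟨i, hi⟩ : ∃ i, ν i ≠ 0 := by
      by_contra h
      push Not at h
      exact hν (Finsupp.ext h)
    have hz : ∏ i, (0 : Vc d) i ^ ν i = 0 := Finset.prod_eq_zero (Finset.mem_univ i) (by simp [hi])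
    rw [hz, mul_zero]
  · intro h; exact absurd (mem_MI.2 (by simp)) h

lemma eval_TP_smul {d : ℕ} (l : ℕ) (c : (Fin d →₀ ℕ) → ℝ) (r : ℝ) (z : Vc d) :
    MvPolynomial.eval (r • z) (TP l c) = MvPolynomial.eval z (TP l fun ν => r ^ ν.degree * c ν) := by
  rw [eval_TP, eval_TP]
  refine Finset.sum_congr rfl fun ν _ => ?_
  have : ∏ i, (r • z) i ^ ν i = r ^ ν.degree * ∏ i, z i ^ ν i := by
    simp only [Pi.smul_apply, smul_eq_mul, mul_pow, Finset.prod_mul_distrib]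
    rw [Finset.prod_pow_eq_pow_sum, Finsupp.degree_eq_sum]
  rw [this]; ring

lemma taylor {d : ℕ} {l : ℕ} {x0 : Vc d} {R0 : ℝ} (h : (Fin d →₀ ℕ) → (Vc d) → ℝ)
    (hder : ∀ μ : Fin d →₀ ℕ, μ.degree < l → ∀ y ∈ Bl x0 R0,
      HasFDerivAt (h μ) (∑ i, h (μ + Finsupp.single i 1) y •
      (ContinuousLinearMap.proj i : (Vc d) →L[ℝ] ℝ)) y)
    (y : Vc d) (r : ℝ) (hr : 0 < r) (hyr : Bl y r ⊆ Bl x0 R0)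
    (ω : ℝ) (hω : ∀ ν : Fin d →₀ ℕ, ν.degree = l → ∀ x ∈ Bl y r, |h ν x - h ν y| ≤ ω) :
    ∀ (k : ℕ) (μ : Fin d →₀ ℕ), μ.degree + k = l → ∀ w ∈ Bl (0 : Vc d) r,
      |h μ (y + w) - MvPolynomial.eval w (TP k fun ν => h (μ + ν) y)| ≤ (d * r) ^ k * ω := by
  have hmem : ∀ w ∈ Bl (0 : Vc d) r, y + w ∈ Bl y r := by
    intro w hw; simpa [dist_eq_norm] using hw
  intro k
  induction k with
  | zero =>
    intro μ hμ w hw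
    have : MvPolynomial.eval w (TP 0 fun ν => h (μ + ν) y) = h μ y := by
      rw [eval_TP, Finset.sum_eq_single 0]
      · simp
      · intro ν hν hne
        rw [mem_MI] at hν
        exact absurd ((Finsupp.degree_eq_zero_iff ν).1 (by omega)) hne
      · intro h; exact absurd (mem_MI.2 (by simp)) h
    rw [this]
    simpa using hω μ hμ _ (hmem w hw)
  | succ k ih =>
    intro μ hμ w hw
    set E : (Vc d) → ℝ := fun w => h μ (y + w) - MvPolynomial.eval w (TP (k + 1) fun ν => h (μ + ν) y) with hE
    have hE0 : E 0 = 0 := by simp only [hE, eval_TP_zero]; simp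
    have hderE : ∀ w ∈ Bl (0 : Vc d) r, HasFDerivAt E
        (∑ i, (h (μ + Finsupp.single i 1) (y + w) -
          MvPolynomial.eval w (TP k fun ν => h (μ + Finsupp.single i 1 + ν) y)) •
          (ContinuousLinearMap.proj i : (Vc d) →L[ℝ] ℝ)) w := by
      intro w hw
      have h1 := hder μ (by omega) (y + w) (hyr (hmem w hw))
      have h2 : HasFDerivAt (fun w => h μ (y + w)) _ w := (hasFDerivAt_comp_add_left y).2 h1
      refine (h2.sub (mvpoly_hasFDerivAt _ w)).congr_fderiv ?_
      rw [← Finset.sum_sub_distrib]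
      refine Finset.sum_congr rfl fun i _ => ?_
      rw [← sub_smul, pderiv_TP]
      simp only [add_assoc, add_comm, add_left_comm]
    have hbd : ∀ w ∈ Bl (0 : Vc d) r, ‖∑ i, (h (μ + Finsupp.single i 1) (y + w) -
          MvPolynomial.eval w (TP k fun ν => h (μ + Finsupp.single i 1 + ν) y)) •
          (ContinuousLinearMap.proj i : (Vc d) →L[ℝ] ℝ)‖ ≤ d * ((d * r) ^ k * ω) := by
      intro w hw
      refine (norm_sum_le _ _).trans ?_
      have : ∀ i ∈ Finset.univ, ‖(h (μ + Finsupp.single i 1) (y + w) -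
          MvPolynomial.eval w (TP k fun ν => h (μ + Finsupp.single i 1 + ν) y)) •
          (ContinuousLinearMap.proj i : (Vc d) →L[ℝ] ℝ)‖ ≤ (d * r) ^ k * ω := by
        intro i _
        rw [norm_smul, Real.norm_eq_abs]
        have h1 := ih (μ + Finsupp.single i 1) (by rw [map_add, Finsupp.degree_single]; omega) w hw
        have h2 : ‖(ContinuousLinearMap.proj i : (Vc d) →L[ℝ] ℝ)‖ ≤ 1 := by
          refine ContinuousLinearMap.opNorm_le_bound _ zero_le_one fun v => ?_
          simpa using norm_le_pi_norm v i
        exact (mul_le_of_le_one_right (abs_nonneg _) h2).trans h1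
      refine (Finset.sum_le_sum this).trans ?_
      simp
    have hmv := (convex_ball (0 : Vc d) r).norm_image_sub_le_of_norm_hasFDerivWithin_le
      (fun w hw => (hderE w hw).hasFDerivWithinAt) hbd (Metric.mem_ball_self hr) hw
    rw [hE0, sub_zero, sub_zero, Real.norm_eq_abs] at hmv
    refine hmv.trans ?_
    have hw' : ‖w‖ ≤ r := by simpa using (Metric.mem_ball.1 hw).le
    have hnn : 0 ≤ (d : ℝ) * ((d * r) ^ k * ω) := (norm_nonneg _).trans (hbd 0 (Metric.mem_ball_self hr))
    calc _ ≤ (d : ℝ) * ((d * r) ^ k * ω) * r := by gcongr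
      _ = _ := by ring

noncomputable def Lam {d N : ℕ} (l : ℕ) (G : (Fin d →₀ ℕ) → (Vc d) → Vc N) (y : Vc d) (r : ℝ)
    (p : Vc N) : MI d l → ℝ := fun ν => r ^ (ν : Fin d →₀ ℕ).degree * (p ⬝ᵥ G ν y)

noncomputable def TPs {d l : ℕ} (u : MI d l → ℝ) : MvPolynomial (Fin d) ℝ :=
  ∑ ν : MI d l, MvPolynomial.monomial (ν : Fin d →₀ ℕ) (u ν / ∏ i, (((ν : Fin d →₀ ℕ) i).factorial : ℝ))

lemma TP_eq_TPs {d : ℕ} (l : ℕ) (c : (Fin d →₀ ℕ) → ℝ) : TP l c = TPs (fun ν : MI d l => c ν) := by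
  unfold TP TPs
  rw [← Finset.sum_coe_sort]

lemma Lam_lower {d N : ℕ} {l : ℕ} {x0 : Vc d} {R0 : ℝ} (hR0 : 0 < R0)
    {G : (Fin d →₀ ℕ) → (Vc d) → Vc N} (hG : Fam l x0 R0 G) :
    ∃ c1 > 0, ∃ R1 > 0, R1 ≤ R0 ∧ ∀ y ∈ Bl x0 R1, ∀ p : Vc N, c1 * ‖p‖ ≤ ‖Lam l G y 1 p‖ := by
  set ψ : (Vc N) × (Vc d) → ℝ := fun q => ‖Lam l G q.2 1 q.1‖ with hψ
  have hcont : ∀ p : Vc N, ContinuousAt ψ (p, x0) := by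
    intro p
    apply ContinuousAt.norm
    rw [continuousAt_pi]
    intro ν
    simp only [Lam, one_pow, one_mul, dotProduct]
    apply tendsto_finsetSum
    intro a _
    have h1 : ContinuousAt (fun q : (Vc N) × (Vc d) => q.1 a) (p, x0) :=
      ((continuous_apply a).comp continuous_fst).continuousAt
    have h2 : ContinuousAt (fun q : (Vc N) × (Vc d) => G ν q.2 a) (p, x0) := by
      have h3 : ContinuousAt (fun y => G ν y a) x0 :=
        continuousAt_pi.1 ((hG.hcont ν (mem_MI.1 ν.2)).continuousAt (Metric.ball_mem_nhds x0 hR0)) a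
      exact ContinuousAt.comp (f := Prod.snd) (x := (p, x0)) h3 continuous_snd.continuousAt
    exact h1.mul h2
  have hpos : ∀ p ∈ Metric.sphere (0 : Vc N) 1, 0 < ψ (p, x0) := by
    intro p hp
    have hp0 : p ≠ 0 := by rintro rfl; simp at hp
    obtain ⟨μ, hμ, hne⟩ := hG.hnd p hp0
    rw [hψ]
    refine norm_pos_iff.2 fun h0 => hne ?_
    have := congrFun h0 ⟨μ, mem_MI.2 hμ⟩
    simpa [Lam] using this
  have hloc : ∃ c1 > 0, ∀ᶠ y in nhds x0, ∀ p ∈ Metric.sphere (0 : Vc N) 1, c1 ≤ ψ (p, y) := by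
    refine (isCompact_sphere (0 : Vc N) 1).induction_on (p := fun S => ∃ c1 > 0, ∀ᶠ y in nhds x0, ∀ p ∈ S, c1 ≤ ψ (p, y))
      ⟨1, one_pos, by simp⟩ ?_ ?_ ?_
    · rintro s t hst ⟨c, hc, h⟩
      exact ⟨c, hc, h.mono fun y hy p hp => hy p (hst hp)⟩
    · rintro s t ⟨c, hc, h⟩ ⟨c', hc', h'⟩
      refine ⟨min c c', lt_min hc hc', ?_⟩
      filter_upwards [h, h'] with y hy hy' p hp
      rcases hp with hp | hp
      · exact (min_le_left _ _).trans (hy p hp)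
      · exact (min_le_right _ _).trans (hy' p hp)
    · intro p hp
      have h1 : ∀ᶠ q in nhds (p, x0), ψ (p, x0) / 2 < ψ q :=
        (hcont p).eventually (lt_mem_nhds (half_lt_self (hpos p hp)))
      rw [nhds_prod_eq, eventually_prod_iff] at h1
      obtain ⟨pa, ha, pb, hb, hab⟩ := h1
      refine ⟨{q | pa q}, mem_nhdsWithin_of_mem_nhds ha, ψ (p, x0) / 2, half_pos (hpos p hp), ?_⟩
      filter_upwards [hb] with y hy q hq
      exact (hab hq hy).le
  obtain ⟨c1, hc1, hev⟩ := hloc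
  obtain ⟨R1, hR1, hball⟩ := Metric.mem_nhds_iff.1 hev
  refine ⟨c1, hc1, min R1 R0, lt_min hR1 hR0, min_le_right _ _, ?_⟩
  intro y hy p
  have hy' := hball (Metric.ball_subset_ball (min_le_left _ _) hy)
  by_cases hp : p = 0
  · subst hp; simp
  have hpn : 0 < ‖p‖ := norm_pos_iff.2 hp
  have h1 := hy' (‖p‖⁻¹ • p) (by simp [norm_smul, hpn.ne'])
  have h2 : Lam l G y 1 (‖p‖⁻¹ • p) = ‖p‖⁻¹ • Lam l G y 1 p := by
    ext ν; simp [Lam, smul_dotProduct]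
  simp only [hψ, h2, norm_smul, norm_inv, norm_norm] at h1
  rw [inv_mul_eq_div, le_div_iff₀ hpn] at h1
  exact h1

lemma scaling {d N : ℕ} {l : ℕ} (hl : 1 ≤ l) {x0 : Vc d} {R0 : ℝ} (hR0 : 0 < R0)
    {G : (Fin d →₀ ℕ) → (Vc d) → Vc N} (hG : Fam l x0 R0 G) :
    ∃ c1 > 0, ∀ η : ℝ, 0 < η → ∃ R > 0, R ≤ R0 ∧ ∀ y r, 0 < r → dist y x0 + r < R → ∀ p : Vc N,
      c1 * r ^ l * ‖p‖ ≤ ‖Lam l G y r p‖ ∧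
      ∀ z ∈ Bl (0 : Vc d) 1,
        |p ⬝ᵥ G 0 (y + r • z) - MvPolynomial.eval z (TPs (Lam l G y r p))| ≤ η * ‖Lam l G y r p‖ ∧
        ∀ i, |r * (p ⬝ᵥ G (Finsupp.single i 1) (y + r • z)) -
          MvPolynomial.eval z (MvPolynomial.pderiv i (TPs (Lam l G y r p)))| ≤ η * ‖Lam l G y r p‖ := by
  obtain ⟨c1, hc1, R1, hR1, hR10, hlow⟩ := Lam_lower hR0 hG
  refine ⟨c1, hc1, fun η hη => ?_⟩
  set ω : ℝ := η * c1 / (2 * ((N : ℝ) + 1) * ((d : ℝ) + 1) ^ l) with hω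
  have hωp : 0 < ω := by positivity
  have hosc : ∃ R2 > 0, R2 ≤ R0 ∧ ∀ ν ∈ MI d l, ∀ x ∈ Bl x0 R2, ‖G ν x - G ν x0‖ < ω := by
    have : ∀ᶠ x in nhds x0, ∀ ν ∈ MI d l, ‖G ν x - G ν x0‖ < ω := by
      rw [Filter.eventually_all_finset]
      intro ν hν
      have hc := (hG.hcont ν (mem_MI.1 hν)).continuousAt (Metric.ball_mem_nhds x0 hR0)
      have := Metric.tendsto_nhds.1 hc ω hωp
      simpa [dist_eq_norm] using this
    obtain ⟨R2, hR2, hb⟩ := Metric.mem_nhds_iff.1 this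
    exact ⟨min R2 R0, lt_min hR2 hR0, min_le_right _ _, fun ν hν x hx =>
      hb (Metric.ball_subset_ball (min_le_left _ _) hx) ν hν⟩
  obtain ⟨R2, hR2, hR20, hosc⟩ := hosc
  refine ⟨min (min R1 R2) 1, by positivity, (min_le_left _ _).trans ((min_le_left _ _).trans hR10), ?_⟩
  intro y r hr hyr p
  have hb1 : dist y x0 + r < R1 := hyr.trans_le ((min_le_left _ _).trans (min_le_left _ _))
  have hb2 : dist y x0 + r < R2 := hyr.trans_le ((min_le_left _ _).trans (min_le_right _ _))
  have hr1 : r ≤ 1 := by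
    have := hyr.trans_le (min_le_right _ _)
    have := dist_nonneg (x := y) (y := x0)
    linarith
  have hsub : ∀ ρ, dist y x0 + r < ρ → Bl y r ⊆ Bl x0 ρ := by
    intro ρ h; apply Metric.ball_subset_ball'; linarith
  have hlow1 : c1 * r ^ l * ‖p‖ ≤ ‖Lam l G y r p‖ := by
    have h1 := hlow y (hsub R1 hb1 (Metric.mem_ball_self hr)) p
    have h2 : r ^ l * ‖Lam l G y 1 p‖ ≤ ‖Lam l G y r p‖ := by
      rw [mul_comm, ← le_div_iff₀ (by positivity)]
      rw [pi_norm_le_iff_of_nonneg (by positivity)]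
      intro ν
      rw [le_div_iff₀ (by positivity)]
      refine le_trans ?_ (norm_le_pi_norm _ ν)
      simp only [Lam, norm_mul, norm_pow, norm_one, one_pow, one_mul, Real.norm_eq_abs, abs_of_pos hr]
      rw [mul_comm]
      gcongr ?_ * _
      exact pow_le_pow_of_le_one hr.le hr1 (mem_MI.1 ν.2)
    calc c1 * r ^ l * ‖p‖ = r ^ l * (c1 * ‖p‖) := by ring
      _ ≤ r ^ l * ‖Lam l G y 1 p‖ := by gcongr
      _ ≤ _ := h2
  refine ⟨hlow1, ?_⟩
  set h : (Fin d →₀ ℕ) → (Vc d) → ℝ := fun μ x => p ⬝ᵥ G μ x with hh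
  have hder : ∀ μ : Fin d →₀ ℕ, μ.degree < l → ∀ y ∈ Bl x0 R0,
      HasFDerivAt (h μ) (∑ i, h (μ + Finsupp.single i 1) y •
      (ContinuousLinearMap.proj i : (Vc d) →L[ℝ] ℝ)) y := by
    intro μ hμ y hy
    have h1 : HasFDerivAt (fun y => ∑ a, p a * G μ y a) _ y :=
      HasFDerivAt.fun_sum fun a _ => (hG.hder μ hμ y hy a).const_mul (p a)
    refine h1.congr_fderiv ?_
    simp only [hh, dotProduct, Finset.smul_sum, Finset.sum_smul]
    rw [Finset.sum_comm]
    simp [smul_smul]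
  have hωh : ∀ ν : Fin d →₀ ℕ, ν.degree = l → ∀ x ∈ Bl y r, |h ν x - h ν y| ≤ N * ‖p‖ * (2 * ω) := by
    intro ν hν x hx
    have hm : ν ∈ MI d l := mem_MI.2 hν.le
    have h1 := hosc ν hm x (hsub R2 hb2 hx)
    have h2 := hosc ν hm y (hsub R2 hb2 (Metric.mem_ball_self hr))
    have h3 : ‖G ν x - G ν y‖ ≤ 2 * ω := by
      have : G ν x - G ν y = (G ν x - G ν x0) - (G ν y - G ν x0) := by abel
      rw [this]
      exact (norm_sub_le _ _).trans (by linarith)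
    simp only [hh]
    rw [← dotProduct_sub, dotProduct]
    refine (Finset.abs_sum_le_sum_abs _ _).trans ?_
    have : ∀ a ∈ Finset.univ, |p a * (G ν x - G ν y) a| ≤ ‖p‖ * (2 * ω) := by
      intro a _
      rw [abs_mul]
      gcongr
      · exact norm_le_pi_norm p a
      · exact (norm_le_pi_norm (G ν x - G ν y) a).trans h3
    refine (Finset.sum_le_sum this).trans ?_
    simp [mul_assoc]
  have hT := taylor h hder y r hr ((hsub R2 hb2).trans (Metric.ball_subset_ball hR20)) _ hωh
  have herr : ∀ k, k ≤ l → (d : ℝ) ^ k * r ^ l * (N * ‖p‖ * (2 * ω)) ≤ η * ‖Lam l G y r p‖ := by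
    intro k hk
    have h1 : (d : ℝ) ^ k ≤ ((d : ℝ) + 1) ^ l :=
      (pow_le_pow_left₀ (by positivity) (by linarith) k).trans (pow_le_pow_right₀ (by linarith [(Nat.cast_nonneg d : (0 : ℝ) ≤ d)]) hk)
    calc (d : ℝ) ^ k * r ^ l * (N * ‖p‖ * (2 * ω)) ≤ ((d : ℝ) + 1) ^ l * r ^ l * (((N : ℝ) + 1) * ‖p‖ * (2 * ω)) := by
          gcongr; linarith
      _ = η * (c1 * r ^ l * ‖p‖) := by rw [hω]; field_simp
      _ ≤ _ := by gcongr
  have hLam : TPs (Lam l G y r p) = TP l (fun ν => r ^ ν.degree * h ν y) := by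
    rw [TP_eq_TPs]; rfl
  intro z hz
  have hz' : r • z ∈ Bl (0 : Vc d) r := by
    simp only [Metric.mem_ball, dist_zero_right, norm_smul, Real.norm_eq_abs, abs_of_pos hr] at hz ⊢
    nlinarith
  constructor
  · have h1 := hT l 0 (by simp) (r • z) hz'
    rw [eval_TP_smul] at h1
    simp only [zero_add] at h1
    rw [hLam]
    refine h1.trans (le_trans (le_of_eq ?_) (herr l le_rfl))
    ring
  · intro i
    obtain ⟨k, rfl⟩ : ∃ k, l = k + 1 := ⟨l - 1, by omega⟩
    have h1 := hT k (Finsupp.single i 1) (by rw [Finsupp.degree_single]; omega) (r • z) hz'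
    rw [eval_TP_smul] at h1
    have h2 : MvPolynomial.eval z (MvPolynomial.pderiv i (TPs (Lam (k + 1) G y r p))) =
        r * MvPolynomial.eval z (TP k fun ν => r ^ ν.degree * h (Finsupp.single i 1 + ν) y) := by
      rw [hLam, pderiv_TP, eval_TP, eval_TP, Finset.mul_sum]
      refine Finset.sum_congr rfl fun ν _ => ?_
      rw [map_add, Finsupp.degree_single, add_comm ν]
      ring
    rw [h2, ← mul_sub, abs_mul, abs_of_pos hr]
    refine (mul_le_mul_of_nonneg_left h1 hr.le).trans (le_trans (le_of_eq ?_) (herr k (by omega)))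
    ring
end Taylor
end DSM

section PWPA4
open scoped Pointwise

namespace DSM
section Good

lemma level_good {d : ℕ} (y : Vc d) (r : ℝ) (hr : 0 < r) (φ ψ : (Vc d) → ℝ) (c2 C S : ℝ) (τ : ℝ≥0∞)
    (hc2 : 0 < c2) (hψ : ∀ z, 0 ≤ ψ z) (hC : ∀ z ∈ Bl (0 : Vc d) 1, ψ z ≤ C) (hS : 0 ≤ S)
    (herr : ∀ z ∈ Bl (0 : Vc d) 1, |φ (y + r • z) - S * ψ z| ≤ c2 / 2 * S)
    (hlev : volume {z | z ∈ Bl (0 : Vc d) 1 ∧ ψ z ≤ c2} ≤ τ * volume (Bl (0 : Vc d) 1)) :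
    (∀ M, 0 < M → (∃ x ∈ Bl y r, M ≤ φ x) →
      volume {x | x ∈ Bl y r ∧ φ x < c2 / (2 * (C + c2)) * M} ≤ τ * volume (Bl y r)) ∧
    (τ < 1 → ∃ x ∈ Bl y r, c2 / 2 * S ≤ φ x) := by
  have hC0 : 0 ≤ C := (hψ 0).trans (hC 0 (Metric.mem_ball_self one_pos))
  have hrep : ∀ x ∈ Bl y r, ∃ z ∈ Bl (0 : Vc d) 1, x = y + r • z := by
    intro x hx
    refine ⟨r⁻¹ • (x - y), ?_, ?_⟩
    · rw [Metric.mem_ball, dist_eq_norm] at hx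
      rw [mem_ball_zero_iff, norm_smul, norm_inv, Real.norm_eq_abs, abs_of_pos hr, inv_mul_lt_iff₀ hr]
      simpa using hx
    · rw [smul_inv_smul₀ hr.ne']; abel
  constructor
  · rintro M hM ⟨x, hx, hMx⟩
    obtain ⟨z, hz, rfl⟩ := hrep x hx
    have h1 := (abs_le.1 (herr z hz)).2
    have h2 := hC z hz
    have hMS : M ≤ (C + c2) * S := by nlinarith
    have hsub : {x | x ∈ Bl y r ∧ φ x < c2 / (2 * (C + c2)) * M} ⊆
        y +ᵥ (r • {z | z ∈ Bl (0 : Vc d) 1 ∧ ψ z ≤ c2}) := by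
      rintro x ⟨hx, hφ⟩
      obtain ⟨z, hz, rfl⟩ := hrep x hx
      refine vadd_mem_vadd_set (smul_mem_smul_set ⟨hz, ?_⟩)
      have h3 := (abs_le.1 (herr z hz)).1
      have h4 : c2 / (2 * (C + c2)) * M ≤ c2 / 2 * S := by
        have : c2 / (2 * (C + c2)) * ((C + c2) * S) = c2 / 2 * S := by field_simp
        rw [← this]; gcongr
      have hSp : 0 < S := by
        rcases hS.lt_or_eq with h | h
        · exact h
        · rw [← h] at hMS; simp at hMS; linarith
      have : S * ψ z < S * c2 := by nlinarith
      exact (lt_of_mul_lt_mul_left this hSp.le).le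
    refine (measure_mono hsub).trans ?_
    rw [measure_vadd, Measure.addHaar_smul_of_nonneg _ hr.le, Measure.addHaar_ball_of_pos _ _ hr]
    calc _ ≤ eR (r ^ Module.finrank ℝ (Vc d)) * (τ * volume (Bl (0 : Vc d) 1)) := by gcongr
      _ = _ := by ring
  · intro hτ
    have hex : ∃ z ∈ Bl (0 : Vc d) 1, c2 < ψ z := by
      by_contra hno
      push Not at hno
      have : Bl (0 : Vc d) 1 ⊆ {z | z ∈ Bl (0 : Vc d) 1 ∧ ψ z ≤ c2} :=
        fun z hz => ⟨hz, hno z hz⟩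
      have h1 := (measure_mono this).trans hlev
      have h2 : τ * volume (Bl (0 : Vc d) 1) < volume (Bl (0 : Vc d) 1) := by
        conv_rhs => rw [← one_mul (volume _)]
        exact ENNReal.mul_lt_mul_left (Metric.measure_ball_pos volume _ one_pos).ne' measure_ball_lt_top.ne hτ
      exact absurd h1 (not_le.2 h2)
    obtain ⟨z, hz, hcz⟩ := hex
    refine ⟨y + r • z, ?_, ?_⟩
    · rw [mem_ball_zero_iff] at hz
      rw [Metric.mem_ball, dist_eq_norm, add_sub_cancel_left, norm_smul, Real.norm_eq_abs, abs_of_pos hr]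
      nlinarith
    · have := (abs_le.1 (herr z hz)).1
      nlinarith

lemma continuous_eval_monomials {d l : ℕ} (e : MI d l → (Fin d →₀ ℕ)) (w : MI d l → ℝ) :
    Continuous fun q : (MI d l → ℝ) × (Vc d) =>
      MvPolynomial.eval q.2 (∑ ν : MI d l, MvPolynomial.monomial (e ν) (q.1 ν * w ν)) := by
  simp only [map_sum, MvPolynomial.eval_monomial, Finsupp.prod]
  fun_prop

lemma continuous_TPs {d l : ℕ} : Continuous fun q : (MI d l → ℝ) × (Vc d) =>
    MvPolynomial.eval q.2 (TPs q.1) := by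
  simp only [TPs, div_eq_mul_inv]
  exact continuous_eval_monomials _ _

lemma continuous_pderiv_TPs {d l : ℕ} (i : Fin d) : Continuous fun q : (MI d l → ℝ) × (Vc d) =>
    MvPolynomial.eval q.2 (MvPolynomial.pderiv i (TPs q.1)) := by
  simp only [TPs, div_eq_mul_inv, map_sum (MvPolynomial.pderiv i), MvPolynomial.pderiv_monomial, mul_assoc]
  exact continuous_eval_monomials _ _

lemma coeff_TPs {d l : ℕ} (u : MI d l → ℝ) (ν : MI d l) :
    MvPolynomial.coeff (ν : Fin d →₀ ℕ) (TPs u) = u ν / ∏ i, (((ν : Fin d →₀ ℕ) i).factorial : ℝ) := by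
  classical
  unfold TPs
  rw [MvPolynomial.coeff_sum, Finset.sum_eq_single ν]
  · simp
  · intro b _ hb
    rw [MvPolynomial.coeff_monomial, if_neg]
    exact fun h => hb (Subtype.ext h)
  · simp

lemma TPs_smul_inj {d l : ℕ} (u v : MI d l → ℝ) (a : ℝ) (h : TPs v = MvPolynomial.C a * TPs u) : v = a • u := by
  ext ν
  have h1 := congrArg (MvPolynomial.coeff (ν : Fin d →₀ ℕ)) h
  rw [MvPolynomial.coeff_C_mul, coeff_TPs, coeff_TPs] at h1
  have h2 : (∏ i, (((ν : Fin d →₀ ℕ) i).factorial : ℝ)) ≠ 0 := Finset.prod_ne_zero_iff.2 fun i _ => by positivity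
  rw [← mul_div_assoc, div_left_inj' h2] at h1
  simpa using h1

lemma TPs_smul {d l : ℕ} (u : MI d l → ℝ) (a : ℝ) : TPs (a • u) = MvPolynomial.C a * TPs u := by
  unfold TPs
  rw [Finset.mul_sum]
  refine Finset.sum_congr rfl fun ν _ => ?_
  rw [MvPolynomial.C_mul_monomial, Pi.smul_apply, smul_eq_mul, mul_div_assoc]

lemma TPs_ne_zero {d l : ℕ} (u : MI d l → ℝ) (hu : u ≠ 0) : TPs u ≠ 0 := by
  intro h
  apply hu
  have := TPs_smul_inj 0 u 0 (by rw [h]; simp)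
  simpa using this

def KP (ι : Type*) [Fintype ι] : Set ((ι → ℝ) × (ι → ℝ)) :=
  {w | ‖w.1‖ = 1 ∧ ‖w.2‖ = 1 ∧ ∃ a, |w.1 a| = 1 ∧ w.2 a = 0}

lemma KP_compact {ι : Type*} [Fintype ι] : IsCompact (KP ι) := by
  have hc : IsCompact (Metric.sphere (0 : ι → ℝ) 1 ×ˢ Metric.sphere (0 : ι → ℝ) 1) :=
    (isCompact_sphere _ _).prod (isCompact_sphere _ _)
  have hcl : IsClosed (⋃ a : ι, {w : (ι → ℝ) × (ι → ℝ) | |w.1 a| = 1 ∧ w.2 a = 0}) := by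
    refine isClosed_iUnion_of_finite fun a => ?_
    refine IsClosed.inter (isClosed_eq (by fun_prop) continuous_const) (isClosed_eq (by fun_prop) continuous_const)
  have : KP ι = (Metric.sphere (0 : ι → ℝ) 1 ×ˢ Metric.sphere (0 : ι → ℝ) 1) ∩
      (⋃ a : ι, {w : (ι → ℝ) × (ι → ℝ) | |w.1 a| = 1 ∧ w.2 a = 0}) := by
    ext w; simp [KP, and_assoc]
  rw [this]
  exact hc.inter_right hcl

lemma pair_reduction {N : ℕ} {ι : Type*} [Fintype ι] (Λ : (Vc N) →ₗ[ℝ] (ι → ℝ)) (hΛ : ∀ p, Λ p = 0 → p = 0)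
    (p q : Vc N) : p = 0 ∨ (∃ κ : ℝ, q = κ • p) ∨
    ∃ (α γ κ : ℝ) (p' q' : Vc N), p = α • p' ∧ q = γ • q' + κ • p' ∧ (Λ p', Λ q') ∈ KP ι := by
  by_cases hp : p = 0
  · exact Or.inl hp
  right
  have hLp : Λ p ≠ 0 := fun h => hp (hΛ p h)
  have hne : (Finset.univ : Finset ι).Nonempty := by
    by_contra h
    rw [Finset.not_nonempty_iff_eq_empty, Finset.univ_eq_empty_iff] at h
    exact hLp (Subsingleton.elim _ _)
  obtain ⟨a, _, ha⟩ := Finset.exists_max_image Finset.univ (fun a => |Λ p a|) hne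
  have hnorm : ‖Λ p‖ = |Λ p a| := by
    refine le_antisymm ((pi_norm_le_iff_of_nonneg (abs_nonneg _)).2 fun b => ha b (Finset.mem_univ b)) (norm_le_pi_norm (Λ p) a)
  have hα : Λ p a ≠ 0 := by
    intro h; rw [h, abs_zero, norm_eq_zero] at hnorm; exact hLp hnorm
  set α := Λ p a with hαd
  set p' := α⁻¹ • p with hp'
  have hpp : p = α • p' := by rw [hp', smul_inv_smul₀ hα]
  set κ := Λ q a with hκ
  set q0 := q - κ • p' with hq0
  by_cases hq : q0 = 0
  · left
    refine ⟨κ * α⁻¹, ?_⟩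
    rw [← smul_smul, ← hp']
    exact sub_eq_zero.1 hq
  right
  have hLq : 0 < ‖Λ q0‖ := norm_pos_iff.2 fun h => hq (hΛ _ h)
  refine ⟨α, ‖Λ q0‖, κ, p', ‖Λ q0‖⁻¹ • q0, hpp, ?_, ?_⟩
  · rw [smul_inv_smul₀ hLq.ne', hq0]; abel
  · have hp1 : Λ p' a = 1 := by rw [hp', map_smul, Pi.smul_apply, ← hαd]; simp [hα]
    refine ⟨?_, ?_, a, ?_, ?_⟩
    · simp only [hp', map_smul, norm_smul, hnorm, norm_inv, Real.norm_eq_abs]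
      exact inv_mul_cancel₀ (abs_ne_zero.2 hα)
    · simp only [map_smul, norm_smul, norm_inv, norm_norm]
      exact inv_mul_cancel₀ hLq.ne'
    · simp only [hp1, abs_one]
    · simp only [map_smul, hq0, map_sub, Pi.smul_apply, Pi.sub_apply, hp1, ← hκ]; simp

lemma wd_err {r A A' B B' P P' Q Q' η C : ℝ} (hη1 : η ≤ 1) (hC1 : 1 ≤ C) (hη0 : 0 ≤ η)
    (a1 : |A - P| ≤ η) (a2 : |r * A' - P'| ≤ η) (a3 : |B - Q| ≤ η) (a4 : |r * B' - Q'| ≤ η)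
    (b1 : |P| ≤ C) (b2 : |P'| ≤ C) (b3 : |Q| ≤ C) (b4 : |Q'| ≤ C) :
    |r * (A * B' - B * A') - (P * Q' - Q * P')| ≤ 6 * C * η := by
  have e : r * (A * B' - B * A') - (P * Q' - Q * P') =
      ((A - P) * (r * B' - Q') + (A - P) * Q' + P * (r * B' - Q')) -
      ((B - Q) * (r * A' - P') + (B - Q) * P' + Q * (r * A' - P')) := by ring
  rw [e]
  have m : ∀ s t S T : ℝ, |s| ≤ S → |t| ≤ T → |s * t| ≤ S * T := fun s t S T hs ht => by
    rw [abs_mul]; exact mul_le_mul hs ht (abs_nonneg _) ((abs_nonneg _).trans hs)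
  have t1 := m _ _ _ _ a1 a4
  have t2 := m _ _ _ _ a1 b4
  have t3 := m _ _ _ _ b1 a4
  have t4 := m _ _ _ _ a3 a2
  have t5 := m _ _ _ _ a3 b2
  have t6 := m _ _ _ _ b3 a2
  have hηη : η * η ≤ C * η := by nlinarith
  refine (abs_sub _ _).trans ?_
  have u1 := abs_add_three ((A - P) * (r * B' - Q')) ((A - P) * Q') (P * (r * B' - Q'))
  have u2 := abs_add_three ((B - Q) * (r * A' - P')) ((B - Q) * P') (Q * (r * A' - P'))
  linarith

set_option maxHeartbeats 1000000 in
theorem good_family {d N l : ℕ} (hl : 1 ≤ l) {x0 : Vc d} {R0 : ℝ} (hR0 : 0 < R0)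
    {G : (Fin d →₀ ℕ) → (Vc d) → Vc N} (hG : Fam l x0 R0 G) (τ : ℝ≥0∞) (hτ : τ ≠ 0) (hτ1 : τ < 1) :
    ∃ R > 0, R ≤ R0 ∧ ∃ c : ℝ, 0 < c ∧ c ≤ 1 ∧
      (∀ p, GoodOn x0 R c τ (fun x => |p ⬝ᵥ G 0 x|)) ∧
      (∀ p q, GoodOn x0 R c τ (fun x => ∑ i, |Wd (G 0) (fun i => G (Finsupp.single i 1)) p q i x|)) ∧
      (∀ y r, 0 < r → dist y x0 + r < R → ∃ cB, 0 < cB ∧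
        (∀ p, ∃ x ∈ Bl y r, cB * ‖p‖ ≤ |p ⬝ᵥ G 0 x|) ∧
        (∀ p q a b, ∃ x ∈ Bl y r, cB * |p a * q b - q a * p b| ≤
          ∑ i, |Wd (G 0) (fun i => G (Finsupp.single i 1)) p q i x|)) := by
  obtain ⟨c1, hc1, hsc⟩ := scaling hl hR0 hG
  set τ' := τ * volume (Bl (0 : Vc d) 1) with hτ'
  have hτ'0 : τ' ≠ 0 := mul_ne_zero hτ (Metric.measure_ball_pos volume _ one_pos).ne'
  have hTc := continuous_TPs (d := d) (l := l)
  have hDc := fun i => continuous_pderiv_TPs (d := d) (l := l) i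
  obtain ⟨ca, hca, hla⟩ := compact_level (Metric.sphere (0 : MI d l → ℝ) 1) (isCompact_sphere _ _)
    (fun u z => |MvPolynomial.eval z (TPs u)|) hTc.abs (fun u z => abs_nonneg _) (by
      intro u hu
      have hu0 : u ≠ 0 := by rintro rfl; simp at hu
      simpa only [abs_eq_zero] using mvpoly_null d _ (TPs_ne_zero u hu0)) τ' hτ'0
  set gW : (MI d l → ℝ) × (MI d l → ℝ) → (Vc d) → ℝ := fun w z =>
    ∑ i, |MvPolynomial.eval z (PW (TPs w.1) (TPs w.2) i)| with hgW
  have hgWc : Continuous (fun q : ((MI d l → ℝ) × (MI d l → ℝ)) × (Vc d) => gW q.1 q.2) := by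
    simp only [hgW, PW, map_sub, map_mul]
    have e1 : Continuous fun q : ((MI d l → ℝ) × (MI d l → ℝ)) × (Vc d) => (q.1.1, q.2) := by fun_prop
    have e2 : Continuous fun q : ((MI d l → ℝ) × (MI d l → ℝ)) × (Vc d) => (q.1.2, q.2) := by fun_prop
    refine continuous_finsetSum _ fun i _ => ?_
    exact (((hTc.comp e1).mul ((hDc i).comp e2)).sub ((hTc.comp e2).mul ((hDc i).comp e1))).abs
  obtain ⟨cb, hcb, hlb⟩ := compact_level (KP (MI d l)) KP_compact gW hgWc
    (fun u z => Finset.sum_nonneg fun i _ => abs_nonneg _) (by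
      rintro ⟨u, v⟩ ⟨hu, hv, a, hua, hva⟩
      simp only at hu hv hua hva
      have hu0 : u ≠ 0 := by rintro rfl; simp at hu
      have hex : ∃ i, PW (TPs u) (TPs v) i ≠ 0 := by
        by_contra hno
        push Not at hno
        obtain ⟨b, hb⟩ := PW_ne_zero _ _ (TPs_ne_zero u hu0) hno
        have h1 := TPs_smul_inj u v b hb
        have h2 := congrFun h1 a
        rw [hva, Pi.smul_apply, smul_eq_mul] at h2
        have hua0 : u a ≠ 0 := by intro h; rw [h] at hua; simp at hua
        have hb0 : b = 0 := (mul_eq_zero.1 h2.symm).resolve_right hua0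
        rw [hb0, zero_smul] at h1
        rw [h1] at hv; simp at hv
      obtain ⟨i, hi⟩ := hex
      refine measure_mono_null ?_ (mvpoly_null d _ hi)
      intro z hz
      simp only [hgW, mem_ofPred_eq] at hz ⊢
      rw [Finset.sum_eq_zero_iff_of_nonneg (fun i _ => abs_nonneg _)] at hz
      exact abs_eq_zero.1 (hz i (Finset.mem_univ i))) τ' hτ'0
  have hcomp : IsCompact (Metric.sphere (0 : MI d l → ℝ) 1 ×ˢ Metric.closedBall (0 : Vc d) 1) :=
    (isCompact_sphere _ _).prod (isCompact_closedBall _ _)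
  obtain ⟨Ca, hCa⟩ := hcomp.exists_bound_of_continuousOn hTc.continuousOn
  have hCbex : ∃ Cb : ℝ, 0 ≤ Cb ∧ ∀ i, ∀ q ∈ Metric.sphere (0 : MI d l → ℝ) 1 ×ˢ Metric.closedBall (0 : Vc d) 1,
      |MvPolynomial.eval q.2 (MvPolynomial.pderiv i (TPs q.1))| ≤ Cb := by
    have : ∀ i, ∃ Cb, ∀ q ∈ Metric.sphere (0 : MI d l → ℝ) 1 ×ˢ Metric.closedBall (0 : Vc d) 1,
      ‖MvPolynomial.eval q.2 (MvPolynomial.pderiv i (TPs q.1))‖ ≤ Cb := fun i =>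
        hcomp.exists_bound_of_continuousOn (hDc i).continuousOn
    choose Cb hCb using this
    refine ⟨∑ i, |Cb i|, Finset.sum_nonneg fun i _ => abs_nonneg _, fun i q hq => (hCb i q hq).trans ?_⟩
    exact (le_abs_self _).trans (Finset.single_le_sum (f := fun i => |Cb i|) (fun i _ => abs_nonneg _) (Finset.mem_univ i))
  obtain ⟨Cb, hCb0, hCb⟩ := hCbex
  set C := max (max Ca Cb) 1 with hC
  have hC1 : 1 ≤ C := le_max_right _ _
  have hb1 : ∀ u : MI d l → ℝ, ‖u‖ = 1 → ∀ z ∈ Bl (0 : Vc d) 1, |MvPolynomial.eval z (TPs u)| ≤ C := by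
    intro u hu z hz
    exact (hCa (u, z) ⟨by simpa using hu, Metric.ball_subset_closedBall hz⟩).trans ((le_max_left _ _).trans (le_max_left _ _))
  have hb2 : ∀ u : MI d l → ℝ, ‖u‖ = 1 → ∀ z ∈ Bl (0 : Vc d) 1, ∀ i,
      |MvPolynomial.eval z (MvPolynomial.pderiv i (TPs u))| ≤ C := by
    intro u hu z hz i
    exact (hCb i (u, z) ⟨by simpa using hu, Metric.ball_subset_closedBall hz⟩).trans ((le_max_right _ _).trans (le_max_left _ _))
  have hgWC : ∀ w ∈ KP (MI d l), ∀ z ∈ Bl (0 : Vc d) 1, gW w z ≤ d * (2 * C ^ 2) := by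
    rintro ⟨u, v⟩ ⟨hu, hv, -⟩ z hz
    have : ∀ i ∈ Finset.univ, |MvPolynomial.eval z (PW (TPs u) (TPs v) i)| ≤ 2 * C ^ 2 := by
      intro i _
      simp only [PW, map_sub, map_mul]
      refine (abs_sub _ _).trans ?_
      rw [abs_mul, abs_mul]
      have e1 := mul_le_mul (hb1 u hu z hz) (hb2 v hv z hz i) (abs_nonneg _) (by positivity)
      have e2 := mul_le_mul (hb1 v hv z hz) (hb2 u hu z hz i) (abs_nonneg _) (by positivity)
      nlinarith
    refine (Finset.sum_le_sum this).trans ?_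
    simp
  set η : ℝ := min 1 (min (ca / 2) (cb / (2 * ((d : ℝ) + 1) * (6 * C)))) with hη
  have hηp : 0 < η := by positivity
  have hη1 : η ≤ 1 := min_le_left _ _
  have hηa : η ≤ ca / 2 := (min_le_right _ _).trans (min_le_left _ _)
  have hηb : d * (6 * C * η) ≤ cb / 2 := by
    have h1 : η ≤ cb / (2 * ((d : ℝ) + 1) * (6 * C)) := (min_le_right _ _).trans (min_le_right _ _)
    calc d * (6 * C * η) ≤ (d + 1) * (6 * C * (cb / (2 * ((d : ℝ) + 1) * (6 * C)))) := by gcongr; linarith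
      _ = cb / 2 := by field_simp
  obtain ⟨R, hR, hRR0, hmain⟩ := hsc η hηp
  have hA : ∀ y r, 0 < r → dist y x0 + r < R → ∀ p,
      (∀ M, 0 < M → (∃ x ∈ Bl y r, M ≤ |p ⬝ᵥ G 0 x|) →
      volume {x | x ∈ Bl y r ∧ |p ⬝ᵥ G 0 x| < ca / (2 * (C + ca)) * M} ≤ τ * volume (Bl y r)) ∧
      (∃ x ∈ Bl y r, ca / 2 * ‖Lam l G y r p‖ ≤ |p ⬝ᵥ G 0 x|) := by
    intro y r hr hyr p
    obtain ⟨-, h2⟩ := hmain y r hr hyr p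
    set L := Lam l G y r p with hL
    rcases eq_or_ne L 0 with h0 | h0
    · have hz0 : ∀ x ∈ Bl y r, |p ⬝ᵥ G 0 x| = 0 := by
        intro x hx
        have h3 := (h2 (r⁻¹ • (x - y)) (by
          rw [Metric.mem_ball, dist_eq_norm] at hx
          rw [mem_ball_zero_iff, norm_smul, norm_inv, Real.norm_eq_abs, abs_of_pos hr, inv_mul_lt_iff₀ hr]
          simpa using hx)).1
        rw [smul_inv_smul₀ hr.ne', h0] at h3
        have h4 : TPs (0 : MI d l → ℝ) = 0 := by simp [TPs]
        rw [h4] at h3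
        have h5 : y + (x - y) = x := by abel
        rw [h5] at h3
        simp only [map_zero, sub_zero, norm_zero, mul_zero] at h3
        exact le_antisymm h3 (abs_nonneg _)
      constructor
      · rintro M hM ⟨x, hx, hMx⟩
        rw [hz0 x hx] at hMx; linarith
      · exact ⟨y, Metric.mem_ball_self hr, by simp [h0]⟩
    · have hLn : 0 < ‖L‖ := norm_pos_iff.2 h0
      have hun : ‖‖L‖⁻¹ • L‖ = 1 := by rw [norm_smul, norm_inv, norm_norm, inv_mul_cancel₀ hLn.ne']
      have key := level_good y r hr (fun x => |p ⬝ᵥ G 0 x|) (fun z => |MvPolynomial.eval z (TPs (‖L‖⁻¹ • L))|) ca C ‖L‖ τ hca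
        (fun z => abs_nonneg _) (hb1 _ hun) hLn.le (by
          intro z hz
          have h3 := (h2 z hz).1
          have h4 : ‖L‖ * |MvPolynomial.eval z (TPs (‖L‖⁻¹ • L))| = |MvPolynomial.eval z (TPs L)| := by
            rw [TPs_smul, map_mul, MvPolynomial.eval_C, abs_mul, abs_inv, abs_norm, mul_inv_cancel_left₀ hLn.ne']
          rw [h4]
          refine (abs_abs_sub_abs_le _ _).trans (h3.trans ?_)
          gcongr) (hla _ (by simpa using hun))
      exact ⟨key.1, key.2 hτ1⟩
  have hWzero : ∀ p q i x, (p = 0 ∨ ∃ κ : ℝ, q = κ • p) → Wd (G 0) (fun i => G (Finsupp.single i 1)) p q i x = 0 := by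
    rintro p q i x (rfl | ⟨κ, rfl⟩)
    · simp [Wd]
    · simp [Wd, smul_dotProduct]; ring
  have hB : ∀ y r, 0 < r → dist y x0 + r < R → ∀ p q,
      (∀ M, 0 < M → (∃ x ∈ Bl y r, M ≤ ∑ i, |Wd (G 0) (fun i => G (Finsupp.single i 1)) p q i x|) →
      volume {x | x ∈ Bl y r ∧ ∑ i, |Wd (G 0) (fun i => G (Finsupp.single i 1)) p q i x| <
        cb / (2 * (d * (2 * C ^ 2) + cb)) * M} ≤ τ * volume (Bl y r)) ∧
      (∀ a b, ∃ x ∈ Bl y r, cb / 2 * ((c1 * r ^ l) ^ 2 / (2 * r)) * |p a * q b - q a * p b| ≤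
        ∑ i, |Wd (G 0) (fun i => G (Finsupp.single i 1)) p q i x|) := by
    intro y r hr hyr p q
    set Λ : (Vc N) →ₗ[ℝ] (MI d l → ℝ) :=
      { toFun := Lam l G y r
        map_add' := fun p q => by ext ν; simp [Lam, add_dotProduct]; ring
        map_smul' := fun a p => by ext ν; simp [Lam, smul_dotProduct]; ring } with hΛ
    have hcr : 0 < c1 * r ^ l := by positivity
    have hlow : ∀ p, c1 * r ^ l * ‖p‖ ≤ ‖Λ p‖ := fun p => (hmain y r hr hyr p).1
    have hinj : ∀ p, Λ p = 0 → p = 0 := by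
      intro p hp
      have := hlow p
      rw [hp, norm_zero] at this
      by_contra hne
      have := norm_pos_iff.2 hne
      have := mul_pos hcr this
      linarith
    have hdeg : (p = 0 ∨ ∃ κ : ℝ, q = κ • p) → _ := fun h => (show
      (∀ M, 0 < M → (∃ x ∈ Bl y r, M ≤ ∑ i, |Wd (G 0) (fun i => G (Finsupp.single i 1)) p q i x|) →
      volume {x | x ∈ Bl y r ∧ ∑ i, |Wd (G 0) (fun i => G (Finsupp.single i 1)) p q i x| <
        cb / (2 * (d * (2 * C ^ 2) + cb)) * M} ≤ τ * volume (Bl y r)) ∧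
      (∀ a b, ∃ x ∈ Bl y r, cb / 2 * ((c1 * r ^ l) ^ 2 / (2 * r)) * |p a * q b - q a * p b| ≤
        ∑ i, |Wd (G 0) (fun i => G (Finsupp.single i 1)) p q i x|) by
        constructor
        · rintro M hM ⟨x, hx, hMx⟩
          simp only [hWzero p q _ _ h, abs_zero, Finset.sum_const_zero] at hMx
          linarith
        · intro a b
          refine ⟨y, Metric.mem_ball_self hr, ?_⟩
          have : p a * q b - q a * p b = 0 := by
            rcases h with rfl | ⟨κ, rfl⟩
            · simp
            · simp; ring
          rw [this, abs_zero, mul_zero]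
          exact Finset.sum_nonneg fun i _ => abs_nonneg _)
    rcases pair_reduction Λ hinj p q with h | h | ⟨α, γ, κ, p', q', hp, hq, hK⟩
    · exact hdeg (Or.inl h)
    · exact hdeg (Or.inr h)
    have hWs : ∀ i x, Wd (G 0) (fun i => G (Finsupp.single i 1)) p q i x =
        (α * γ) * Wd (G 0) (fun i => G (Finsupp.single i 1)) p' q' i x := by
      intro i x
      simp only [Wd, hp, hq, smul_dotProduct, add_dotProduct, smul_eq_mul]; ring
    have hms : ∀ a b, p a * q b - q a * p b = (α * γ) * (p' a * q' b - q' a * p' b) := by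
      intro a b; simp only [hp, hq, Pi.smul_apply, Pi.add_apply, smul_eq_mul]; ring
    have hu : ‖Λ p'‖ = 1 := hK.1
    have hv : ‖Λ q'‖ = 1 := hK.2.1
    have hS0 : 0 ≤ |α * γ| / r := by positivity
    have key := level_good y r hr (fun x => ∑ i, |Wd (G 0) (fun i => G (Finsupp.single i 1)) p q i x|)
      (gW (Λ p', Λ q')) cb (d * (2 * C ^ 2)) (|α * γ| / r) τ hcb
      (fun z => Finset.sum_nonneg fun i _ => abs_nonneg _) (hgWC _ hK) hS0 (by
        intro z hz
        have h1 : ∑ i, |Wd (G 0) (fun i => G (Finsupp.single i 1)) p q i (y + r • z)| =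
            |α * γ| / r * ∑ i, |r * Wd (G 0) (fun i => G (Finsupp.single i 1)) p' q' i (y + r • z)| := by
          rw [Finset.mul_sum]
          refine Finset.sum_congr rfl fun i _ => ?_
          rw [hWs, abs_mul, abs_mul r, abs_of_pos hr]
          field_simp
        rw [h1, ← mul_sub, abs_mul, abs_of_nonneg hS0, mul_comm]
        gcongr
        simp only [hgW]
        rw [← Finset.sum_sub_distrib]
        refine (Finset.abs_sum_le_sum_abs _ _).trans (le_trans ?_ hηb)
        have hterm : ∀ i ∈ Finset.univ, |(|r * Wd (G 0) (fun i => G (Finsupp.single i 1)) p' q' i (y + r • z)| -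
            |MvPolynomial.eval z (PW (TPs (Λ p')) (TPs (Λ q')) i)|)| ≤ 6 * C * η := by
          intro i _
          refine (abs_abs_sub_abs_le _ _).trans ?_
          obtain ⟨-, hp2⟩ := hmain y r hr hyr p'
          obtain ⟨-, hq2⟩ := hmain y r hr hyr q'
          have a1 := (hp2 z hz).1
          have a2 := (hp2 z hz).2 i
          have a3 := (hq2 z hz).1
          have a4 := (hq2 z hz).2 i
          change |_ - MvPolynomial.eval z (TPs (Λ p'))| ≤ η * ‖Λ p'‖ at a1
          change |_ - MvPolynomial.eval z (MvPolynomial.pderiv i (TPs (Λ p')))| ≤ η * ‖Λ p'‖ at a2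
          change |_ - MvPolynomial.eval z (TPs (Λ q'))| ≤ η * ‖Λ q'‖ at a3
          change |_ - MvPolynomial.eval z (MvPolynomial.pderiv i (TPs (Λ q')))| ≤ η * ‖Λ q'‖ at a4
          rw [hu, mul_one] at a1 a2
          rw [hv, mul_one] at a3 a4
          have b1 := hb1 _ hu z hz
          have b2 := hb2 _ hu z hz i
          have b3 := hb1 _ hv z hz
          have b4 := hb2 _ hv z hz i
          simp only [Wd, PW, map_sub, map_mul]
          generalize p' ⬝ᵥ G 0 (y + r • z) = A at *
          generalize p' ⬝ᵥ G (Finsupp.single i 1) (y + r • z) = A' at *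
          generalize q' ⬝ᵥ G 0 (y + r • z) = B at *
          generalize q' ⬝ᵥ G (Finsupp.single i 1) (y + r • z) = B' at *
          generalize MvPolynomial.eval z (TPs (Λ p')) = P at *
          generalize MvPolynomial.eval z (MvPolynomial.pderiv i (TPs (Λ p'))) = P' at *
          generalize MvPolynomial.eval z (TPs (Λ q')) = Q at *
          generalize MvPolynomial.eval z (MvPolynomial.pderiv i (TPs (Λ q'))) = Q' at *
          exact wd_err hη1 hC1 hηp.le a1 a2 a3 a4 b1 b2 b3 b4
        refine (Finset.sum_le_sum hterm).trans ?_
        simp) (hlb _ hK)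
    refine ⟨key.1, fun a b => ?_⟩
    obtain ⟨x, hx, hle⟩ := key.2 hτ1
    refine ⟨x, hx, le_trans ?_ hle⟩
    rw [hms, abs_mul]
    have hp1 : c1 * r ^ l * ‖p'‖ ≤ 1 := (hlow p').trans hu.le
    have hq1 : c1 * r ^ l * ‖q'‖ ≤ 1 := (hlow q').trans hv.le
    have hmin : |p' a * q' b - q' a * p' b| ≤ 2 * (‖p'‖ * ‖q'‖) := by
      refine (abs_sub _ _).trans ?_
      rw [abs_mul, abs_mul]
      have e1 := mul_le_mul (norm_le_pi_norm p' a) (norm_le_pi_norm q' b) (norm_nonneg _) (norm_nonneg _)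
      have e2 := mul_le_mul (norm_le_pi_norm q' a) (norm_le_pi_norm p' b) (norm_nonneg _) (norm_nonneg _)
      simp only [Real.norm_eq_abs] at e1 e2
      linarith
    have hpq : (c1 * r ^ l) ^ 2 * (‖p'‖ * ‖q'‖) ≤ 1 := by
      have := mul_le_mul hp1 hq1 (by positivity) zero_le_one
      calc _ = (c1 * r ^ l * ‖p'‖) * (c1 * r ^ l * ‖q'‖) := by ring
        _ ≤ 1 := by linarith
    calc cb / 2 * ((c1 * r ^ l) ^ 2 / (2 * r)) * (|α * γ| * |p' a * q' b - q' a * p' b|)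
        ≤ cb / 2 * ((c1 * r ^ l) ^ 2 / (2 * r)) * (|α * γ| * (2 * (‖p'‖ * ‖q'‖))) := by gcongr
      _ = cb / 2 * (|α * γ| / r) * ((c1 * r ^ l) ^ 2 * (‖p'‖ * ‖q'‖)) := by field_simp
      _ ≤ cb / 2 * (|α * γ| / r) * 1 := by gcongr
      _ = _ := mul_one _
  set c := min (ca / (2 * (C + ca))) (cb / (2 * (d * (2 * C ^ 2) + cb))) with hc
  have hCp : 0 < C := by linarith
  have hcp : 0 < c := lt_min (by positivity) (by positivity)
  refine ⟨R, hR, hRR0, c, hcp, ?_, ?_, ?_, ?_⟩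
  · refine (min_le_left _ _).trans ?_
    rw [div_le_one (by positivity)]; linarith
  · intro p y r M hr hyr hM hex
    refine (measure_mono ?_).trans ((hA y r hr hyr p).1 M hM hex)
    rintro x ⟨hx1, hx2⟩
    refine ⟨hx1, hx2.trans_le ?_⟩
    gcongr
    exact min_le_left _ _
  · intro p q y r M hr hyr hM hex
    refine (measure_mono ?_).trans ((hB y r hr hyr p q).1 M hM hex)
    rintro x ⟨hx1, hx2⟩
    refine ⟨hx1, hx2.trans_le ?_⟩
    gcongr
    exact min_le_right _ _
  · intro y r hr hyr
    refine ⟨min (ca / 2 * (c1 * r ^ l)) (cb / 2 * ((c1 * r ^ l) ^ 2 / (2 * r))), by positivity, ?_, ?_⟩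
    · intro p
      obtain ⟨x, hx, hle⟩ := (hA y r hr hyr p).2
      refine ⟨x, hx, le_trans ?_ hle⟩
      calc _ ≤ (ca / 2 * (c1 * r ^ l)) * ‖p‖ := by gcongr; exact min_le_left _ _
        _ = ca / 2 * (c1 * r ^ l * ‖p‖) := by ring
        _ ≤ _ := by gcongr; exact (hmain y r hr hyr p).1
    · intro p q a b
      obtain ⟨x, hx, hle⟩ := (hB y r hr hyr p q).2 a b
      refine ⟨x, hx, le_trans ?_ hle⟩
      gcongr
      exact min_le_right _ _
end Good
end DSM

end PWPA4

namespace DSM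
section Count

lemma translates {d : ℕ} {S W : Set (Vc d)} (hS : MeasurableSet S) (v : Vc d) (X : ℝ) (hX : 0 ≤ X)
    (hdis : ∀ k : ℕ, 1 ≤ k → (k : ℝ) ≤ X → ∀ x ∈ S, x + (k : ℝ) • v ∉ S)
    (hW : ∀ k : ℕ, (k : ℝ) ≤ X → ∀ x ∈ S, x + (k : ℝ) • v ∈ W) :
    eR X * volume S ≤ volume W := by
  set M := ⌊X⌋₊ + 1 with hM
  have hk : ∀ k ∈ Finset.range M, (k : ℝ) ≤ X := by
    intro k hk
    rw [Finset.mem_range] at hk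
    exact (Nat.cast_le.2 (by omega : k ≤ ⌊X⌋₊)).trans (Nat.floor_le hX)
  have hvol : ∀ k : ℕ, volume ((fun x => x + -((k : ℝ) • v)) ⁻¹' S) = volume S := fun k =>
    measure_preimage_add_right volume _ S
  have hmeas : ∀ k : ℕ, MeasurableSet ((fun x => x + -((k : ℝ) • v)) ⁻¹' S) := fun k =>
    (measurable_add_const _) hS
  have hdj : ∀ k ∈ Finset.range M, ∀ k' ∈ Finset.range M, k < k' →
      Disjoint ((fun x => x + -((k : ℝ) • v)) ⁻¹' S) ((fun x => x + -((k' : ℝ) • v)) ⁻¹' S) := by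
    intro k hk1 k' hk2 hlt
    rw [Set.disjoint_left]
    intro x hx hx'
    simp only [mem_preimage] at hx hx'
    have h1 : ((k' - k : ℕ) : ℝ) = (k' : ℝ) - k := by push_cast [hlt.le]; ring
    refine hdis (k' - k) (by omega) (by rw [h1]; linarith [hk k' hk2, (Nat.cast_nonneg k : (0 : ℝ) ≤ k)]) _ hx' ?_
    rw [h1]
    have : x + -((k' : ℝ) • v) + ((k' : ℝ) - k) • v = x + -((k : ℝ) • v) := by rw [sub_smul]; abel
    rw [this]; exact hx
  have hsum := measure_biUnion_finset (μ := volume) (s := Finset.range M)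
    (f := fun k : ℕ => (fun x : Vc d => x + -((k : ℝ) • v)) ⁻¹' S) (by
      intro k hk1 k' hk2 hne
      rcases lt_or_gt_of_ne hne with h | h
      · exact hdj k hk1 k' hk2 h
      · exact (hdj k' hk2 k hk1 h).symm) (fun k _ => hmeas k)
  simp only [hvol, Finset.sum_const, Finset.card_range, nsmul_eq_mul] at hsum
  calc eR X * volume S ≤ (M : ℝ≥0∞) * volume S := by
        gcongr
        rw [← ENNReal.ofReal_natCast]
        apply ENNReal.ofReal_le_ofReal
        rw [hM]; push_cast
        exact (Nat.lt_floor_add_one X).le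
    _ = _ := hsum.symm
    _ ≤ volume W := by
        apply measure_mono
        intro x hx
        simp only [mem_iUnion] at hx
        obtain ⟨k, hk1, hx⟩ := hx
        have := hW k (hk k hk1) _ hx
        simpa using this

lemma ofReal_mul_le {X Y : ℝ} (hX : 0 < X) {a b : ℝ≥0∞} (h : eR X * a ≤ b) (hY : 1 ≤ X * Y) :
    a ≤ eR Y * b := by
  have hY0 : 0 < Y := by
    by_contra hn
    push Not at hn
    nlinarith
  calc a = 1 * a := (one_mul a).symm
    _ ≤ eR (X * Y) * a := by
        gcongr
        rw [← ENNReal.ofReal_one]; exact ENNReal.ofReal_le_ofReal hY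
    _ = eR Y * (eR X * a) := by rw [ENNReal.ofReal_mul hX.le]; ring
    _ ≤ _ := by gcongr

lemma slab {d : ℕ} (z : Vc d) (r : ℝ) (hr : 0 < r) (jd : Fin d → ℤ) (i : Fin d) (hi : jd i ≠ 0) (c b0 : ℝ) (hb0 : 0 < b0) :
    volume {y | y ∈ Bl z (2 * r) ∧ |c + ∑ i, (jd i : ℝ) * y i| < 2 * b0} ≤
      eR (3 ^ d * b0 / (r * |(jd i : ℝ)|)) * volume (Bl z (2 * r)) := by
  have hJ : 0 < |(jd i : ℝ)| := abs_pos.2 (by exact_mod_cast hi)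
  have hmeas : MeasurableSet {y | y ∈ Bl z (2 * r) ∧ |c + ∑ i, (jd i : ℝ) * y i| < 2 * b0} := by
    have ho : IsOpen {y : Vc d | |c + ∑ i, (jd i : ℝ) * y i| < 2 * b0} := by
      have h1 : Continuous fun y : Vc d => |c + ∑ i, (jd i : ℝ) * y i| := by fun_prop
      exact isOpen_lt h1 continuous_const
    exact (Metric.isOpen_ball.inter ho).measurableSet
  have key := translates (W := Bl z (3 * (2 * r))) hmeas ((4 * b0 / |(jd i : ℝ)|) • Pi.single i 1) (r * |(jd i : ℝ)| / b0) (by positivity)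
    (by
      rintro k hk hkX x ⟨hx1, hx2⟩ ⟨hx3, hx4⟩
      have hs : c + ∑ i', (jd i' : ℝ) * (x + (k : ℝ) • (4 * b0 / |(jd i : ℝ)|) • Pi.single i (1 : ℝ) : Vc d) i' =
          (c + ∑ i', (jd i' : ℝ) * x i') + k * (4 * b0 / |(jd i : ℝ)|) * jd i := by
        simp only [Pi.add_apply, Pi.smul_apply, smul_eq_mul, mul_add, Finset.sum_add_distrib, Pi.single_apply]
        simp; ring
      rw [hs] at hx4
      have h1 : |(k : ℝ) * (4 * b0 / |(jd i : ℝ)|) * jd i| = 4 * b0 * k := by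
        rw [abs_mul, abs_mul, abs_div, abs_abs, Nat.abs_cast, abs_of_pos (by positivity : 0 < 4 * b0)]
        field_simp
      have h2 : (1 : ℝ) ≤ k := by exact_mod_cast hk
      have h3 := abs_sub ((c + ∑ i', (jd i' : ℝ) * x i') + k * (4 * b0 / |(jd i : ℝ)|) * jd i) (c + ∑ i', (jd i' : ℝ) * x i')
      rw [add_sub_cancel_left, h1] at h3
      nlinarith)
    (by
      rintro k hkX x ⟨hx1, -⟩
      rw [Metric.mem_ball, dist_eq_norm] at hx1 ⊢
      have h1 : ‖(k : ℝ) • (4 * b0 / |(jd i : ℝ)|) • (Pi.single i (1 : ℝ) : Vc d)‖ ≤ 4 * r := by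
        rw [norm_smul, norm_smul, Pi.norm_single]
        simp only [norm_one, mul_one, Real.norm_eq_abs, Nat.abs_cast, abs_div, abs_abs]
        rw [abs_of_pos (by positivity : 0 < 4 * b0)]
        rw [le_div_iff₀ hb0] at hkX
        rw [mul_div_assoc', div_le_iff₀ hJ]
        nlinarith
      calc ‖x + (k : ℝ) • (4 * b0 / |(jd i : ℝ)|) • (Pi.single i (1 : ℝ) : Vc d) - z‖
          = ‖(x - z) + (k : ℝ) • (4 * b0 / |(jd i : ℝ)|) • (Pi.single i (1 : ℝ) : Vc d)‖ := by congr 1; abel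
        _ ≤ _ := norm_add_le _ _
        _ < 3 * (2 * r) := by linarith)
  have hv := vol_ball_scale z z 3 (2 * r) (by positivity) (by norm_num)
  simp only [Nat.cast_ofNat] at hv
  rw [hv] at key
  refine (ofReal_mul_le (Y := b0 / (r * |(jd i : ℝ)|)) (by positivity) key (by
    apply le_of_eq; field_simp)).trans (le_of_eq ?_)
  rw [mul_div_assoc, ENNReal.ofReal_mul (by positivity)]
  rw [ENNReal.ofReal_pow (by norm_num), ENNReal.ofReal_ofNat]
  ring

lemma tsum_int_le (F : ℤ → ℝ≥0∞) (w X : ℝ) (hX : 0 ≤ X) (c : ℝ≥0∞) (hF : ∀ j, F j ≤ c)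
    (h0 : ∀ j : ℤ, X ≤ |(j : ℝ) + w| → F j = 0) : ∑' j, F j ≤ eR (2 * X + 1) * c := by
  have hs : ∀ j ∉ Finset.Icc ⌈-w - X⌉ ⌊-w + X⌋, F j = 0 := by
    intro j hj
    apply h0
    rw [Finset.mem_Icc, not_and_or] at hj
    rcases hj with hj | hj
    · rw [Int.ceil_le, not_le] at hj
      rw [le_abs]; right; linarith
    · rw [Int.le_floor, not_le] at hj
      rw [le_abs]; left; linarith
  rw [tsum_eq_sum hs]
  refine (Finset.sum_le_sum fun j _ => hF j).trans ?_
  rw [Finset.sum_const, nsmul_eq_mul]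
  gcongr
  rw [← ENNReal.ofReal_natCast]
  apply ENNReal.ofReal_le_ofReal
  rw [Int.card_Icc]
  have h1 : (⌊-w + X⌋ : ℝ) ≤ -w + X := Int.floor_le _
  have h2 : -w - X ≤ (⌈-w - X⌉ : ℝ) := Int.le_ceil _
  rcases le_total 0 (⌊-w + X⌋ + 1 - ⌈-w - X⌉) with h | h
  · have : (((⌊-w + X⌋ + 1 - ⌈-w - X⌉).toNat : ℤ) : ℝ) = ((⌊-w + X⌋ + 1 - ⌈-w - X⌉ : ℤ) : ℝ) := by
      rw [Int.toNat_of_nonneg h]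
    rw [Int.cast_natCast] at this
    rw [this]; push_cast; linarith
  · rw [Int.toNat_of_nonpos h]; simp; linarith

noncomputable def ibox (d : ℕ) (X : ℝ) : Finset (Fin d → ℤ) := Fintype.piFinset fun _ => Finset.Icc (-⌊X⌋) ⌊X⌋

lemma mem_ibox {d : ℕ} {X : ℝ} {a : Fin d → ℤ} : a ∈ ibox d X ↔ ∀ i, |(a i : ℝ)| ≤ X := by
  simp only [ibox, Fintype.mem_piFinset, Finset.mem_Icc]
  refine forall_congr' fun i => ?_
  rw [abs_le, Int.le_floor, neg_le, Int.le_floor]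
  push_cast
  constructor <;> rintro ⟨h1, h2⟩ <;> constructor <;> linarith

lemma card_ibox (d : ℕ) (X : ℝ) (hX : 0 ≤ X) : ((ibox d X).card : ℝ) ≤ (2 * X + 1) ^ d := by
  rw [ibox, Fintype.card_piFinset]
  simp only [Finset.prod_const, Finset.card_univ, Fintype.card_fin]
  push_cast
  gcongr
  rw [Int.card_Icc]
  have h0 : 0 ≤ ⌊X⌋ := Int.floor_nonneg.2 hX
  have : (((⌊X⌋ + 1 - -⌊X⌋).toNat : ℤ) : ℝ) = ((⌊X⌋ + 1 - -⌊X⌋ : ℤ) : ℝ) := by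
    rw [Int.toNat_of_nonneg (by omega)]
  rw [Int.cast_natCast] at this
  rw [this]; push_cast; linarith [Int.floor_le X]

def SJ {d : ℕ} (z : Vc d) (r g b0 : ℝ) (j : ℤ × (Fin d → ℤ)) : Set (Vc d) :=
  {y | y ∈ Bl z (2 * r) ∧ |(j.1 : ℝ) + ∑ i, (j.2 i : ℝ) * y i| < 2 * b0 ∧ ∀ i, |(j.2 i : ℝ)| < 6 * g}

lemma SJ_open {d : ℕ} (z : Vc d) (r g b0 : ℝ) (j : ℤ × (Fin d → ℤ)) : IsOpen (SJ z r g b0 j) := by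
  have h1 : Continuous fun y : Vc d => |(j.1 : ℝ) + ∑ i, (j.2 i : ℝ) * y i| := by fun_prop
  have ho : IsOpen {y : Vc d | |(j.1 : ℝ) + ∑ i, (j.2 i : ℝ) * y i| < 2 * b0} := isOpen_lt h1 continuous_const
  have hc : IsOpen {y : Vc d | ∀ i, |(j.2 i : ℝ)| < 6 * g} := isOpen_const
  exact Metric.isOpen_ball.inter (ho.inter hc)

lemma sum_SJ_one {d : ℕ} (z : Vc d) (r : ℝ) (hr : 0 < r) (g b0 : ℝ) (hb0 : 0 < b0) (hb1 : b0 ≤ 1) (jd : Fin d → ℤ) (h0 : jd ≠ 0) :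
    ∑' j0 : ℤ, volume (SJ z r g b0 (j0, jd)) ≤
      eR (3 ^ d * b0 * (4 * d + 5) + (if jd ∈ ibox d (1 / r) then 3 ^ d * b0 * (5 / r) else 0)) *
        volume (Bl z (2 * r)) := by
  obtain ⟨i1, hi1⟩ : ∃ i, jd i ≠ 0 := by
    by_contra h; push Not at h; exact h0 (funext h)
  obtain ⟨i, -, hmax⟩ := Finset.exists_max_image Finset.univ (fun i => |(jd i : ℝ)|) ⟨i1, Finset.mem_univ _⟩
  set J := |(jd i : ℝ)| with hJ
  have hJ1 : 1 ≤ J := by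
    refine le_trans ?_ (hmax i1 (Finset.mem_univ _))
    have := Int.one_le_abs hi1
    exact_mod_cast this
  have hi : jd i ≠ 0 := by intro h; rw [hJ, h] at hJ1; norm_num at hJ1
  have h1 := tsum_int_le (fun j0 => volume (SJ z r g b0 (j0, jd))) (∑ i, (jd i : ℝ) * z i) (2 + 2 * r * d * J) (by positivity)
    (eR (3 ^ d * b0 / (r * J)) * volume (Bl z (2 * r)))
    (fun j0 => (measure_mono (fun y hy => And.intro hy.1 hy.2.1)).trans (slab z r hr jd i hi j0 b0 hb0))
    (by
      intro j0 hj0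
      have : SJ z r g b0 (j0, jd) = ∅ := by
        rw [Set.eq_empty_iff_forall_notMem]
        rintro y ⟨hy1, hy2, -⟩
        simp only at hy2
        have hd : |∑ i, (jd i : ℝ) * z i - ∑ i, (jd i : ℝ) * y i| ≤ 2 * r * d * J := by
          rw [← Finset.sum_sub_distrib]
          refine (Finset.abs_sum_le_sum_abs _ _).trans ?_
          have : ∀ i' ∈ Finset.univ, |(jd i' : ℝ) * z i' - (jd i' : ℝ) * y i'| ≤ J * (2 * r) := by
            intro i' _
            rw [← mul_sub, abs_mul]
            gcongr
            · exact hmax i' (Finset.mem_univ _)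
            · rw [Metric.mem_ball, dist_comm, dist_eq_norm] at hy1
              exact (norm_le_pi_norm (z - y) i').trans hy1.le
          refine (Finset.sum_le_sum this).trans ?_
          simp; apply le_of_eq; ring
        have := abs_add_le ((j0 : ℝ) + ∑ i, (jd i : ℝ) * y i) (∑ i, (jd i : ℝ) * z i - ∑ i, (jd i : ℝ) * y i)
        have e : (j0 : ℝ) + ∑ i, (jd i : ℝ) * y i + (∑ i, (jd i : ℝ) * z i - ∑ i, (jd i : ℝ) * y i) = j0 + ∑ i, (jd i : ℝ) * z i := by ring
        rw [e] at this
        linarith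
      rw [this]; simp)
  refine h1.trans ?_
  rw [← mul_assoc, ← ENNReal.ofReal_mul (by positivity)]
  gcongr eR ?_ * _
  have e : (2 * (2 + 2 * r * d * J) + 1) * (3 ^ d * b0 / (r * J)) = 3 ^ d * b0 * (4 * d) + 3 ^ d * b0 * (5 / (r * J)) := by
    field_simp; ring
  rw [e, mul_add (3 ^ d * b0 : ℝ) (4 * (d : ℝ)) 5, add_assoc]
  gcongr
  split_ifs with hb
  · have : 5 / (r * J) ≤ 5 / r := by
      gcongr; nlinarith
    have h5 : 0 ≤ 3 ^ d * b0 * (5 : ℝ) := by positivity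
    have := mul_le_mul_of_nonneg_left this (by positivity : 0 ≤ 3 ^ d * b0)
    linarith
  · have hJr : 1 < r * J := by
      by_contra hn
      push Not at hn
      apply hb
      rw [mem_ibox]
      intro i'
      refine (hmax i' (Finset.mem_univ _)).trans ?_
      rw [le_div_iff₀ hr]; linarith
    rw [add_zero]
    gcongr
    rw [div_le_iff₀ (by positivity)]
    linarith

lemma sum_SJ {d : ℕ} (z : Vc d) (r : ℝ) (hr : 0 < r) (g b0 : ℝ) (hg : 1 ≤ g) (hb0 : 0 < b0) (hb1 : b0 ≤ 1) :
    ∑' j : ℤ × (Fin d → ℤ), volume (SJ z r g b0 j) ≤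
      eR (5 + 3 ^ d * (4 * d + 5) * 13 ^ d * (b0 * g ^ d) + (2 / r + 1) ^ d * (3 ^ d * (5 / r)) * b0) *
        volume (Bl z (2 * r)) := by
  rw [ENNReal.tsum_prod', ENNReal.tsum_comm]
  have hz : ∀ jd ∉ ibox d (6 * g), ∑' j0 : ℤ, volume (SJ z r g b0 (j0, jd)) = 0 := by
    intro jd hjd
    rw [ENNReal.tsum_eq_zero]
    intro j0
    have : SJ z r g b0 (j0, jd) = ∅ := by
      rw [Set.eq_empty_iff_forall_notMem]
      rintro y ⟨-, -, h⟩
      exact hjd (mem_ibox.2 fun i => (h i).le)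
    rw [this]; simp
  rw [tsum_eq_sum hz]
  set V := volume (Bl z (2 * r)) with hV
  have hterm : ∀ jd ∈ ibox d (6 * g), ∑' j0 : ℤ, volume (SJ z r g b0 (j0, jd)) ≤
      eR ((if jd = 0 then 5 else 0) + 3 ^ d * b0 * (4 * d + 5) +
        (if jd ∈ ibox d (1 / r) then 3 ^ d * b0 * (5 / r) else 0)) * V := by
    intro jd _
    by_cases h0 : jd = 0
    · have h1 := tsum_int_le (fun j0 => volume (SJ z r g b0 (j0, jd))) 0 2 (by norm_num) V
        (fun j0 => measure_mono fun y hy => hy.1) (by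
          intro j0 hj0
          have : SJ z r g b0 (j0, jd) = ∅ := by
            rw [Set.eq_empty_iff_forall_notMem]
            rintro y ⟨-, h, -⟩
            rw [h0] at h
            simp only [Pi.zero_apply, Int.cast_zero, zero_mul, Finset.sum_const_zero] at h
            linarith
          rw [this]; simp)
      refine h1.trans ?_
      gcongr eR ?_ * _
      rw [if_pos h0]
      have : 0 ≤ 3 ^ d * b0 * (4 * (d : ℝ) + 5) := by positivity
      have : (0 : ℝ) ≤ (if jd ∈ ibox d (1 / r) then 3 ^ d * b0 * (5 / r) else 0) := by
        split_ifs <;> positivity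
      linarith
    · refine (sum_SJ_one z r hr g b0 hb0 hb1 jd h0).trans ?_
      gcongr eR ?_ * _
      rw [if_neg h0, zero_add]
  refine (Finset.sum_le_sum hterm).trans ?_
  rw [← Finset.sum_mul, ← ENNReal.ofReal_sum_of_nonneg (by
    intro jd _
    have : (0 : ℝ) ≤ (if jd ∈ ibox d (1 / r) then 3 ^ d * b0 * (5 / r) else 0) := by
      split_ifs <;> positivity
    have : (0 : ℝ) ≤ (if jd = 0 then 5 else 0) := by split_ifs <;> positivity
    positivity)]
  gcongr eR ?_ * _
  rw [Finset.sum_add_distrib, Finset.sum_add_distrib]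
  gcongr
  · rw [Finset.sum_ite_eq']
    split_ifs <;> norm_num
  · rw [Finset.sum_const, nsmul_eq_mul]
    have h1 : ((ibox d (6 * g)).card : ℝ) ≤ (13 * g) ^ d := (card_ibox d _ (by positivity)).trans (by gcongr; linarith)
    calc _ ≤ (13 * g) ^ d * (3 ^ d * b0 * (4 * d + 5)) := by gcongr
      _ = _ := by rw [mul_pow]; ring
  · rw [← Finset.sum_filter, Finset.sum_const, nsmul_eq_mul]
    have h1 : (((ibox d (6 * g)).filter (· ∈ ibox d (1 / r))).card : ℝ) ≤ (2 / r + 1) ^ d := by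
      refine le_trans ?_ ((card_ibox d (1 / r) (by positivity)).trans (le_of_eq (by ring)))
      exact_mod_cast Finset.card_le_card fun a ha => (Finset.mem_filter.1 ha).2
    calc _ ≤ (2 / r + 1) ^ d * (3 ^ d * b0 * (5 / r)) := by gcongr
      _ = _ := by ring
end Count
section Scale

noncomputable def hA {d m : ℕ} (f : (Vc d) → Vc m) (am : Fin m → ℤ) (a : ℤ × (Fin d → ℤ)) (x : Vc d) : ℝ :=
  (a.1 + ∑ i, (a.2 i : ℝ) * x i) + ∑ j, (am j : ℝ) * f x j

noncomputable def dA {d m : ℕ} (Df : Fin d → Fin m → (Vc d) → ℝ) (am : Fin m → ℤ) (a : ℤ × (Fin d → ℤ)) (i : Fin d) (x : Vc d) : ℝ :=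
  a.2 i + ∑ j, (am j : ℝ) * Df i j x

structure Tay {d m : ℕ} (f : (Vc d) → Vc m) (Df : Fin d → Fin m → (Vc d) → ℝ) (C : ℝ) (S : Set (Vc d)) : Prop where
  hC : 0 ≤ C
  hT : ∀ x ∈ S, ∀ y ∈ S, ∀ j, |f y j - f x j - ∑ i, Df i j x * (y i - x i)| ≤ C * ‖y - x‖ ^ 2
  hL : ∀ x ∈ S, ∀ y ∈ S, ∀ i j, |Df i j y - Df i j x| ≤ C * ‖y - x‖
  hf : ∀ j, ContinuousOn (fun x => f x j) S
  hD : ∀ i j, ContinuousOn (Df i j) S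

variable {d m : ℕ} {f : (Vc d) → Vc m} {Df : Fin d → Fin m → (Vc d) → ℝ} {C : ℝ}

lemma Tay.mono {S S' : Set (Vc d)} (h : Tay f Df C S) (hs : S' ⊆ S) : Tay f Df C S' where
  hC := h.hC
  hT x hx y hy j := h.hT x (hs hx) y (hs hy) j
  hL x hx y hy i j := h.hL x (hs hx) y (hs hy) i j
  hf j := (h.hf j).mono hs
  hD i j := (h.hD i j).mono hs

lemma hA_tay {S : Set (Vc d)} (h : Tay f Df C S) {am : Fin m → ℤ} {T : ℝ} (ham : ∀ j, |(am j : ℝ)| ≤ T)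
    (a : ℤ × (Fin d → ℤ)) {x y : Vc d} (hx : x ∈ S) (hy : y ∈ S) :
    |hA f am a y - hA f am a x - ∑ i, dA Df am a i x * (y i - x i)| ≤ m * C * T * ‖y - x‖ ^ 2 := by
  have e : hA f am a y - hA f am a x - ∑ i, dA Df am a i x * (y i - x i) =
      ∑ j, (am j : ℝ) * (f y j - f x j - ∑ i, Df i j x * (y i - x i)) := by
    simp only [hA, dA, add_mul, mul_sub, Finset.sum_add_distrib, Finset.sum_sub_distrib, Finset.sum_mul, Finset.mul_sum]
    rw [Finset.sum_comm (s := Finset.univ (α := Fin d)) (t := Finset.univ (α := Fin m)),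
      Finset.sum_comm (s := Finset.univ (α := Fin d)) (t := Finset.univ (α := Fin m))]
    simp only [mul_assoc]
    ring
  rw [e]
  refine (Finset.abs_sum_le_sum_abs _ _).trans ?_
  have : ∀ j ∈ Finset.univ, |(am j : ℝ) * (f y j - f x j - ∑ i, Df i j x * (y i - x i))| ≤ T * (C * ‖y - x‖ ^ 2) := by
    intro j _
    rw [abs_mul]
    have h1 := h.hT x hx y hy j
    have h2 := ham j
    have : 0 ≤ T := (abs_nonneg _).trans h2
    gcongr
  refine (Finset.sum_le_sum this).trans ?_
  simp
  apply le_of_eq; ring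

lemma dA_lip {S : Set (Vc d)} (h : Tay f Df C S) {am : Fin m → ℤ} {T : ℝ} (ham : ∀ j, |(am j : ℝ)| ≤ T)
    (a : ℤ × (Fin d → ℤ)) (i : Fin d) {x y : Vc d} (hx : x ∈ S) (hy : y ∈ S) :
    |dA Df am a i y - dA Df am a i x| ≤ m * C * T * ‖y - x‖ := by
  have e : dA Df am a i y - dA Df am a i x = ∑ j, (am j : ℝ) * (Df i j y - Df i j x) := by
    simp only [dA, mul_sub, Finset.sum_sub_distrib]; ring
  rw [e]
  refine (Finset.abs_sum_le_sum_abs _ _).trans ?_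
  have : ∀ j ∈ Finset.univ, |(am j : ℝ) * (Df i j y - Df i j x)| ≤ T * (C * ‖y - x‖) := by
    intro j _
    rw [abs_mul]
    have h1 := h.hL x hx y hy i j
    have h2 := ham j
    have : 0 ≤ T := (abs_nonneg _).trans h2
    gcongr
  refine (Finset.sum_le_sum this).trans ?_
  simp
  apply le_of_eq; ring

lemma hA_cont {S : Set (Vc d)} (h : Tay f Df C S) (am : Fin m → ℤ) (a : ℤ × (Fin d → ℤ)) : ContinuousOn (hA f am a) S := by
  unfold hA
  refine ContinuousOn.add (by fun_prop) (continuousOn_finsetSum _ fun j _ => continuousOn_const.mul (h.hf j))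

lemma dA_cont {S : Set (Vc d)} (h : Tay f Df C S) (am : Fin m → ℤ) (a : ℤ × (Fin d → ℤ)) (i : Fin d) : ContinuousOn (dA Df am a i) S := by
  unfold dA
  refine ContinuousOn.add (by fun_prop) (continuousOn_finsetSum _ fun j _ => continuousOn_const.mul (h.hD i j))

def Esm (f : (Vc d) → Vc m) (Df : Fin d → Fin m → (Vc d) → ℝ) (z : Vc d) (r δ g : ℝ) (am : Fin m → ℤ) (i : Fin d) (a : ℤ × (Fin d → ℤ)) : Set (Vc d) :=
  {x | x ∈ Bl z r ∧ |hA f am a x| < δ ∧ g < 2 * |dA Df am a i x| ∧ ∀ i', |dA Df am a i' x| < 2 * g}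

def Ebg (f : (Vc d) → Vc m) (Df : Fin d → Fin m → (Vc d) → ℝ) (z : Vc d) (r b0 g : ℝ) (am : Fin m → ℤ) (a : ℤ × (Fin d → ℤ)) : Set (Vc d) :=
  {x | x ∈ Bl z (2 * r) ∧ |hA f am a x| < b0 ∧ ∀ i', |dA Df am a i' x| < 3 * g}

lemma Esm_meas {z : Vc d} {r : ℝ} (h : Tay f Df C (Bl z r)) (δ g : ℝ) (am : Fin m → ℤ) (i : Fin d) (a : ℤ × (Fin d → ℤ)) :
    MeasurableSet (Esm f Df z r δ g am i a) := by
  have h1 := (hA_cont h am a).abs.isOpen_inter_preimage Metric.isOpen_ball (isOpen_Iio (a := δ))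
  have h2 := fun i => (dA_cont h am a i).abs.isOpen_inter_preimage Metric.isOpen_ball (isOpen_Iio (a := 2 * g))
  have h3 := (dA_cont h am a i).abs.isOpen_inter_preimage Metric.isOpen_ball (isOpen_Ioi (a := g / 2))
  have e : Esm f Df z r δ g am i a = ((Bl z r ∩ (fun x => |hA f am a x|) ⁻¹' Iio δ) ∩ (Bl z r ∩ (fun x => |dA Df am a i x|) ⁻¹' Ioi (g / 2))) ∩
      ⋂ i, (Bl z r ∩ (fun x => |dA Df am a i x|) ⁻¹' Iio (2 * g)) := by
    ext x
    simp only [Esm, mem_ofPred_eq, mem_inter_iff, mem_preimage, mem_Iio, mem_Ioi, mem_iInter]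
    constructor
    · rintro ⟨a1, a2, a3, a4⟩
      exact ⟨⟨⟨a1, a2⟩, a1, by linarith⟩, fun i => ⟨a1, a4 i⟩⟩
    · rintro ⟨⟨⟨a1, a2⟩, _, a3⟩, a4⟩
      exact ⟨a1, a2, by linarith, fun i => (a4 i).2⟩
  rw [e]
  exact ((h1.inter h3).inter (isOpen_iInter_of_finite h2)).measurableSet

lemma Ebg_meas {z : Vc d} {r : ℝ} (h : Tay f Df C (Bl z (2 * r))) (δ g : ℝ) (am : Fin m → ℤ) (a : ℤ × (Fin d → ℤ)) :
    MeasurableSet (Ebg f Df z r δ g am a) := by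
  have h1 := (hA_cont h am a).abs.isOpen_inter_preimage Metric.isOpen_ball (isOpen_Iio (a := δ))
  have h2 := fun i => (dA_cont h am a i).abs.isOpen_inter_preimage Metric.isOpen_ball (isOpen_Iio (a := 3 * g))
  have e : Ebg f Df z r δ g am a = (Bl z (2 * r) ∩ (fun x => |hA f am a x|) ⁻¹' Iio δ) ∩
      ⋂ i, (Bl z (2 * r) ∩ (fun x => |dA Df am a i x|) ⁻¹' Iio (3 * g)) := by
    ext x
    simp only [Ebg, mem_ofPred_eq, mem_inter_iff, mem_preimage, mem_Iio, mem_iInter]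
    constructor
    · rintro ⟨a1, a2, a4⟩
      exact ⟨⟨a1, a2⟩, fun i => ⟨a1, a4 i⟩⟩
    · rintro ⟨⟨a1, a2⟩, a4⟩
      exact ⟨a1, a2, fun i => (a4 i).2⟩
  rw [e]
  exact (h1.inter (isOpen_iInter_of_finite h2)).measurableSet

lemma Esm_le {z : Vc d} {r : ℝ} (hr : 0 < r) (h : Tay f Df C (Bl z (2 * r))) {δ g b0 T κ : ℝ} (hg : 1 ≤ g)
    (hδ : 0 < δ) (hb0 : 0 < b0) (hδb : δ ≤ b0 / 2) (hT : 1 ≤ T) (hbT : b0 * T ≤ g ^ 2) (hbr : b0 ≤ g * r)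
    (hκ : 0 < κ) (hκ5 : κ ≤ 1 / 5) (hκC : m * C * κ ≤ 1 / 4)
    {am : Fin m → ℤ} (ham : ∀ j, |(am j : ℝ)| ≤ T) (i : Fin d) (a : ℤ × (Fin d → ℤ)) :
    volume (Esm f Df z r δ g am i a) ≤ eR (8 * δ / (κ * b0)) * volume (Ebg f Df z r b0 g am a) := by
  have hC := h.hC
  have hg0 : 0 < g := by linarith
  set R := κ * b0 / g with hR
  have hR0 : 0 < R := by positivity
  have hgR : g * R = κ * b0 := by rw [hR]; field_simp
  have hRr : R ≤ r := by
    rw [hR, div_le_iff₀ hg0]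
    have : κ * b0 ≤ 1 * b0 := by gcongr; linarith
    linarith
  set Λ := m * C * T with hΛ
  have hΛ0 : 0 ≤ Λ := by positivity
  have hΛR : Λ * R ≤ g / 4 := by
    rw [hΛ, hR]
    have : m * C * T * (κ * b0 / g) = (m * C * κ) * (b0 * T) / g := by ring
    rw [this, div_le_iff₀ hg0]
    calc _ ≤ (1 / 4) * g ^ 2 := by gcongr
      _ = _ := by ring
  have hsub : Bl z r ⊆ Bl z (2 * r) := Metric.ball_subset_ball (by linarith)
  have hw : ∀ k : ℕ, (k : ℝ) ≤ κ * b0 / (8 * δ) → k * (8 * δ / g) ≤ R := by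
    intro k hk
    rw [le_div_iff₀ (by positivity)] at hk
    rw [hR, mul_div_assoc', div_le_div_iff_of_pos_right hg0]
    linarith
  have hnw : ∀ k : ℕ, ‖(k : ℝ) • (8 * δ / g) • (Pi.single i (1 : ℝ) : Vc d)‖ = k * (8 * δ / g) := by
    intro k
    rw [norm_smul, norm_smul, Pi.norm_single]
    simp only [norm_one, mul_one, Real.norm_eq_abs, Nat.abs_cast]
    rw [abs_of_pos (by positivity)]
  have hball : ∀ k : ℕ, (k : ℝ) ≤ κ * b0 / (8 * δ) → ∀ x ∈ Bl z r,
      x + (k : ℝ) • (8 * δ / g) • (Pi.single i (1 : ℝ) : Vc d) ∈ Bl z (2 * r) := by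
    intro k hk x hx
    rw [Metric.mem_ball, dist_eq_norm] at hx ⊢
    calc ‖x + (k : ℝ) • (8 * δ / g) • (Pi.single i (1 : ℝ) : Vc d) - z‖
        = ‖(x - z) + (k : ℝ) • (8 * δ / g) • (Pi.single i (1 : ℝ) : Vc d)‖ := by congr 1; abel
      _ ≤ _ := norm_add_le _ _
      _ < 2 * r := by rw [hnw]; linarith [hw k hk]
  have htay : ∀ k : ℕ, (k : ℝ) ≤ κ * b0 / (8 * δ) → ∀ x ∈ Bl z r,
      |hA f am a (x + (k : ℝ) • (8 * δ / g) • (Pi.single i (1 : ℝ) : Vc d)) - hA f am a x - dA Df am a i x * (k * (8 * δ / g))| ≤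
        g / 4 * (k * (8 * δ / g)) := by
    intro k hk x hx
    have h1 := hA_tay h ham a (hsub hx) (hball k hk x hx)
    rw [add_sub_cancel_left, hnw] at h1
    have e : ∑ i', dA Df am a i' x * ((x + (k : ℝ) • (8 * δ / g) • (Pi.single i (1 : ℝ) : Vc d)) i' - x i') = dA Df am a i x * (k * (8 * δ / g)) := by
      simp [Pi.single_apply]
    rw [e] at h1
    refine h1.trans ?_
    rw [← hΛ, pow_two, ← mul_assoc]
    gcongr
    exact (mul_le_mul_of_nonneg_left (hw k hk) hΛ0).trans hΛR
  have key := translates (W := Ebg f Df z r b0 g am a) (Esm_meas (h.mono hsub) δ g am i a) ((8 * δ / g) • Pi.single i 1) (κ * b0 / (8 * δ)) (by positivity)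
    (by
      rintro k hk hkX x ⟨hx1, hx2, hx3, -⟩ ⟨-, hx4, -⟩
      have h1 := htay k hkX x hx1
      have hk1 : (1 : ℝ) ≤ k := by exact_mod_cast hk
      set W := (k : ℝ) * (8 * δ / g) with hW
      have hWp : 8 * δ / g ≤ W := by
        rw [hW]
        have : 0 < 8 * δ / g := by positivity
        nlinarith
      have hW0 : 0 < W := lt_of_lt_of_le (by positivity) hWp
      rw [div_le_iff₀ hg0] at hWp
      have h2 : |dA Df am a i x * W| = |dA Df am a i x| * W := by rw [abs_mul, abs_of_pos hW0]
      have h3 : |dA Df am a i x * W| ≤ |hA f am a (x + (k : ℝ) • (8 * δ / g) • (Pi.single i (1 : ℝ) : Vc d)) - hA f am a x - dA Df am a i x * W| +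
          |hA f am a (x + (k : ℝ) • (8 * δ / g) • (Pi.single i (1 : ℝ) : Vc d))| + |hA f am a x| := by
        have e : dA Df am a i x * W = -(hA f am a (x + (k : ℝ) • (8 * δ / g) • (Pi.single i (1 : ℝ) : Vc d)) - hA f am a x - dA Df am a i x * W) +
          hA f am a (x + (k : ℝ) • (8 * δ / g) • (Pi.single i (1 : ℝ) : Vc d)) - hA f am a x := by ring
        calc _ = _ := congrArg _ e
          _ ≤ _ := abs_sub _ _
          _ ≤ _ := by
            gcongr
            refine (abs_add_le _ _).trans ?_
            rw [abs_neg]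
      rw [h2] at h3
      have h4 : g / 2 * W ≤ |dA Df am a i x| * W := by gcongr; linarith
      linarith)
    (by
      rintro k hkX x ⟨hx1, hx2, -, hx3⟩
      have h1 := htay k hkX x hx1
      have hWR := hw k hkX
      refine ⟨hball k hkX x hx1, ?_, ?_⟩
      · set W := (k : ℝ) * (8 * δ / g) with hW
        have hW0 : 0 ≤ W := by positivity
        have h2 : |dA Df am a i x * W| = |dA Df am a i x| * W := by rw [abs_mul, abs_of_nonneg hW0]
        have h3 : |hA f am a (x + (k : ℝ) • (8 * δ / g) • (Pi.single i (1 : ℝ) : Vc d))| ≤ |hA f am a (x + (k : ℝ) • (8 * δ / g) • (Pi.single i (1 : ℝ) : Vc d)) - hA f am a x - dA Df am a i x * W| +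
            |dA Df am a i x * W| + |hA f am a x| := by
          have e : hA f am a (x + (k : ℝ) • (8 * δ / g) • (Pi.single i (1 : ℝ) : Vc d)) = (hA f am a (x + (k : ℝ) • (8 * δ / g) • (Pi.single i (1 : ℝ) : Vc d)) - hA f am a x - dA Df am a i x * W) +
            dA Df am a i x * W + hA f am a x := by ring
          calc _ = _ := congrArg _ e
            _ ≤ _ := abs_add_le _ _
            _ ≤ _ := by
              gcongr
              exact abs_add_le _ _
        rw [h2] at h3
        have h4 : |dA Df am a i x| * W ≤ 2 * g * R := by gcongr; exact (hx3 i).le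
        have h5 : g / 4 * W ≤ g / 4 * R := by gcongr
        have h6 : g * R ≤ b0 / 5 := by rw [hgR]; nlinarith
        nlinarith
      · intro i'
        have h2 := dA_lip h ham a i' (hsub hx1) (hball k hkX x hx1)
        rw [add_sub_cancel_left, hnw] at h2
        have h3 : Λ * (k * (8 * δ / g)) ≤ g / 4 := (mul_le_mul_of_nonneg_left hWR hΛ0).trans hΛR
        have h4 := abs_sub_abs_le_abs_sub (dA Df am a i' (x + (k : ℝ) • (8 * δ / g) • (Pi.single i (1 : ℝ) : Vc d))) (dA Df am a i' x)
        have h5 := hx3 i'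
        linarith)
  refine ofReal_mul_le (by positivity) key (le_of_eq ?_)
  field_simp

lemma sum_Ebg {z : Vc d} {r : ℝ} (h : Tay f Df C (Bl z (2 * r))) (g b0 : ℝ) (am : Fin m → ℤ) :
    ∑' a, volume (Ebg f Df z r b0 g am a) ≤ ∑' j, volume (SJ z r g b0 j) := by
  have e1 : ∀ a, volume (Ebg f Df z r b0 g am a) = ∫⁻ y, (Ebg f Df z r b0 g am a).indicator 1 y := fun a =>
    (lintegral_indicator_one (Ebg_meas h b0 g am a)).symm
  have e2 : ∀ a, volume (SJ z r g b0 a) = ∫⁻ y, (SJ z r g b0 a).indicator 1 y := fun a =>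
    (lintegral_indicator_one (SJ_open z r g b0 a).measurableSet).symm
  simp only [e1, e2]
  rw [← lintegral_tsum (fun a => (measurable_one.indicator (Ebg_meas h b0 g am a)).aemeasurable),
    ← lintegral_tsum (fun a => (measurable_one.indicator (SJ_open z r g b0 a).measurableSet).aemeasurable)]
  refine lintegral_mono fun y => ?_
  by_cases hex : ∃ a, y ∈ Ebg f Df z r b0 g am a
  · obtain ⟨a0, ha0⟩ := hex
    show ∑' a, (Ebg f Df z r b0 g am a).indicator 1 y ≤ ∑' a, (SJ z r g b0 a).indicator 1 y
    rw [← (Equiv.addLeft a0).tsum_eq (fun a => (Ebg f Df z r b0 g am a).indicator (1 : (Vc d) → ℝ≥0∞) y)]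
    refine ENNReal.tsum_le_tsum fun j => ?_
    by_cases hj : y ∈ Ebg f Df z r b0 g am (a0 + j)
    · have : y ∈ SJ z r g b0 j := by
        refine ⟨hj.1, ?_, fun i => ?_⟩
        · have e : (j.1 : ℝ) + ∑ i, (j.2 i : ℝ) * y i = hA f am (a0 + j) y - hA f am a0 y := by
            simp only [hA, Prod.fst_add, Prod.snd_add, Pi.add_apply, Int.cast_add, add_mul, Finset.sum_add_distrib]
            ring
          rw [e]
          have := abs_sub (hA f am (a0 + j) y) (hA f am a0 y)
          have := hj.2.1
          have := ha0.2.1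
          linarith
        · have e : (j.2 i : ℝ) = dA Df am (a0 + j) i y - dA Df am a0 i y := by
            simp only [dA, Prod.snd_add, Pi.add_apply, Int.cast_add]
            ring
          rw [e]
          have := abs_sub (dA Df am (a0 + j) i y) (dA Df am a0 i y)
          have := hj.2.2 i
          have := ha0.2.2 i
          linarith
      simp only [Equiv.coe_addLeft]
      rw [indicator_of_mem hj, indicator_of_mem this]
    · simp only [Equiv.coe_addLeft]
      rw [indicator_of_notMem hj]; exact zero_le
  · have : ∀ a, (Ebg f Df z r b0 g am a).indicator (1 : (Vc d) → ℝ≥0∞) y = 0 := fun a =>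
      indicator_of_notMem (fun hy => hex ⟨a, hy⟩) _
    simp [this]

noncomputable def CD (d m : ℕ) (C : ℝ) : ℝ := 3 ^ m * d * (8 * (5 + 4 * m * C)) * 2 ^ d * (5 + 3 ^ d * (4 * d + 5) * 13 ^ d)
noncomputable def CR (d : ℕ) (r : ℝ) : ℝ := 5 / r + (2 / r + 1) ^ d * (3 ^ d * (5 / r))

def BadG (f : (Vc d) → Vc m) (Df : Fin d → Fin m → (Vc d) → ℝ) (z : Vc d) (r δ T g : ℝ) : Set (Vc d) :=
  {x | ∃ am : Fin m → ℤ, (∀ j, |(am j : ℝ)| ≤ T) ∧ ∃ i a, x ∈ Esm f Df z r δ g am i a}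

lemma BadG_le {z : Vc d} {r : ℝ} (hr : 0 < r) (h : Tay f Df C (Bl z (2 * r))) {δ g T : ℝ} (hg : 1 ≤ g)
    (hδ : 0 < δ) (hT : 1 ≤ T) (hδ1 : δ ≤ 1 / 2) (hδr : δ ≤ r / 2) (hδT : δ ≤ 1 / T / 2) :
    volume (BadG f Df z r δ T g) ≤ eR (CD d m C * (δ * T ^ m) * (T / g ^ 2 + g ^ d + CR d r)) * volume (Bl z r) := by
  have hC := h.hC
  have hg0 : 0 < g := by linarith
  have hT0 : 0 < T := by linarith
  set κ : ℝ := 1 / (5 + 4 * m * C) with hκ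
  have hden : 0 < 5 + 4 * m * C := by positivity
  have hκ0 : 0 < κ := by positivity
  set b0 := min 1 (min (g ^ 2 / T) (g * r)) with hb
  have hb0 : 0 < b0 := by rw [hb]; positivity
  have hb1 : b0 ≤ 1 := min_le_left _ _
  have hbT : b0 ≤ g ^ 2 / T := (min_le_right _ _).trans (min_le_left _ _)
  have hbr : b0 ≤ g * r := (min_le_right _ _).trans (min_le_right _ _)
  have hδb : δ ≤ b0 / 2 := by
    have : 2 * δ ≤ b0 := by
      refine le_min (by linarith) (le_min ?_ ?_)
      · have : 1 / T ≤ g ^ 2 / T := by gcongr; nlinarith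
        linarith
      · nlinarith
    linarith
  have hinv : 1 / b0 ≤ 1 + T / g ^ 2 + 1 / r := by
    have p1 : 0 < T / g ^ 2 := by positivity
    have p2 : 0 < 1 / r := by positivity
    rcases min_choice 1 (min (g ^ 2 / T) (g * r)) with e | e
    · rw [hb, e]; norm_num; rw [one_div] at p2; linarith
    · rcases min_choice (g ^ 2 / T) (g * r) with e' | e'
      · rw [hb, e, e', one_div_div]; linarith
      · rw [hb, e, e']
        have : 1 / (g * r) ≤ 1 / r := by gcongr; nlinarith
        linarith
  have hone : ∀ am : Fin m → ℤ, (∀ j, |(am j : ℝ)| ≤ T) → ∀ i, ∑' a, volume (Esm f Df z r δ g am i a) ≤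
      eR (8 * δ / (κ * b0)) * (eR (5 + 3 ^ d * (4 * d + 5) * 13 ^ d * (b0 * g ^ d) + (2 / r + 1) ^ d * (3 ^ d * (5 / r)) * b0) *
        volume (Bl z (2 * r))) := by
    intro am ham i
    refine (ENNReal.tsum_le_tsum fun a => Esm_le hr h hg hδ hb0 hδb hT ?_ hbr hκ0 ?_ ?_ ham i a).trans ?_
    · rwa [le_div_iff₀ hT0] at hbT
    · rw [hκ]; gcongr; nlinarith [mul_nonneg (Nat.cast_nonneg (α := ℝ) m) hC]
    · rw [hκ, mul_one_div, div_le_iff₀ hden]; nlinarith [mul_nonneg (Nat.cast_nonneg (α := ℝ) m) hC]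
    · rw [ENNReal.tsum_mul_left]
      gcongr
      exact (sum_Ebg h g b0 am).trans (sum_SJ z r hr g b0 hg hb0 hb1)
  have hsub : BadG f Df z r δ T g ⊆ ⋃ am ∈ ibox m T, ⋃ i, ⋃ a, Esm f Df z r δ g am i a := by
    rintro x ⟨am, ham, i, a, hx⟩
    simp only [mem_iUnion]
    exact ⟨am, mem_ibox.2 ham, i, a, hx⟩
  have hv := vol_ball_scale z z 2 r hr (by norm_num)
  simp only [Nat.cast_ofNat] at hv
  rw [hv] at hone
  set Q := 8 * δ / (κ * b0) * (5 + 3 ^ d * (4 * d + 5) * 13 ^ d * (b0 * g ^ d) + (2 / r + 1) ^ d * (3 ^ d * (5 / r)) * b0) * 2 ^ d with hQ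
  have hQ0 : 0 ≤ Q := by positivity
  have hone' : ∀ am : Fin m → ℤ, (∀ j, |(am j : ℝ)| ≤ T) → ∀ i, ∑' a, volume (Esm f Df z r δ g am i a) ≤
      eR Q * volume (Bl z r) := by
    intro am ham i
    refine (hone am ham i).trans (le_of_eq ?_)
    rw [hQ, ENNReal.ofReal_mul (by positivity), ENNReal.ofReal_mul (by positivity), ENNReal.ofReal_pow (by norm_num), ENNReal.ofReal_ofNat]
    ring
  have hfin : volume (BadG f Df z r δ T g) ≤ eR ((2 * T + 1) ^ m * (d * Q)) * volume (Bl z r) := by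
    refine (measure_mono hsub).trans ((measure_biUnion_finset_le _ _).trans ?_)
    have : ∀ am ∈ ibox m T, volume (⋃ i, ⋃ a, Esm f Df z r δ g am i a) ≤ eR (d * Q) * volume (Bl z r) := by
      intro am ham
      refine (measure_iUnion_fintype_le _ _).trans ?_
      refine (Finset.sum_le_sum fun i _ => (measure_iUnion_le _).trans (hone' am (mem_ibox.1 ham) i)).trans (le_of_eq ?_)
      rw [Finset.sum_const, nsmul_eq_mul, ENNReal.ofReal_mul (p := (d : ℝ)) (by positivity), ENNReal.ofReal_natCast,
        Finset.card_univ, Fintype.card_fin, mul_assoc]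
    refine (Finset.sum_le_sum this).trans ?_
    rw [Finset.sum_const, nsmul_eq_mul, ENNReal.ofReal_mul (p := (2 * T + 1) ^ m) (by positivity), mul_assoc]
    gcongr
    rw [← ENNReal.ofReal_natCast]
    exact ENNReal.ofReal_le_ofReal (card_ibox m T hT0.le)
  refine hfin.trans ?_
  gcongr eR ?_ * _
  have hQle : Q ≤ (8 * (5 + 4 * m * C)) * 2 ^ d * δ * ((5 + 3 ^ d * (4 * d + 5) * 13 ^ d) * (T / g ^ 2 + g ^ d + CR d r)) := by
    set A1 : ℝ := 3 ^ d * (4 * d + 5) * 13 ^ d with hA1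
    have hA10 : 0 ≤ A1 := by positivity
    have e : Q = (8 * (5 + 4 * m * C)) * 2 ^ d * δ * (5 * (1 / b0) + A1 * g ^ d + (2 / r + 1) ^ d * (3 ^ d * (5 / r))) := by
      rw [hQ, hκ]; field_simp
    rw [e]
    have hgd : 1 ≤ g ^ d := one_le_pow₀ hg
    have hp1 : 0 ≤ T / g ^ 2 := by positivity
    have hp2 : 0 ≤ CR d r := by unfold CR; positivity
    have hp3 : 5 * (1 / r) + (2 / r + 1) ^ d * (3 ^ d * (5 / r)) = CR d r := by unfold CR; ring
    gcongr
    nlinarith [mul_nonneg hA10 hp1, mul_nonneg hA10 hp2]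
  have hQle' := mul_le_mul_of_nonneg_left hQle (by positivity : 0 ≤ (3 * T) ^ m * (d : ℝ))
  calc (2 * T + 1) ^ m * (d * Q) ≤ (3 * T) ^ m * (d * Q) := by gcongr; linarith
    _ = (3 * T) ^ m * d * Q := by ring
    _ ≤ _ := hQle'
    _ = _ := by unfold CD; rw [mul_pow]; ring

def BadD (f : (Vc d) → Vc m) (Df : Fin d → Fin m → (Vc d) → ℝ) (z : Vc d) (r δ T K : ℝ) : Set (Vc d) :=
  {x | x ∈ Bl z r ∧ ∃ am : Fin m → ℤ, (∀ j, |(am j : ℝ)| ≤ T) ∧ ∃ a, |hA f am a x| < δ ∧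
    (∃ i, 1 ≤ |dA Df am a i x|) ∧ ∀ i, |dA Df am a i x| < K}

lemma sum_geo (J : ℕ) (hd : 0 < d) {T : ℝ} (hT : 0 ≤ T) (R : ℝ) :
    ∑ j ∈ Finset.range J, (T / ((2 : ℝ) ^ j) ^ 2 + ((2 : ℝ) ^ j) ^ d + R) ≤ 2 * T + (2 ^ J) ^ d + R * J := by
  have h1 : ∑ j ∈ Finset.range J, T / ((2 : ℝ) ^ j) ^ 2 ≤ 2 * T := by
    have : ∀ J : ℕ, ∑ j ∈ Finset.range J, T / ((2 : ℝ) ^ j) ^ 2 ≤ 2 * T - 2 * (T / ((2 : ℝ) ^ J) ^ 2) := by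
      intro J
      induction J with
      | zero => simp
      | succ k ih =>
        rw [Finset.sum_range_succ, pow_succ (2 : ℝ) k, mul_pow, div_mul_eq_div_div]
        have : 0 ≤ T / (2 ^ k) ^ 2 := by positivity
        linarith
    have h2 := this J
    have : 0 ≤ T / ((2 : ℝ) ^ J) ^ 2 := by positivity
    linarith
  have h2 : ∑ j ∈ Finset.range J, ((2 : ℝ) ^ j) ^ d ≤ (2 ^ J) ^ d := by
    clear h1
    induction J with
    | zero => simp
    | succ k ih =>
      rw [Finset.sum_range_succ, pow_succ (2 : ℝ) k, mul_pow]
      have : (2 : ℝ) ^ 1 ≤ 2 ^ d := pow_le_pow_right₀ (by norm_num) hd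
      have : 0 ≤ ((2 : ℝ) ^ k) ^ d := by positivity
      nlinarith
  rw [Finset.sum_add_distrib, Finset.sum_add_distrib, Finset.sum_const, nsmul_eq_mul, Finset.card_range]
  linarith

lemma BadD_le (hd : 0 < d) {z : Vc d} {r : ℝ} (hr : 0 < r) (h : Tay f Df C (Bl z (2 * r))) {δ T K : ℝ}
    (hδ : 0 < δ) (hT : 1 ≤ T) (hδ1 : δ ≤ 1 / 2) (hδr : δ ≤ r / 2) (hδT : δ ≤ 1 / T / 2) (J : ℕ) (hJ : K ≤ 2 ^ J) :
    volume (BadD f Df z r δ T K) ≤ eR (CD d m C * (δ * T ^ m) * (2 * T + (2 ^ J) ^ d + CR d r * J)) * volume (Bl z r) := by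
  have hC := h.hC
  have hsub : BadD f Df z r δ T K ⊆ ⋃ j ∈ Finset.range J, BadG f Df z r δ T (2 ^ j) := by
    rintro x ⟨hx, am, ham, a, h1, ⟨i1, hi1⟩, h3⟩
    obtain ⟨i, -, hmax⟩ := Finset.exists_max_image Finset.univ (fun i => |dA Df am a i x|) ⟨i1, Finset.mem_univ _⟩
    obtain ⟨j, hj1, hj2⟩ := exists_nat_pow_near (hi1.trans (hmax i1 (Finset.mem_univ _))) (by norm_num : (1 : ℝ) < 2)
    have hjJ : j < J := by
      have : (2 : ℝ) ^ j < 2 ^ J := (hj1.trans_lt (h3 i)).trans_le hJ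
      exact (pow_lt_pow_iff_right₀ (by norm_num)).1 this
    simp only [mem_iUnion]
    refine ⟨j, Finset.mem_range.2 hjJ, am, ham, i, a, hx, h1, ?_, fun i' => ?_⟩
    · have : (0 : ℝ) < 2 ^ j := by positivity
      linarith
    · rw [pow_succ] at hj2
      linarith [hmax i' (Finset.mem_univ _)]
  refine (measure_mono hsub).trans ((measure_biUnion_finset_le _ _).trans ?_)
  refine (Finset.sum_le_sum fun j _ => BadG_le hr h (one_le_pow₀ (by norm_num)) hδ hT hδ1 hδr hδT).trans ?_
  have hCD : 0 ≤ CD d m C := by unfold CD; positivity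
  have hCR : 0 ≤ CR d r := by unfold CR; positivity
  rw [← Finset.sum_mul, ← ENNReal.ofReal_sum_of_nonneg (fun j _ => by positivity), ← Finset.mul_sum]
  gcongr eR (_ * ?_) * _
  exact sum_geo J hd (by linarith) _

end Scale
section Setup
variable {d m : ℕ}

noncomputable def DD (f : (Vc d) → Vc m) (i : Fin d) (j : Fin m) (x : Vc d) : ℝ :=
  fderiv ℝ f x (Pi.single i 1) j

lemma DD_sum (f : (Vc d) → Vc m) (j : Fin m) (x w : Vc d) :
    ∑ i, DD f i j x * w i = fderiv ℝ f x w j := by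
  have : w = ∑ i, w i • (Pi.single i (1 : ℝ) : Vc d) := by
    ext k; simp [Pi.single_apply]
  conv_rhs => rw [this, map_sum]
  simp only [map_smul, Finset.sum_apply, Pi.smul_apply, smul_eq_mul, DD]
  exact Finset.sum_congr rfl fun i _ => mul_comm _ _

lemma DD_lip (f : (Vc d) → Vc m) (i : Fin d) (j : Fin m) (A : (Vc d) →L[ℝ] (Vc m)) :
    |A (Pi.single i 1) j| ≤ ‖A‖ := by
  have h1 := norm_le_pi_norm (A (Pi.single i 1)) j
  have h2 := A.le_opNorm (Pi.single i 1)
  rw [Pi.norm_single, norm_one, mul_one] at h2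
  exact h1.trans h2

lemma exists_tay (f : (Vc d) → Vc m) (x0 : Vc d) {R0 : ℝ} (hR0 : 0 < R0)
    (hf : ContDiffOn ℝ 2 f (Bl x0 R0)) :
    ∃ R1 : ℝ, 0 < R1 ∧ R1 ≤ R0 ∧ ∃ C, Tay f (DD f) C (Bl x0 R1) ∧
      ∀ x ∈ Bl x0 R1, ∀ i j, |DD f i j x| ≤ C := by
  have ho : IsOpen (Bl x0 R0) := Metric.isOpen_ball
  have h1 : ContDiffOn ℝ 1 (fderiv ℝ f) (Bl x0 R0) := hf.fderiv_of_isOpen ho (by norm_num)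
  obtain ⟨L, s, hs, hL⟩ := (h1.contDiffAt (ho.mem_nhds (Metric.mem_ball_self hR0))).exists_lipschitzOnWith
  obtain ⟨r1, hr1, hb⟩ := Metric.mem_nhds_iff.1 hs
  have hsub1 : Bl x0 (min R0 r1) ⊆ s := (Metric.ball_subset_ball (min_le_right _ _)).trans hb
  have hsub0 : Bl x0 (min R0 r1) ⊆ Bl x0 R0 := Metric.ball_subset_ball (min_le_left _ _)
  have hder : ∀ x ∈ Bl x0 (min R0 r1), HasFDerivAt f (fderiv ℝ f x) x := fun x hx =>
    ((hf.contDiffAt (ho.mem_nhds (hsub0 hx))).differentiableAt (by norm_num)).hasFDerivAt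
  have hLL : ∀ x ∈ Bl x0 (min R0 r1), ∀ y ∈ Bl x0 (min R0 r1), ‖fderiv ℝ f y - fderiv ℝ f x‖ ≤ L * ‖y - x‖ := by
    intro x hx y hy
    have := hL.dist_le_mul y (hsub1 hy) x (hsub1 hx)
    rwa [dist_eq_norm, dist_eq_norm] at this
  set C : ℝ := L + ‖fderiv ℝ f x0‖ + L * min R0 r1 with hC
  have hmin : 0 < min R0 r1 := lt_min hR0 hr1
  have hLC : (L : ℝ) ≤ C := by
    have : 0 ≤ L * min R0 r1 := by positivity
    have := norm_nonneg (fderiv ℝ f x0)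
    linarith
  refine ⟨min R0 r1, hmin, min_le_left _ _, C, ⟨by positivity, ?_, ?_, ?_, ?_⟩, ?_⟩
  · intro x hx y hy j
    rw [show ∑ i, DD f i j x * (y i - x i) = fderiv ℝ f x (y - x) j from DD_sum f j x (y - x)]
    have hseg : segment ℝ x y ⊆ Bl x0 (min R0 r1) := (convex_ball x0 _).segment_subset hx hy
    have := (convex_segment x y).norm_image_sub_le_of_norm_hasFDerivWithin_le' (f := f) (f' := fderiv ℝ f) (φ := fderiv ℝ f x) (C := L * ‖y - x‖)
      (fun w hw => (hder w (hseg hw)).hasFDerivWithinAt) (fun w hw => (hLL x hx w (hseg hw)).trans (by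
        gcongr
        exact norm_sub_le_of_mem_segment hw)) (left_mem_segment ℝ x y) (right_mem_segment ℝ x y)
    have h2 := norm_le_pi_norm (f y - f x - fderiv ℝ f x (y - x)) j
    simp only [Pi.sub_apply, Real.norm_eq_abs] at h2
    refine h2.trans (this.trans ?_)
    rw [pow_two, ← mul_assoc]
    gcongr
  · intro x hx y hy i j
    have := DD_lip f i j (fderiv ℝ f y - fderiv ℝ f x)
    refine (this.trans (hLL x hx y hy)).trans ?_
    gcongr
  · intro j
    exact (continuous_apply j).comp_continuousOn (hf.continuousOn.mono hsub0)
  · intro i j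
    have h2 := h1.continuousOn.mono hsub0
    exact (continuous_apply j).comp_continuousOn (h2.clm_apply continuousOn_const)
  · intro x hx i j
    refine (DD_lip f i j (fderiv ℝ f x)).trans ?_
    have h2 := hLL x0 (Metric.mem_ball_self hmin) x hx
    have h3 := norm_sub_norm_le (fderiv ℝ f x) (fderiv ℝ f x0)
    have h4 : L * ‖x - x0‖ ≤ L * min R0 r1 := by
      rw [Metric.mem_ball, dist_eq_norm] at hx
      gcongr
    have : (0 : ℝ) ≤ L := L.2
    linarith

lemma fullMap_castAdd (f : (Vc d) → Vc m) (x : Vc d) (i : Fin d) : fullMap d m f x (Fin.castAdd m i) = x i := by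
  simp [fullMap]

lemma fullMap_natAdd (f : (Vc d) → Vc m) (x : Vc d) (j : Fin m) : fullMap d m f x (Fin.natAdd d j) = f x j := by
  simp [fullMap]

lemma two_le_l (hm : 0 < m) {f : (Vc d) → Vc m} {x0 : Vc d} {l : ℕ}
    (h : Submodule.span ℝ {v : Vc (d + m) | ∃ β : List (Fin d),
        1 ≤ β.length ∧ β.length ≤ l ∧ v = listPDeriv β (fullMap d m f) x0} = ⊤) : 2 ≤ l := by
  by_contra hl
  have hsub : {v : Vc (d + m) | ∃ β : List (Fin d),
        1 ≤ β.length ∧ β.length ≤ l ∧ v = listPDeriv β (fullMap d m f) x0} ⊆ range (fun i : Fin d => listPDeriv [i] (fullMap d m f) x0) := by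
    rintro v ⟨β, h1, h2, rfl⟩
    obtain ⟨i, rfl⟩ := List.length_eq_one_iff.1 (by omega : β.length = 1)
    exact ⟨i, rfl⟩
  have h2 : Submodule.span ℝ (range (fun i : Fin d => listPDeriv [i] (fullMap d m f) x0)) = ⊤ := by
    rw [eq_top_iff, ← h]; exact Submodule.span_mono hsub
  have h3 := finrank_range_le_card (R := ℝ) (fun i : Fin d => listPDeriv [i] (fullMap d m f) x0)
  rw [Set.finrank, h2, finrank_top] at h3
  simp at h3
  omega

def mkA (am : Fin m → ℤ) (a : ℤ × (Fin d → ℤ)) : Fin (d + m + 1) → ℤ := Fin.cons a.1 (Fin.append a.2 am)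

lemma mkA_F (f : (Vc d) → Vc m) (am : Fin m → ℤ) (a : ℤ × (Fin d → ℤ)) (x : Vc d) :
    (fun j => (mkA am a j : ℝ)) ⬝ᵥ consOne (fullMap d m f) x = hA f am a x := by
  simp only [dotProduct, Fin.sum_univ_succ, Fin.sum_univ_add, mkA, consOne, Fin.cons_zero, Fin.cons_succ, Fin.append_left, Fin.append_right,
    fullMap_castAdd, fullMap_natAdd, hA]
  ring

lemma mkA_ne {am : Fin m → ℤ} {a : ℤ × (Fin d → ℤ)} (h : a ≠ 0 ∨ am ≠ 0) : mkA am a ≠ 0 := by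
  intro h0
  have h1 : a.1 = 0 := by have := congrFun h0 0; simpa [mkA] using this
  have h2 : a.2 = 0 := by
    funext i; have := congrFun h0 (Fin.castAdd m i).succ; simpa [mkA] using this
  have h3 : am = 0 := by
    funext i; have := congrFun h0 (Fin.natAdd d i).succ; simpa [mkA] using this
  rcases h with h | h
  · exact h (Prod.ext h1 h2)
  · exact h h3

lemma D_comp (f : (Vc d) → Vc m) {x : Vc d} (hF : DifferentiableAt ℝ (consOne (fullMap d m f)) x) (i : Fin d) :
    (∀ i', fderiv ℝ (consOne (fullMap d m f)) x (Pi.single i 1) (Fin.castAdd m i').succ = if i' = i then 1 else 0) ∧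
    ∀ j, fderiv ℝ (consOne (fullMap d m f)) x (Pi.single i 1) (Fin.natAdd d j).succ = DD f i j x := by
  have h1 := hasFDerivAt_pi'.1 hF.hasFDerivAt
  constructor
  · intro i'
    have h2 := h1 (Fin.castAdd m i').succ
    have e : (fun x => consOne (fullMap d m f) x (Fin.castAdd m i').succ) = fun x : Vc d => x i' := by
      funext y; simp [consOne, fullMap_castAdd]
    rw [e] at h2
    have h3 := h2.unique (hasFDerivAt_apply (𝕜 := ℝ) i' x)
    have h4 := congrArg (fun A : (Vc d) →L[ℝ] ℝ => A (Pi.single i 1)) h3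
    simpa [Pi.single_apply] using h4
  · intro j
    have h2 : HasFDerivAt f (ContinuousLinearMap.pi fun j => (ContinuousLinearMap.proj (Fin.natAdd d j).succ).comp (fderiv ℝ (consOne (fullMap d m f)) x)) x := by
      rw [hasFDerivAt_pi']
      intro j
      have h2 := h1 (Fin.natAdd d j).succ
      have e : (fun x => consOne (fullMap d m f) x (Fin.natAdd d j).succ) = fun x : Vc d => f x j := by
        funext y; simp [consOne, fullMap_natAdd]
      rw [e] at h2
      exact h2
    rw [DD, h2.fderiv]
    simp

lemma D_zero (g : (Vc d) → Vc m) (x v : Vc d) : fderiv ℝ (consOne g) x v 0 = 0 := by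
  by_cases hF : DifferentiableAt ℝ (consOne g) x
  · have h1 := hasFDerivAt_pi'.1 hF.hasFDerivAt 0
    have e : (fun x => consOne g x 0) = fun _ => 1 := by funext y; simp [consOne]
    rw [e] at h1
    have h3 := h1.unique (hasFDerivAt_const (𝕜 := ℝ) (1 : ℝ) x)
    have h4 := congrArg (fun A : (Vc d) →L[ℝ] ℝ => A v) h3
    simpa using h4
  · rw [fderiv_zero_of_not_differentiableAt hF]; simp

lemma mkA_D (f : (Vc d) → Vc m) {x : Vc d} (hF : DifferentiableAt ℝ (consOne (fullMap d m f)) x) (am : Fin m → ℤ) (a : ℤ × (Fin d → ℤ)) (i : Fin d) :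
    (fun j => (mkA am a j : ℝ)) ⬝ᵥ (fderiv ℝ (consOne (fullMap d m f)) x (Pi.single i 1)) = dA (DD f) am a i x := by
  simp only [dotProduct, Fin.sum_univ_succ, Fin.sum_univ_add, mkA, Fin.cons_zero, Fin.cons_succ, Fin.append_left, Fin.append_right,
    D_zero, (D_comp f hF i).1, (D_comp f hF i).2, dA]
  simp

def Bad (f : (Vc d) → Vc m) (Df : Fin d → Fin m → (Vc d) → ℝ) (z : Vc d) (r δ K T : ℝ) : Set (Vc d) :=
  {x | x ∈ Bl z r ∧ ∃ (am : Fin m → ℤ) (a : ℤ × (Fin d → ℤ)), (a ≠ 0 ∨ am ≠ 0) ∧ |hA f am a x| < δ ∧ (∀ i, |dA Df am a i x| < K) ∧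
    ∀ j, |(am j : ℝ)| < T}

theorem small_grad (hd : 0 < d) (hm : 0 < m) (f : (Vc d) → Vc m) (x0 : Vc d)
    (hnd : IsNondegenerateAt (fullMap d m f) x0) :
    ∃ R : ℝ, 0 < R ∧ ∃ C, Tay f (DD f) C (Bl x0 R) ∧ ∃ σ : ℝ, 0 < σ ∧ ∀ z r, 0 < r → dist z x0 + 20 ^ (d + m + 1) * r < R →
      ∃ δ0 : ℝ, 0 < δ0 ∧ ∀ δ K T : ℝ, 0 < δ → δ ≤ δ0 → 0 < K → 1 ≤ T → K ≤ T → δ * K * T ^ (d + m - 1) ≤ σ →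
        volume (Bad f (DD f) z r δ K T) ≤ eR (1 / 8) * volume (Bl z r) := by
  obtain ⟨l, R0, hR0, hcd, hspan, G, hG, hG0, hG1⟩ := exists_fam _ x0 hnd
  have hl := two_le_l hm hspan
  have hF := consOne_contDiffOn hcd
  obtain ⟨τ, hτ0, hτ1, hτ6, hτ8⟩ : ∃ τ : ℝ≥0∞, τ ≠ 0 ∧ τ < 1 ∧ τ * 6 ^ d < 1 ∧ KMA d (d + m + 1) * τ ≤ eR (1 / 8) := by
    have hne := KMA_ne_top d (d + m + 1)
    set k := KMA d (d + m + 1) with hk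
    have hden : k + 6 ^ d ≠ ⊤ := ENNReal.add_ne_top.2 ⟨hne, by simp⟩
    have hden0 : k + 6 ^ d ≠ 0 := by simp
    have h16 : eR (1 / 8) < 1 := by
      rw [← ENNReal.ofReal_one]; exact (ENNReal.ofReal_lt_ofReal_iff one_pos).2 (by norm_num)
    have hmul : eR (1 / 8) / (k + 6 ^ d) * (k + 6 ^ d) = eR (1 / 8) := ENNReal.div_mul_cancel hden0 hden
    have h6 : eR (1 / 8) / (k + 6 ^ d) * 6 ^ d ≤ eR (1 / 8) :=
      le_trans (by gcongr; exact le_add_self) hmul.le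
    refine ⟨eR (1 / 8) / (k + 6 ^ d), ?_, ?_, h6.trans_lt h16, ?_⟩
    · rw [ENNReal.div_ne_zero]; refine ⟨by simp, hden⟩
    · refine lt_of_le_of_lt ?_ h16
      refine le_trans ?_ h6
      exact le_mul_of_one_le_right' (one_le_pow₀ (by norm_num))
    · rw [mul_comm]
      exact le_trans (by gcongr; exact le_self_add) hmul.le
  obtain ⟨R, hR, hRR0, c, hc, hc1, hg1, hg2, hg3⟩ := good_family (by omega) hR0 hG τ hτ0 hτ1
  have hsub : Bl x0 R ⊆ Bl x0 R0 := Metric.ball_subset_ball hRR0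
  have hfd : ∀ x ∈ Bl x0 R, DifferentiableAt ℝ (consOne (fullMap d m f)) x := fun x hx =>
    (hF.contDiffAt (Metric.isOpen_ball.mem_nhds (hsub hx))).differentiableAt (by
      have : (l : ℕ) ≠ 0 := by omega
      exact_mod_cast this)
  have hfC2 : ContDiffOn ℝ 2 f (Bl x0 R) := by
    rw [contDiffOn_pi]
    intro j
    have h1 : ContDiffOn ℝ l (fun x => fullMap d m f x (Fin.natAdd d j)) (Bl x0 R) := contDiffOn_pi.1 (hcd.mono hsub) _
    simp only [fullMap_natAdd] at h1
    exact h1.of_le (by exact_mod_cast hl)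
  obtain ⟨R1, hR1, hR1R, C, hTay, hbd⟩ := exists_tay f x0 hR hfC2
  have hone : (1 : Fin (d + m + 1)) = (Fin.castAdd m ⟨0, hd⟩).succ := by
    ext
    simp
    omega
  obtain ⟨κ, hκ, hB⟩ := BKM (n := d + m) (by omega) ⟨0, hd⟩ hτ6 (G 0) (fun i => G (Finsupp.single i 1))
    (by intro x; rw [hG0]; simp [consOne]) (by intro i x; rw [hG1]; exact D_zero _ _ _)
    (by intro x hx; rw [hG1, hone]; simp only [(D_comp f (hfd x hx) _).1]; simp) hc hc1
    ((hG.hcont 0 (by simp)).mono hsub) (fun i => (hG.hcont _ (by simp; omega)).mono hsub) hg1 hg2 hg3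
  refine ⟨R1, hR1, C, hTay, ?_⟩
  have hC := hTay.hC
  set c1 : ℝ := 1 + m * C with hc1d
  have hc11 : 1 ≤ c1 := by rw [hc1d]; have : 0 ≤ m * C := by positivity
                           linarith
  refine ⟨κ / c1 ^ (d + m - 1), by positivity, ?_⟩
  intro z r hr hz
  obtain ⟨cB, hcB, hBB⟩ := hB z r hr (hz.trans_le hR1R)
  set L' : ℝ := max 1 (κ / cB) with hL'
  have hL1 : 1 ≤ L' := le_max_left _ _
  refine ⟨cB / (c1 * L') ^ (d + m), by positivity, ?_⟩
  intro δ K T hδ hδ0 hK hT hKT hσ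
  have hsubz : Bl z r ⊆ Bl x0 R1 := by
    intro x hx
    rw [Metric.mem_ball] at hx ⊢
    have : (1 : ℝ) ≤ 20 ^ (d + m + 1) := one_le_pow₀ (by norm_num)
    have := dist_triangle x z x0
    nlinarith
  have hT' : 1 ≤ c1 * T := by nlinarith
  have h1 : δ * K * (c1 * T) ^ (d + m - 1) ≤ κ := by
    rw [mul_pow]
    rw [le_div_iff₀ (by positivity)] at hσ
    linarith
  have hδL : δ * (c1 * L') ^ (d + m) ≤ cB := by rwa [le_div_iff₀ (by positivity)] at hδ0
  have hcL : 1 ≤ c1 * L' := by nlinarith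
  have h2 : δ ≤ cB := by
    refine le_trans ?_ hδL
    have : 1 ≤ (c1 * L') ^ (d + m) := one_le_pow₀ hcL
    nlinarith
  have h3 : δ * K * (c1 * T) ^ (d + m - 2) ≤ cB := by
    rcases le_total T L' with hTL | hTL
    · refine le_trans ?_ hδL
      have e : d + m = (d + m - 2) + 2 := by omega
      calc δ * K * (c1 * T) ^ (d + m - 2) ≤ δ * L' * (c1 * L') ^ (d + m - 2) := by
            gcongr; linarith
        _ ≤ δ * (c1 * L') ^ 2 * (c1 * L') ^ (d + m - 2) := by
            gcongr
            nlinarith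
        _ = δ * (c1 * L') ^ (d + m) := by
            conv_rhs => rw [e, pow_add]
            ring
    · have e : d + m - 1 = (d + m - 2) + 1 := by omega
      rw [e, pow_succ, ← mul_assoc] at h1
      have h4 : κ / cB ≤ c1 * T := (le_max_right _ _).trans (hTL.trans (by nlinarith))
      rw [div_le_iff₀ hcB] at h4
      have h5 : 0 < c1 * T := by positivity
      have h6 : δ * K * (c1 * T) ^ (d + m - 2) * (c1 * T) ≤ cB * (c1 * T) := by linarith
      exact le_of_mul_le_mul_right h6 h5
  have h4 := hBB δ K (c1 * T) hδ h2 hK hT' h3 h1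
  refine (measure_mono ?_).trans (h4.trans (by gcongr))
  rintro x ⟨hx, am, a, hne, ha1, ha2, ha3⟩
  have hx' := hsubz hx
  have hxR : x ∈ Bl x0 R := Metric.ball_subset_ball hR1R hx'
  refine ⟨hx, mkA am a, mkA_ne hne, ?_, ?_, ?_⟩
  · rw [hG0, mkA_F]; exact ha1
  · intro i
    rw [hG1]
    simp only
    rw [mkA_D f (hfd x hxR)]; exact ha2 i
  · intro k
    refine Fin.addCases (fun i => ?_) (fun j => ?_) k
    · simp only [mkA, Fin.cons_succ, Fin.append_left]
      have e : (a.2 i : ℝ) = dA (DD f) am a i x - ∑ j, (am j : ℝ) * DD f i j x := by simp [dA]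
      rw [e]
      refine lt_of_le_of_lt (abs_sub _ _) ?_
      have : |∑ j, (am j : ℝ) * DD f i j x| ≤ m * C * T := by
        refine (Finset.abs_sum_le_sum_abs _ _).trans ?_
        have : ∀ j ∈ Finset.univ, |(am j : ℝ) * DD f i j x| ≤ T * C := by
          intro j _
          rw [abs_mul]
          have := ha3 j
          have := hbd x hx' i j
          gcongr
        refine (Finset.sum_le_sum this).trans ?_
        simp
        apply le_of_eq; ring
      have := ha2 i
      rw [hc1d]
      linarith
    · simp only [mkA, Fin.cons_succ, Fin.append_right]
      refine (ha3 j).trans_le ?_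
      nlinarith

end Setup
section Setup2
variable {d m : ℕ}

lemma sq_le_four_two_pow (J : ℕ) : (J : ℝ) ^ 2 ≤ 4 * 2 ^ J := by
  induction J with
  | zero => simp
  | succ k ih =>
    by_cases hk : k ≤ 2
    · interval_cases k <;> norm_num
    · push Not at hk
      have : (3 : ℝ) ≤ k := by exact_mod_cast hk
      rw [pow_succ (2 : ℝ) k]; push_cast; nlinarith

theorem large_grad (hd : 0 < d) {f : (Vc d) → Vc m} {Df : Fin d → Fin m → (Vc d) → ℝ} {C R : ℝ} {x0 : Vc d}
    (h : Tay f Df C (Bl x0 R)) :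
    ∃ σ : ℝ, 0 < σ ∧ ∀ z r, 0 < r → dist z x0 + 2 * r ≤ R → ∃ L : ℝ, 1 ≤ L ∧ ∀ δ K T : ℝ, 0 < δ → δ ≤ r / 2 → 1 ≤ T → δ * T ≤ 1 / 2 →
      δ * T ^ (m + 1) ≤ σ → δ * T ^ m * K ^ d ≤ σ → L ≤ K →
        volume (BadD f Df z r δ T K) ≤ eR (1 / 8) * volume (Bl z r) := by
  have hC := h.hC
  have hCD : 0 ≤ CD d m C := by unfold CD; positivity
  set σ : ℝ := 1 / (16 * (CD d m C + 1) * (2 + 2 ^ d)) with hσ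
  have hσ0 : 0 < σ := by positivity
  refine ⟨σ, hσ0, ?_⟩
  intro z r hr hz
  have hCR : 0 ≤ CR d r := by unfold CR; positivity
  refine ⟨1 + (16 * CD d m C * CR d r * σ) ^ 2 * 8, by nlinarith [sq_nonneg (16 * CD d m C * CR d r * σ)], ?_⟩
  intro δ K T hδ hδr hT hδT h1 h2 hL
  have hK1 : 1 ≤ K := by nlinarith [sq_nonneg (16 * CD d m C * CR d r * σ)]
  have hK0 : 0 < K := by linarith
  have hTay := h.mono (S' := Bl z (2 * r)) (by
    intro x hx
    rw [Metric.mem_ball] at hx ⊢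
    have := dist_triangle x z x0
    linarith)
  obtain ⟨j, hj1, hj2⟩ := exists_nat_pow_near hK1 (by norm_num : (1 : ℝ) < 2)
  have hB := BadD_le hd hr hTay hδ hT (by nlinarith) hδr (by
    rw [div_div, le_div_iff₀ (by positivity)]; linarith) (j + 1) hj2.le
  refine hB.trans ?_
  gcongr eR ?_ * _
  set J := j + 1 with hJ
  have hJ2 : (2 : ℝ) ^ J ≤ 2 * K := by rw [hJ, pow_succ]; linarith
  have e : CD d m C * (δ * T ^ m) * (2 * T + (2 ^ J) ^ d + CR d r * J) =
      CD d m C * (2 * (δ * T ^ (m + 1)) + δ * T ^ m * (2 ^ J) ^ d) + CD d m C * CR d r * (δ * T ^ m * J) := by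
    rw [pow_succ]; ring
  rw [e]
  have t1 : CD d m C * (2 * (δ * T ^ (m + 1)) + δ * T ^ m * (2 ^ J) ^ d) ≤ 1 / 16 := by
    have : δ * T ^ m * (2 ^ J) ^ d ≤ 2 ^ d * σ := by
      calc δ * T ^ m * (2 ^ J) ^ d ≤ δ * T ^ m * (2 * K) ^ d := by gcongr
        _ = 2 ^ d * (δ * T ^ m * K ^ d) := by rw [mul_pow]; ring
        _ ≤ _ := by gcongr
    calc CD d m C * (2 * (δ * T ^ (m + 1)) + δ * T ^ m * (2 ^ J) ^ d) ≤ (CD d m C + 1) * (2 * σ + 2 ^ d * σ) := by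
          gcongr; linarith
      _ = 1 / 16 := by rw [hσ]; field_simp
  have t2 : CD d m C * CR d r * (δ * T ^ m * J) ≤ 1 / 16 := by
    have hKd : K ≤ K ^ d := le_self_pow₀ hK1 hd.ne'
    have a1 : δ * T ^ m * K ≤ σ := le_trans (by gcongr) h2
    have a2 : δ * T ^ m * J ≤ σ * (J / K) := by
      rw [mul_div_assoc', le_div_iff₀ hK0]
      calc δ * T ^ m * J * K = (δ * T ^ m * K) * J := by ring
        _ ≤ σ * J := by gcongr
    have a3 : ((J : ℝ) / K) ^ 2 * K ≤ 8 := by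
      have := sq_le_four_two_pow J
      rw [div_pow, div_mul_eq_mul_div, div_le_iff₀ (by positivity)]
      nlinarith
    set P := CD d m C * CR d r * σ with hP
    have hP0 : 0 ≤ P := by positivity
    have a4 : (P * (J / K)) ^ 2 ≤ (1 / 16) ^ 2 := by
      have hL' : (16 * P) ^ 2 * 8 ≤ K := by
        have : 16 * CD d m C * CR d r * σ = 16 * P := by rw [hP]; ring
        rw [this] at hL; linarith
      have h5 : (16 * P) ^ 2 * 8 * ((J : ℝ) / K) ^ 2 ≤ K * ((J : ℝ) / K) ^ 2 := by gcongr
      nlinarith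
    have a5 : P * (J / K) ≤ 1 / 16 := by
      have : 0 ≤ P * (J / K) := by positivity
      nlinarith
    calc _ ≤ CD d m C * CR d r * (σ * (J / K)) := by gcongr
      _ = P * (J / K) := by rw [hP]; ring
      _ ≤ _ := a5
  linarith

lemma bad_split (f : (Vc d) → Vc m) (Df : Fin d → Fin m → (Vc d) → ℝ) (z : Vc d) (r δ K T : ℝ) :
    Bad f Df z r δ K T ⊆ Bad f Df z r δ 1 T ∪ BadD f Df z r δ T K := by
  rintro x ⟨hx, am, a, hne, h1, h2, h3⟩
  by_cases hs : ∀ i, |dA Df am a i x| < 1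
  · exact Or.inl ⟨hx, am, a, hne, h1, hs, h3⟩
  · push Not at hs
    exact Or.inr ⟨hx, am, fun j => (h3 j).le, a, h1, hs, h2⟩

noncomputable def TM (x : Vc d) (fx : Vc m) (Dx : Fin d → Vc m) (δ K T : ℝ) :
    Matrix (Unit ⊕ (Fin d ⊕ Fin m)) (Unit ⊕ (Fin d ⊕ Fin m)) ℝ :=
  Matrix.of (Sum.elim (fun _ => Sum.elim (fun _ => 1 / δ) (Sum.elim (fun i => x i / δ) (fun j => fx j / δ)))
    (Sum.elim (fun i => Sum.elim (fun _ => 0) (Sum.elim (fun i' => if i = i' then 1 / K else 0) (fun j => Dx i j / K)))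
      (fun j => Sum.elim (fun _ => 0) (Sum.elim (fun _ => 0) (fun j' => if j = j' then 1 / T else 0)))))

lemma point {f : (Vc d) → Vc m} {Df : Fin d → Fin m → (Vc d) → ℝ} {z : Vc d} {r δ K T : ℝ}
    (hδ : 0 < δ) (hK : 0 < K) (hT : 0 < T) {x : Vc d} (hx : x ∈ Bl z r) (hbad : x ∉ Bad f Df z r δ K T)
    (Q : ℝ) (θd : Vc d) (θm : Vc m) :
    ∃ (q : ℤ) (pd : Fin d → ℤ) (pm : Fin m → ℤ), |q - Q| ≤ 2 ^ (d + m + 1) / δ ∧ (∀ i, |pd i + θd i - q * x i| ≤ 2 ^ (d + m + 1) / K) ∧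
      ∀ j, |q * f x j + ∑ i, Df i j x * (pd i + θd i - q * x i) - θm j - pm j| ≤ 2 ^ (d + m + 1) / T := by
  set M := TM x (f x) (fun i j => Df i j x) δ K T with hM
  have r0 : ∀ b, M.mulVec b (Sum.inl ()) = (b (Sum.inl ()) + ∑ i, b (Sum.inr (Sum.inl i)) * x i + ∑ j, b (Sum.inr (Sum.inr j)) * f x j) / δ := by
    intro b
    simp only [Matrix.mulVec, dotProduct, Fintype.sum_sum_type, hM, TM, Matrix.of_apply, Sum.elim_inl, Sum.elim_inr, Finset.univ_unique, Finset.sum_singleton]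
    rw [add_div, add_div, Finset.sum_div, Finset.sum_div, add_assoc]
    congr 1
    · simp; ring
    · congr 1 <;> exact Finset.sum_congr rfl fun _ _ => by ring
  have r1 : ∀ b i, M.mulVec b (Sum.inr (Sum.inl i)) = (b (Sum.inr (Sum.inl i)) + ∑ j, b (Sum.inr (Sum.inr j)) * Df i j x) / K := by
    intro b i
    simp only [Matrix.mulVec, dotProduct, Fintype.sum_sum_type, hM, TM, Matrix.of_apply, Sum.elim_inl, Sum.elim_inr, Finset.univ_unique, Finset.sum_singleton]
    rw [add_div, Finset.sum_div]
    simp only [zero_mul, zero_add, ite_mul, Finset.sum_ite_eq, Finset.mem_univ, if_true]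
    congr 1
    · ring
    · exact Finset.sum_congr rfl fun _ _ => by ring
  have r2 : ∀ b j, M.mulVec b (Sum.inr (Sum.inr j)) = b (Sum.inr (Sum.inr j)) / T := by
    intro b j
    simp only [Matrix.mulVec, dotProduct, Fintype.sum_sum_type, hM, TM, Matrix.of_apply, Sum.elim_inl, Sum.elim_inr, Finset.univ_unique, Finset.sum_singleton]
    simp only [zero_mul, zero_add, ite_mul, Finset.sum_ite_eq, Finset.mem_univ, if_true, Finset.sum_const_zero]
    ring
  obtain ⟨w, u, huw, hu⟩ := transference M (by
      intro b hb
      have hj : ∀ j, b (Sum.inr (Sum.inr j)) = 0 := by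
        intro j
        have := congrFun hb (Sum.inr (Sum.inr j))
        rw [r2] at this
        simpa [hT.ne'] using this
      have hi : ∀ i, b (Sum.inr (Sum.inl i)) = 0 := by
        intro i
        have := congrFun hb (Sum.inr (Sum.inl i))
        rw [r1] at this
        simpa [hK.ne', hj] using this
      have h0 : b (Sum.inl ()) = 0 := by
        have := congrFun hb (Sum.inl ())
        rw [r0] at this
        simpa [hδ.ne', hj, hi] using this
      funext k
      rcases k with ⟨⟩ | i | j
      · exact h0
      · exact hi i
      · exact hj j) (by
      intro a ha
      by_contra hcon
      push Not at hcon
      apply hbad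
      refine ⟨hx, fun j => a (Sum.inr (Sum.inr j)), (a (Sum.inl ()), fun i => a (Sum.inr (Sum.inl i))), ?_, ?_, ?_, ?_⟩
      · by_contra hn
        push Not at hn
        apply ha
        funext k
        have hn1 := (Prod.ext_iff.1 hn.1)
        rcases k with ⟨⟩ | i | j
        · exact hn1.1
        · exact congrFun hn1.2 i
        · exact congrFun hn.2 j
      · have := hcon (Sum.inl ())
        rw [r0, abs_div, abs_of_pos hδ, div_lt_one hδ] at this
        exact this
      · intro i
        have := hcon (Sum.inr (Sum.inl i))
        rw [r1, abs_div, abs_of_pos hK, div_lt_one hK] at this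
        exact this
      · intro j
        have := hcon (Sum.inr (Sum.inr j))
        rw [r2, abs_div, abs_of_pos hT, div_lt_one hT] at this
        exact this)
    (Sum.elim (fun _ => δ * Q) (Sum.elim (fun i => -(K * θd i)) (fun j => T * (-θm j + ∑ i, θd i * Df i j x))))
  have hcard : Fintype.card (Unit ⊕ (Fin d ⊕ Fin m)) = d + m + 1 := by simp; omega
  rw [hcard] at hu
  have c0 : u (Sum.inl ()) / δ = w (Sum.inl ()) := by
    have := congrFun huw (Sum.inl ())
    simp only [Matrix.vecMul, dotProduct, Fintype.sum_sum_type, hM, TM, Matrix.of_apply, Sum.elim_inl, Sum.elim_inr, Finset.univ_unique, Finset.sum_singleton] at this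
    rw [← this]
    simp
    ring
  have c1 : ∀ i, w (Sum.inl ()) * x i + u (Sum.inr (Sum.inl i)) / K = w (Sum.inr (Sum.inl i)) := by
    intro i
    have := congrFun huw (Sum.inr (Sum.inl i))
    simp only [Matrix.vecMul, dotProduct, Fintype.sum_sum_type, hM, TM, Matrix.of_apply, Sum.elim_inl, Sum.elim_inr, Finset.univ_unique, Finset.sum_singleton] at this
    rw [← this, ← c0]
    simp
    ring
  have c2 : ∀ j, w (Sum.inl ()) * f x j + ∑ i, Df i j x * (u (Sum.inr (Sum.inl i)) / K) + u (Sum.inr (Sum.inr j)) / T = w (Sum.inr (Sum.inr j)) := by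
    intro j
    have := congrFun huw (Sum.inr (Sum.inr j))
    simp only [Matrix.vecMul, dotProduct, Fintype.sum_sum_type, hM, TM, Matrix.of_apply, Sum.elim_inl, Sum.elim_inr, Finset.univ_unique, Finset.sum_singleton] at this
    rw [← this, ← c0, add_assoc]
    congr 1
    · simp; ring
    · congr 1
      · exact Finset.sum_congr rfl fun _ _ => by ring
      · simp; ring
  refine ⟨w (Sum.inl ()), fun i => w (Sum.inr (Sum.inl i)), fun j => w (Sum.inr (Sum.inr j)), ?_, ?_, ?_⟩
  · have := hu (Sum.inl ())
    simp only [Sum.elim_inl] at this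
    have e : u (Sum.inl ()) / δ - Q = (u (Sum.inl ()) - δ * Q) / δ := by field_simp
    rw [← c0, e, abs_div, abs_of_pos hδ]
    gcongr
  · intro i
    have := hu (Sum.inr (Sum.inl i))
    simp only [Sum.elim_inl, Sum.elim_inr] at this
    have e : w (Sum.inl ()) * x i + u (Sum.inr (Sum.inl i)) / K + θd i - w (Sum.inl ()) * x i = (u (Sum.inr (Sum.inl i)) - -(K * θd i)) / K := by
      field_simp; ring
    rw [← c1, e, abs_div, abs_of_pos hK]
    gcongr
  · intro j
    have := hu (Sum.inr (Sum.inr j))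
    simp only [Sum.elim_inr] at this
    have e : w (Sum.inl ()) * f x j + ∑ i, Df i j x * (w (Sum.inr (Sum.inl i)) + θd i - w (Sum.inl ()) * x i) - θm j - w (Sum.inr (Sum.inr j)) =
        -((u (Sum.inr (Sum.inr j)) - T * (-θm j + ∑ i, θd i * Df i j x)) / T) := by
      rw [← c2 j]
      have e2 : ∑ i, Df i j x * ((w (Sum.inr (Sum.inl i)) : ℝ) + θd i - w (Sum.inl ()) * x i) =
          ∑ i, Df i j x * (u (Sum.inr (Sum.inl i)) / K) + ∑ i, θd i * Df i j x := by
        rw [← Finset.sum_add_distrib]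
        refine Finset.sum_congr rfl fun i _ => ?_
        rw [← c1 i]; ring
      rw [e2]
      field_simp
      ring
    rw [e, abs_neg, abs_div, abs_of_pos hT]
    gcongr

end Setup2
section Final
variable {d m : ℕ}

lemma pw {K0 ε η t : ℝ} (hK0 : 1 ≤ K0) (ht : 0 ≤ t) (h : K0 * Real.exp (-η * t) < ε) {k s : ℕ} (hk : 1 ≤ k) (hs : η * k ≤ s) :
    K0 ≤ ε ^ k * Real.exp t ^ s := by
  have h0 : 0 ≤ K0 * Real.exp (-η * t) := by positivity
  have h1 : (K0 * Real.exp (-η * t)) ^ k ≤ ε ^ k := pow_le_pow_left₀ h0 h.le k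
  have h2 : K0 ≤ K0 ^ k := le_self_pow₀ hK0 (by omega)
  have h3 : 1 ≤ Real.exp (-η * t) ^ k * Real.exp t ^ s := by
    rw [← Real.exp_nat_mul, ← Real.exp_nat_mul, ← Real.exp_add]
    apply Real.one_le_exp
    nlinarith
  calc K0 ≤ K0 ^ k * 1 := by linarith
    _ ≤ K0 ^ k * (Real.exp (-η * t) ^ k * Real.exp t ^ s) := by gcongr
    _ = (K0 * Real.exp (-η * t)) ^ k * Real.exp t ^ s := by rw [mul_pow]; ring
    _ ≤ _ := by gcongr

lemma eta_le_one (hd : 0 < d) (hm : 0 < m) : etaND (d + m) d * (1 : ℕ) ≤ (1 : ℕ) := by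
  have hd' : (1 : ℝ) ≤ d := by exact_mod_cast hd
  have hm' : (1 : ℝ) ≤ m := by exact_mod_cast hm
  unfold etaND
  push_cast
  split_ifs with h
  · rw [mul_one, div_le_one (by linarith)]
    have : (2 : ℝ) ≤ d := by exact_mod_cast h
    linarith
  · rw [mul_one, div_le_one (by linarith)]
    linarith

lemma eta_n (hd : 1 < d) : etaND (d + m) d * (d + m - 1 : ℕ) ≤ (1 : ℕ) := by
  have hd' : (2 : ℝ) ≤ d := by exact_mod_cast hd
  have hm' : (0 : ℝ) ≤ m := by positivity
  unfold etaND
  rw [if_pos hd, Nat.cast_sub (by omega)]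
  push_cast
  rw [div_mul_cancel₀ _ (by linarith)]

lemma eta_c (hd : 0 < d) (hm : 0 < m) : etaND (d + m) d * (2 * m + d : ℕ) ≤ (d + 2 : ℕ) := by
  have hm' : (1 : ℝ) ≤ m := by exact_mod_cast hm
  unfold etaND
  push_cast
  split_ifs with h
  · have : (2 : ℝ) ≤ d := by exact_mod_cast h
    rw [div_mul_eq_mul_div, div_le_iff₀ (by linarith)]
    nlinarith
  · have : d = 1 := by omega
    subst this
    push_cast
    rw [div_mul_eq_mul_div, div_le_iff₀ (by linarith)]
    nlinarith

lemma KE_lower (hd : 0 < d) {K κ ε E K0 G : ℝ} (hκ : 0 < κ) (hε : 0 < ε) (hE : 0 < E) (hK : 0 < K) (hKd : K ^ d = κ ^ d * (ε ^ m * E))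
    (hG : 0 < G) (hGK : G ^ d ≤ K0) (hc : K0 ≤ ε ^ (2 * m + d) * E ^ (d + 2)) :
    κ ^ 2 * G * E ≤ (K * E) ^ 2 * ε := by
  refine le_of_pow_le_pow_left₀ hd.ne' (by positivity) ?_
  calc (κ ^ 2 * G * E) ^ d = κ ^ (2 * d) * E ^ d * G ^ d := by rw [mul_pow, mul_pow, ← pow_mul]; ring
    _ ≤ κ ^ (2 * d) * E ^ d * (ε ^ (2 * m + d) * E ^ (d + 2)) := by gcongr; exact hGK.trans hc
    _ = (κ ^ d * (ε ^ m * E)) ^ 2 * E ^ (2 * d) * ε ^ d := by ring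
    _ = _ := by rw [← hKd]; ring

lemma rho_eq (hd : 0 < d) {K κ ε t N : ℝ} (hκ : 0 < κ) (hε : 0 < ε) (hN : 0 < N) (hK : 0 < K) (hKd : K ^ d = κ ^ d * (ε ^ m * Real.exp t)) :
    ((3 * N / κ) ^ d / (ε ^ m * Real.exp (((d : ℝ) + 1) * t))) ^ ((1 : ℝ) / d) = 3 * N / (K * Real.exp t) := by
  have hE := Real.exp_pos t
  have e : (3 * N / κ) ^ d / (ε ^ m * Real.exp (((d : ℝ) + 1) * t)) = (3 * N / (K * Real.exp t)) ^ d := by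
    have : Real.exp (((d : ℝ) + 1) * t) = Real.exp t ^ (d + 1) := by
      rw [← Real.exp_nat_mul]; push_cast; rfl
    rw [this, div_pow, div_pow (3 * N) (K * Real.exp t), mul_pow K, hKd]
    field_simp
    ring
  rw [e, one_div, Real.pow_rpow_inv_natCast (by positivity) hd.ne']

lemma vol_shrink (hd : 0 < d) {z : Vc d} {r ρ : ℝ} (hr : 0 < r) (hρ : 0 < ρ) (h : 4 * d * ρ ≤ r) :
    eR (3 / 4) * volume (Bl z r) ≤ volume (Bl z (r - ρ)) := by
  have hd' : (1 : ℝ) ≤ d := by exact_mod_cast hd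
  have h1 : ρ < r := by nlinarith
  rw [Real.volume_pi_ball _ hr, Real.volume_pi_ball _ (by linarith), ← ENNReal.ofReal_mul (by norm_num)]
  apply ENNReal.ofReal_le_ofReal
  simp only [Fintype.card_fin]
  have h2 : ρ / r ≤ 1 / (4 * d) := by
    rw [div_le_div_iff₀ hr (by linarith)]; linarith
  have h3 := one_add_mul_le_pow (a := -(ρ / r)) (by
    have : ρ / r < 1 := by rw [div_lt_one hr]; exact h1
    linarith) d
  have h4 : (d : ℝ) * (ρ / r) ≤ 1 / 4 := by
    calc (d : ℝ) * (ρ / r) ≤ d * (1 / (4 * d)) := by gcongr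
      _ = 1 / 4 := by field_simp
  calc 3 / 4 * (2 * r) ^ d ≤ (1 + -(ρ / r)) ^ d * (2 * r) ^ d := by gcongr; linarith
    _ = (2 * (r - ρ)) ^ d := by rw [← mul_pow]; congr 1; field_simp; ring

lemma cover {f : (Vc d) → Vc m} {Df : Fin d → Fin m → (Vc d) → ℝ} {C : ℝ} {z : Vc d} {r : ℝ}
    (h : Tay f Df C (Bl z r)) (θ : Vc (d + m)) {t : ℕ} {K ε ρ N : ℝ} (hN : N = 2 ^ (d + m + 1)) (hε : 0 < ε) (hK : 0 < K)
    (hρ : ρ = 3 * N / (K * Real.exp t)) (hCρ : Real.exp t * (C * ρ ^ 2) ≤ ε / 2)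
    {x : Vc d} (hx : x ∈ Bl z (r - ρ)) (hbad : x ∉ Bad f Df z r (4 * N / Real.exp t) K (4 * N / ε)) :
    x ∈ DeltaCal f θ t ε (Bl z r) ρ := by
  have hN0 : 0 < N := by rw [hN]; positivity
  have hE := Real.exp_pos (t : ℝ)
  have hρ0 : 0 < ρ := by rw [hρ]; positivity
  have hC := h.hC
  have hxr : x ∈ Bl z r := Metric.ball_subset_ball (by linarith) hx
  obtain ⟨q, pd, pm, h1, h2, h3⟩ := point (f := f) (Df := Df) (by positivity) hK (by positivity) hxr hbad
    ((Real.exp t / Real.exp 1 + Real.exp t) / 2) (fun i => θ (Fin.castAdd m i)) (fun j => θ (Fin.natAdd d j))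
  rw [← hN] at h1 h2 h3
  have he1 : 2.7182818283 < Real.exp 1 := Real.exp_one_gt_d9
  have he2 : Real.exp 1 < 3 := Real.exp_one_lt_three
  set E := Real.exp (t : ℝ) with hEdef
  have hEe : Real.exp ((t : ℝ) - 1) = E / Real.exp 1 := Real.exp_sub _ _
  have hEe2 : E / Real.exp 1 ≤ E / 2 := by gcongr; linarith
  have hEe3 : E / 3 < E / Real.exp 1 := by gcongr
  have e1 : N / (4 * N / E) = E / 4 := by field_simp
  rw [e1, abs_le] at h1
  have hq1 : E / Real.exp 1 ≤ q := by linarith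
  have hq2 : (q : ℝ) ≤ E := by linarith
  have hq0 : (0 : ℝ) < q := by linarith [div_pos hE (Real.exp_pos 1)]
  have hq0' : 0 < q := by exact_mod_cast hq0
  obtain ⟨Q, rfl⟩ := Int.eq_ofNat_of_zero_le hq0'.le
  simp only [Int.cast_natCast] at *
  set c : Vc d := fun i => ((pd i : ℝ) + θ (Fin.castAdd m i)) / (Q : ℝ) with hc
  have hcq : ∀ i, (pd i : ℝ) + θ (Fin.castAdd m i) - Q * x i = Q * (c i - x i) := by
    intro i; rw [hc]; field_simp
  have hdist : dist c x < ρ := by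
    rw [dist_pi_lt_iff hρ0]
    intro i
    rw [Real.dist_eq]
    have := h2 i
    rw [hcq i, abs_mul, abs_of_pos hq0] at this
    have h5 : Q * |c i - x i| < Q * ρ := by
      refine this.trans_lt ?_
      calc N / K = E / 3 * ρ := by rw [hρ]; field_simp
        _ < Q * ρ := by gcongr; linarith
    exact lt_of_mul_lt_mul_left h5 hq0.le
  have hcB : c ∈ Bl z r := by
    rw [Metric.mem_ball] at hx ⊢
    linarith [dist_triangle c x z]
  unfold DeltaCal
  rw [mem_iUnion₂]
  refine ⟨(Q, pd, pm), ?_, ?_⟩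
  · refine ⟨by exact_mod_cast hq0', hcB, by rw [hEe]; exact hq1, hq2, ?_⟩
    rw [pi_norm_le_iff_of_nonneg hε.le]
    intro j
    rw [Real.norm_eq_abs]
    have h4 := h.hT x hxr c hcB j
    have h5 := h3 j
    simp only [hcq] at h5
    have e2 : N / (4 * N / ε) = ε / 4 := by field_simp
    rw [e2] at h5
    have hn : ‖c - x‖ ≤ ρ := by rw [← dist_eq_norm]; exact hdist.le
    have h6 : |(Q : ℝ) * (f c j - f x j - ∑ i, Df i j x * (c i - x i))| ≤ ε / 2 := by
      rw [abs_mul, abs_of_pos hq0]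
      calc Q * |f c j - f x j - ∑ i, Df i j x * (c i - x i)| ≤ E * (C * ρ ^ 2) := by
            gcongr
            exact h4.trans (by gcongr)
        _ ≤ _ := hCρ
    have e3 : ∑ i, Df i j x * (Q * (c i - x i)) = Q * ∑ i, Df i j x * (c i - x i) := by
      rw [Finset.mul_sum]; exact Finset.sum_congr rfl fun _ _ => by ring
    rw [e3] at h5
    have e4 : (Q : ℝ) * f c j - θ (Fin.natAdd d j) - pm j = Q * (f c j - f x j - ∑ i, Df i j x * (c i - x i)) +
        (Q * f x j + Q * ∑ i, Df i j x * (c i - x i) - θ (Fin.natAdd d j) - pm j) := by ring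
    show |(Q : ℝ) * f c j - θ (Fin.natAdd d j) - pm j| ≤ ε
    rw [e4]
    refine (abs_add_le _ _).trans ?_
    linarith
  · rw [Metric.mem_ball, dist_comm]; exact hdist

end Final
section Final2
variable {d m : ℕ}

lemma bad_meas (hd : 0 < d) (hm : 0 < m) {f : (Vc d) → Vc m} {Df : Fin d → Fin m → (Vc d) → ℝ} {z : Vc d}
    {r σ σ1 σ2 δ0 L A E ε κ K K0 : ℝ}
    (hS : ∀ δ K T : ℝ, 0 < δ → δ ≤ δ0 → 0 < K → 1 ≤ T → K ≤ T → δ * K * T ^ (d + m - 1) ≤ σ1 →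
      volume (Bad f Df z r δ K T) ≤ eR (1 / 8) * volume (Bl z r))
    (hLg : ∀ δ K T : ℝ, 0 < δ → δ ≤ r / 2 → 1 ≤ T → δ * T ≤ 1 / 2 →
      δ * T ^ (m + 1) ≤ σ2 → δ * T ^ m * K ^ d ≤ σ2 → L ≤ K →
        volume (BadD f Df z r δ T K) ≤ eR (1 / 8) * volume (Bl z r))
    (hr : 0 < r) (hδ0 : 0 < δ0) (hσ : 0 < σ) (hσ1 : σ ≤ σ1) (hσ2 : σ ≤ σ2) (hσ3 : σ ≤ 1) (hA : 1 ≤ A) (hE : 1 ≤ E) (hε : 0 < ε) (hε1 : ε < 1)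
    (hκ : κ = σ / A ^ (m + 1)) (hK : 0 < K) (hKd : K ^ d = κ ^ d * (ε ^ m * E)) (hL : 1 ≤ L)
    (h1 : K0 ≤ ε * E) (h2 : 1 < d → K0 ≤ ε ^ (d + m - 1) * E) (k1 : 2 * A ^ 2 ≤ K0) (k2 : A ^ (d + m) / σ ≤ K0)
    (t1 : A / δ0 ≤ E) (t2 : 2 * A / r ≤ E) (t3 : (L / κ) ^ (d * (m + 1)) < E) :
    volume (Bad f Df z r (A / E) K (A / ε)) ≤ eR (1 / 4) * volume (Bl z r) := by
  have hA0 : 0 < A := by linarith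
  have hE0 : 0 < E := by linarith
  have hκ0 : 0 < κ := by rw [hκ]; positivity
  have hκ1 : κ ≤ 1 := by
    rw [hκ, div_le_one (by positivity)]
    exact hσ3.trans (one_le_pow₀ hA)
  have hδ : 0 < A / E := by positivity
  have hδ1 : A / E ≤ δ0 := by rw [div_le_iff₀ hδ0] at t1; rw [div_le_iff₀ hE0]; linarith
  have hδ2 : A / E ≤ r / 2 := by rw [div_le_iff₀ hr] at t2; rw [div_le_iff₀ hE0]; linarith
  have hT : 1 ≤ A / ε := by rw [le_div_iff₀ hε]; linarith
  have hT0 : 0 < A / ε := by linarith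
  have hδT : A / E * (A / ε) ≤ 1 / 2 := by
    rw [div_mul_div_comm, div_le_iff₀ (by positivity)]
    nlinarith
  have hKT : A / E * (A / ε) ^ m * K ^ d ≤ σ := by
    have : A / E * (A / ε) ^ m * K ^ d = A ^ (m + 1) * κ ^ d := by
      rw [hKd, div_pow]; field_simp; ring
    rw [this]
    calc A ^ (m + 1) * κ ^ d ≤ A ^ (m + 1) * κ := by
          gcongr; exact pow_le_of_le_one hκ0.le hκ1 hd.ne'
      _ = σ := by rw [hκ]; field_simp
  have h48 : eR (1 / 8) * volume (Bl z r) + eR (1 / 8) * volume (Bl z r) =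
      eR (1 / 4) * volume (Bl z r) := by
    rw [← add_mul, ← ENNReal.ofReal_add (by norm_num) (by norm_num)]; norm_num
  by_cases hcase : 1 < d ∨ A / ε ≤ K
  · have hb : A / E * (A / ε) ^ (d + m - 1) ≤ σ ∧ A / E * (A / ε) ^ (m + 1) ≤ σ := by
      by_cases hd1 : 1 < d
      · have h3 : A / E * (A / ε) ^ (d + m - 1) ≤ σ := by
          have h4 := k2.trans (h2 hd1)
          rw [div_le_iff₀ hσ] at h4
          rw [div_pow, div_mul_div_comm, ← pow_succ', Nat.sub_add_cancel (by omega), div_le_iff₀ (by positivity)]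
          linarith
        refine ⟨h3, le_trans ?_ h3⟩
        exact mul_le_mul_of_nonneg_left (pow_le_pow_right₀ hT (by omega)) hδ.le
      · have hTK : A / ε ≤ K := hcase.resolve_left hd1
        have hd2 : d = 1 := by omega
        subst hd2
        rw [pow_one] at hKT
        have e : 1 + m - 1 = m := by omega
        rw [e]
        constructor
        · refine le_trans ?_ hKT
          have : 1 ≤ K := hT.trans hTK
          exact le_mul_of_one_le_right (by positivity) this
        · refine le_trans ?_ hKT
          rw [pow_succ, ← mul_assoc]
          gcongr
    have hLK : L ≤ K := by
      by_contra hlt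
      push Not at hlt
      have a1 : K ^ d * (A / ε) ^ m = κ ^ d * A ^ m * E := by rw [hKd, div_pow]; field_simp
      have a2 : (A / ε) ^ (m + 1) ≤ E := by
        have := hb.2
        rw [div_mul_eq_mul_div, div_le_iff₀ hE0] at this
        calc (A / ε) ^ (m + 1) ≤ A * (A / ε) ^ (m + 1) := le_mul_of_one_le_left (by positivity) hA
          _ ≤ σ * E := this
          _ ≤ E := mul_le_of_le_one_left hE0.le hσ3
      have a3 : (κ ^ d * A ^ m * E) ^ (m + 1) ≤ L ^ (d * (m + 1)) * E ^ m := by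
        rw [← a1]
        calc (K ^ d * (A / ε) ^ m) ^ (m + 1) = K ^ (d * (m + 1)) * ((A / ε) ^ (m + 1)) ^ m := by
              rw [mul_pow, ← pow_mul, ← pow_mul, ← pow_mul, mul_comm m (m + 1)]
          _ ≤ _ := by gcongr
      have a4 : κ ^ (d * (m + 1)) * E * E ^ m ≤ L ^ (d * (m + 1)) * E ^ m := by
        refine le_trans ?_ a3
        rw [mul_pow, mul_pow, ← pow_mul, pow_succ E m]
        have : 1 ≤ (A ^ m) ^ (m + 1) := one_le_pow₀ (one_le_pow₀ hA)
        calc κ ^ (d * (m + 1)) * E * E ^ m = κ ^ (d * (m + 1)) * 1 * (E ^ m * E) := by ring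
          _ ≤ _ := by gcongr
      have a5 := le_of_mul_le_mul_right a4 (by positivity)
      rw [div_pow, div_lt_iff₀ (by positivity)] at t3
      linarith
    refine (measure_mono (bad_split _ _ _ _ _ _ _)).trans ((measure_union_le _ _).trans ?_)
    rw [← h48]
    refine add_le_add (hS _ _ _ hδ hδ1 one_pos hT hT ?_) (hLg _ _ _ hδ hδ2 hT hδT (hb.2.trans hσ2) (hKT.trans hσ2) hLK)
    rw [mul_one]; exact hb.1.trans hσ1
  · push Not at hcase
    have hd2 : d = 1 := by omega
    subst hd2
    refine (hS _ _ _ hδ hδ1 hK hT hcase.2.le ?_).trans ?_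
    · have e : 1 + m - 1 = m := by omega
      rw [e]
      rw [pow_one] at hKT
      refine le_trans (le_of_eq ?_) (hKT.trans hσ1)
      ring
    · rw [← h48]; exact le_self_add

end Final2
set_option maxHeartbeats 1000000 in
theorem main_aux
    {d m : ℕ} (hd : 0 < d) (hm : 0 < m)
    (U : Set (Vc d)) (hU : IsOpen U)
    (f : (Vc d) → Vc m) (θ : Vc (d + m))
    (x₀ : Vc d) (hx₀ : x₀ ∈ U)
    (hnd : IsNondegenerateAt (fullMap d m f) x₀) :
    ∃ rV : ℝ, 0 < rV ∧ Bl x₀ rV ⊆ U ∧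
    ∃ C₀ : ℝ, 0 < C₀ ∧ ∃ K₀ : ℝ, 0 < K₀ ∧
      ∀ z : Vc d, ∀ r : ℝ, 0 < r → Bl z r ⊆ Bl x₀ rV →
        ∃ t₀ : ℕ, ∀ t : ℕ, t₀ ≤ t → ∀ ε : ℝ, 0 < ε → ε < 1 →
          K₀ * Real.exp (-(etaND (d + m) d) * t) < ε →
          eR ((1 : ℝ) / 2) * volume (Bl z r) ≤
            volume (DeltaCal f θ t ε (Bl z r)
              ((C₀ / (ε ^ m * Real.exp (((d : ℝ) + 1) * t))) ^ ((1 : ℝ) / d))) := by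
  obtain ⟨R, hR, C, hTay, σ1, hσ1, hsmall⟩ := DSM.small_grad hd hm f x₀ hnd
  obtain ⟨σ2, hσ2, hlarge⟩ := DSM.large_grad hd hTay
  obtain ⟨RU, hRU, hballU⟩ := Metric.isOpen_iff.1 hU x₀ hx₀
  set D : ℝ := 20 ^ (d + m + 1) with hD
  have hD2 : 2 ≤ D := by
    calc (2 : ℝ) ≤ 20 ^ 1 := by norm_num
      _ ≤ D := by rw [hD]; gcongr <;> [norm_num; omega]
  set N : ℝ := 2 ^ (d + m + 1) with hN
  have hN1 : 1 ≤ N := one_le_pow₀ (by norm_num)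
  have hN0 : 0 < N := by linarith
  set A : ℝ := 4 * N with hA
  have hA1 : 1 ≤ A := by linarith
  have hA0 : 0 < A := by linarith
  set σ : ℝ := min (min σ1 σ2) 1 with hσdef
  have hσ : 0 < σ := by positivity
  set κ : ℝ := σ / A ^ (m + 1) with hκ
  have hκ0 : 0 < κ := by positivity
  have hC := hTay.hC
  set G : ℝ := 1 + 18 * C * N ^ 2 / κ ^ 2 with hG
  have hG1 : 1 ≤ G := by rw [hG]; linarith [show 0 ≤ 18 * C * N ^ 2 / κ ^ 2 by positivity]
  set K0 : ℝ := 1 + 2 * A ^ 2 + A ^ (d + m) / σ + G ^ d with hK0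
  have p1 : 0 < A ^ (d + m) / σ := by positivity
  have p2 : 0 < G ^ d := by positivity
  have p3 : 0 < A ^ 2 := by positivity
  refine ⟨min RU (R / (2 * (1 + 4 * D))), by positivity, (Metric.ball_subset_ball (min_le_left _ _)).trans hballU, (3 * N / κ) ^ d, by positivity, K0, by linarith, ?_⟩
  intro z r hr hsub
  set rV := min RU (R / (2 * (1 + 4 * D))) with hrV
  have hrV2 : rV * (2 * (1 + 4 * D)) ≤ R := by
    rw [← le_div_iff₀ (by positivity)]; exact min_le_right _ _
  have hz : dist z x₀ < rV := hsub (Metric.mem_ball_self hr)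
  have hrr : r ≤ 4 * rV := by
    set y : Vc d := fun i => z i + r / 2 with hy
    have hyz : dist y z = r / 2 := by
      apply le_antisymm
      · rw [dist_pi_le_iff (by positivity)]
        intro i; rw [hy, Real.dist_eq]; simp only [add_sub_cancel_left]; rw [abs_of_pos (by positivity)]
      · refine le_trans ?_ (dist_le_pi_dist y z ⟨0, hd⟩)
        rw [hy, Real.dist_eq]; simp only [add_sub_cancel_left]; exact le_abs_self _
    have hy2 : y ∈ Bl z r := by rw [Metric.mem_ball, hyz]; linarith
    have := hsub hy2
    rw [Metric.mem_ball] at this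
    have := dist_triangle y x₀ z
    rw [dist_comm x₀ z] at this
    linarith
  have hrV0 : 0 < rV := by linarith
  have hzr : dist z x₀ + D * r < R := by nlinarith
  obtain ⟨δ0, hδ0, hS⟩ := hsmall z r hr hzr
  obtain ⟨L, hL, hLg⟩ := hlarge z r hr (by nlinarith)
  set Y : ℝ := A / δ0 + 2 * A / r + (L / κ) ^ (d * (m + 1)) + (12 * d * N / (κ * r)) ^ 2 with hY
  refine ⟨⌈Y⌉₊, ?_⟩
  intro t ht ε hε hε1 hKε
  have htY : Y ≤ t := (Nat.le_ceil Y).trans (by exact_mod_cast ht)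
  have hEt : (t : ℝ) + 1 ≤ Real.exp t := Real.add_one_le_exp _
  have ht0 : (0 : ℝ) ≤ t := by positivity
  have q1 : 0 < A / δ0 := by positivity
  have q2 : 0 < 2 * A / r := by positivity
  have q3 : 0 < (L / κ) ^ (d * (m + 1)) := by positivity
  have q4 : 0 ≤ (12 * d * N / (κ * r)) ^ 2 := by positivity
  have hE := Real.exp_pos (t : ℝ)
  have c1 := DSM.pw (by linarith) ht0 hKε le_rfl (DSM.eta_le_one hd hm)
  have c2 : 1 < d → K0 ≤ ε ^ (d + m - 1) * Real.exp t := fun h => by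
    simpa using DSM.pw (by linarith) ht0 hKε (by omega) (DSM.eta_n (m := m) h)
  have c3 := DSM.pw (by linarith) ht0 hKε (by omega) (DSM.eta_c hd hm)
  rw [pow_one, pow_one] at c1
  set K : ℝ := κ * (ε ^ m * Real.exp t) ^ ((d : ℝ)⁻¹) with hKdef
  have hK : 0 < K := by positivity
  have hKd : K ^ d = κ ^ d * (ε ^ m * Real.exp t) := by
    rw [hKdef, mul_pow, Real.rpow_inv_natCast_pow (by positivity) hd.ne']
  have hKE := DSM.KE_lower hd hκ0 hε hE hK hKd (by linarith) (by linarith : G ^ d ≤ K0) c3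
  rw [DSM.rho_eq hd hκ0 hε hN0 hK hKd]
  set ρ : ℝ := 3 * N / (K * Real.exp t) with hρ
  have hρ0 : 0 < ρ := by positivity
  have hρ2 : ρ ^ 2 * (κ ^ 2 * G * Real.exp t) ≤ 9 * N ^ 2 * ε := by
    calc ρ ^ 2 * (κ ^ 2 * G * Real.exp t) ≤ ρ ^ 2 * ((K * Real.exp t) ^ 2 * ε) := by gcongr
      _ = _ := by rw [hρ]; field_simp; ring
  have hCρ : Real.exp t * (C * ρ ^ 2) ≤ ε / 2 := by
    have g1 : 18 * C * N ^ 2 ≤ κ ^ 2 * G := by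
      rw [hG, mul_add, mul_div_cancel₀ _ (by positivity)]; linarith [sq_nonneg κ]
    have g2 : C * (ρ ^ 2 * (κ ^ 2 * G * Real.exp t)) ≤ C * (9 * N ^ 2 * ε) := by gcongr
    have g3 : (κ ^ 2 * G) * (Real.exp t * (C * ρ ^ 2)) ≤ (κ ^ 2 * G) * (ε / 2) := by
      calc (κ ^ 2 * G) * (Real.exp t * (C * ρ ^ 2)) = C * (ρ ^ 2 * (κ ^ 2 * G * Real.exp t)) := by ring
        _ ≤ _ := g2
        _ = (18 * C * N ^ 2) * (ε / 2) := by ring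
        _ ≤ _ := by gcongr
    exact le_of_mul_le_mul_left g3 (by positivity)
  have hρr : 4 * d * ρ ≤ r := by
    have g1 : ρ ^ 2 * κ ^ 2 * Real.exp t ≤ 9 * N ^ 2 := by
      calc ρ ^ 2 * κ ^ 2 * Real.exp t = ρ ^ 2 * (κ ^ 2 * 1 * Real.exp t) := by ring
        _ ≤ ρ ^ 2 * (κ ^ 2 * G * Real.exp t) := by gcongr
        _ ≤ _ := hρ2.trans (mul_le_of_le_one_right (by positivity) hε1.le)
    have g2 : (12 * d * N / (κ * r)) ^ 2 ≤ Real.exp t := by linarith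
    rw [div_pow, div_le_iff₀ (by positivity)] at g2
    refine le_of_sq_le_sq ?_ hr.le
    have g3 : Real.exp t * κ ^ 2 * (4 * d * ρ) ^ 2 ≤ Real.exp t * κ ^ 2 * r ^ 2 := by
      calc Real.exp t * κ ^ 2 * (4 * d * ρ) ^ 2 = 16 * d ^ 2 * (ρ ^ 2 * κ ^ 2 * Real.exp t) := by ring
        _ ≤ 16 * d ^ 2 * (9 * N ^ 2) := by gcongr
        _ = (12 * d * N) ^ 2 := by ring
        _ ≤ _ := g2
        _ = _ := by ring
    exact le_of_mul_le_mul_left g3 (by positivity)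
  have hbad := DSM.bad_meas hd hm hS hLg hr hδ0 hσ ((min_le_left _ _).trans (min_le_left _ _)) ((min_le_left _ _).trans (min_le_right _ _))
    (min_le_right _ _) hA1 (by linarith : 1 ≤ Real.exp (t : ℝ)) hε hε1 hκ hK hKd hL c1 c2 (by linarith) (by linarith) (by linarith) (by linarith) (by linarith)
  have hTay2 := hTay.mono (S' := Bl z r) (by
    intro x hx
    rw [Metric.mem_ball] at hx ⊢
    nlinarith [dist_triangle x z x₀])
  have hcov : Bl z (r - ρ) ⊆ DeltaCal f θ t ε (Bl z r) ρ ∪ DSM.Bad f (DSM.DD f) z r (A / Real.exp t) K (A / ε) := by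
    intro x hx
    by_cases hb : x ∈ DSM.Bad f (DSM.DD f) z r (A / Real.exp t) K (A / ε)
    · exact Or.inr hb
    · exact Or.inl (DSM.cover hTay2 θ hN hε hK hρ hCρ hx hb)
  have hv := (DSM.vol_shrink hd (z := z) hr hρ0 hρr).trans ((measure_mono hcov).trans (measure_union_le _ _))
  have hv2 := hv.trans (add_le_add_right hbad _)
  have e34 : eR (3 / 4) * volume (Bl z r) = eR (1 / 2) * volume (Bl z r) + eR (1 / 4) * volume (Bl z r) := by
    rw [← add_mul, ← ENNReal.ofReal_add (by norm_num) (by norm_num)]; norm_num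
  rw [e34] at hv2
  exact (ENNReal.add_le_add_iff_right (ENNReal.mul_ne_top ENNReal.ofReal_ne_top measure_ball_lt_top.ne)).1 hv2

end DSM

end NN

theorem delta_set_large_measure
    {d m : ℕ} (hd : 0 < d) (hm : 0 < m)
    (U : Set (Fin d → ℝ)) (hU : IsOpen U)
    (f : (Fin d → ℝ) → Fin m → ℝ) (θ : Fin (d + m) → ℝ)
    (x₀ : Fin d → ℝ) (hx₀ : x₀ ∈ U)
    (hnd : IsNondegenerateAt (fullMap d m f) x₀) :
    ∃ rV : ℝ, 0 < rV ∧ Metric.ball x₀ rV ⊆ U ∧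
    ∃ C₀ : ℝ, 0 < C₀ ∧ ∃ K₀ : ℝ, 0 < K₀ ∧
      ∀ z : Fin d → ℝ, ∀ r : ℝ, 0 < r → Metric.ball z r ⊆ Metric.ball x₀ rV →
        ∃ t₀ : ℕ, ∀ t : ℕ, t₀ ≤ t → ∀ ε : ℝ, 0 < ε → ε < 1 →
          K₀ * Real.exp (-(etaND (d + m) d) * t) < ε →
          ENNReal.ofReal ((1 : ℝ) / 2) * volume (Metric.ball z r) ≤
            volume (DeltaCal f θ t ε (Metric.ball z r)
              ((C₀ / (ε ^ m * Real.exp (((d : ℝ) + 1) * t))) ^ ((1 : ℝ) / d))) := by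
  exact DSM.main_aux hd hm U hU f θ x₀ hx₀ hnd
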